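/- arXiv:math/0405156 — 15 statements merged into one kernel-verified Lean document; each statement's English description precedes it below -/
import Mathlib

section
/- Let K be a field with algebraic closure K_a, and let f ∈ K[t] be a separable irreducible polynomial of degree 7 whose set of roots ℛ_f ⊂ K_a satisfies: the image of the absolute Galois group Gal(K_a/K) in the group of permutations of ℛ_f is the full symmetric group S₇ or the alternating group A₇. Then the 7-element set B_f = {(α³ : α : 1) : α ∈ ℛ_f} of points of the projective plane over K_a is in general position; that is: (i) there do not exist three distinct roots α₁, α₂, α₃ ∈ ℛ_f and a triple (a,b,c) ∈ K_a³ with (a,b,c) ≠ (0,0,0) such that a·αᵢ³ + b·αᵢ + c = 0 for i = 1,2,3; and (ii) there do not exist six distinct roots α₁, …, α₆ ∈ ℛ_f and a nonzero homogeneous quadratic form q ∈ K_a[x,y,z] such that q(αⱼ³, αⱼ, 1) = 0 for j = 1, …, 6. -/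
open Polynomial
open scoped Classical

/-- The permutation of the set of roots of `f` in `Ka` induced by an element
of the absolute Galois group `Gal(Ka/K)`. -/
noncomputable def galRootPerm (K Ka : Type*) [Field K] [Field Ka] [Algebra K Ka]
    (f : Polynomial K) : (Ka ≃ₐ[K] Ka) →* Equiv.Perm (f.rootSet Ka) :=
  MonoidHom.mk'
    (fun σ =>
      { toFun := Set.MapsTo.restrict σ _ _ (f.rootSet_mapsTo σ.toAlgHom)
        invFun := Set.MapsTo.restrict σ.symm _ _ (f.rootSet_mapsTo σ.symm.toAlgHom)
        left_inv := fun x => by ext; exact σ.symm_apply_apply x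
        right_inv := fun x => by ext; exact σ.apply_symm_apply x })
    (fun σ τ => by ext x; rfl)

theorem galRootPerm_apply_coe {K Ka : Type*} [Field K] [Field Ka] [Algebra K Ka]
    (f : Polynomial K) (σ : Ka ≃ₐ[K] Ka) (x : f.rootSet Ka) :
    (galRootPerm K Ka f σ x : Ka) = σ x := rfl

/-- If the Galois group contains all even permutations of the roots, then every three-cycle of
roots is induced by an automorphism. -/
theorem exists_algEquiv_threeCycle {K Ka : Type*} [Field K] [Field Ka] [Algebra K Ka]
    {f : Polynomial K} (hbig : alternatingGroup (f.rootSet Ka) ≤ (galRootPerm K Ka f).range)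
    {x y z : Ka} (hx : x ∈ f.rootSet Ka) (hy : y ∈ f.rootSet Ka) (hz : z ∈ f.rootSet Ka)
    (hxy : x ≠ y) (hxz : x ≠ z) (hyz : y ≠ z) :
    ∃ σ : Ka ≃ₐ[K] Ka, σ x = y ∧ σ z = x ∧
      ∀ w ∈ f.rootSet Ka, w ≠ x → w ≠ y → w ≠ z → σ w = w := by
  have hxy' : (⟨x, hx⟩ : f.rootSet Ka) ≠ ⟨y, hy⟩ := by simpa using hxy
  have hxz' : (⟨x, hx⟩ : f.rootSet Ka) ≠ ⟨z, hz⟩ := by simpa using hxz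
  have hyz' : (⟨y, hy⟩ : f.rootSet Ka) ≠ ⟨z, hz⟩ := by simpa using hyz
  obtain ⟨σ, hσ⟩ := hbig
    (Equiv.Perm.isThreeCycle_swap_mul_swap_same hxz' hxy' hyz'.symm).mem_alternatingGroup
  have key (w : f.rootSet Ka) : σ w = ((Equiv.swap (⟨x, hx⟩ : f.rootSet Ka) ⟨z, hz⟩ *
      Equiv.swap (⟨x, hx⟩ : f.rootSet Ka) ⟨y, hy⟩) w : f.rootSet Ka) := by
    rw [← hσ, galRootPerm_apply_coe]
  refine ⟨σ, ?_, ?_, fun w hw hwx hwy hwz => ?_⟩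
  · simpa [Equiv.swap_apply_of_ne_of_ne hxy'.symm hyz'] using key ⟨x, hx⟩
  · simpa [Equiv.swap_apply_of_ne_of_ne hxz'.symm hyz'.symm] using key ⟨z, hz⟩
  · have h := key ⟨w, hw⟩
    rwa [Equiv.Perm.mul_apply,
      Equiv.swap_apply_of_ne_of_ne (x := (⟨w, hw⟩ : f.rootSet Ka)) (a := ⟨x, hx⟩) (b := ⟨y, hy⟩)
        (by simpa) (by simpa),
      Equiv.swap_apply_of_ne_of_ne (by simpa) (by simpa)] at h

/-- If the Galois group contains all even permutations of the roots, then no nonempty proper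
subset of the (at least three) roots sums to zero. -/
theorem sum_ne_zero_of_subset_rootSet {K Ka : Type*} [Field K] [Field Ka] [Algebra K Ka]
    {f : Polynomial K} (hbig : alternatingGroup (f.rootSet Ka) ≤ (galRootPerm K Ka f).range)
    (hcard : 3 ≤ Fintype.card (f.rootSet Ka)) {T : Finset Ka} (hT : ↑T ⊆ f.rootSet Ka)
    (hne : T.Nonempty) (hlt : T.card < Fintype.card (f.rootSet Ka)) :
    ∑ w ∈ T, w ≠ 0 := by
  rw [← Set.toFinset_card] at hcard hlt
  intro hsum
  obtain ⟨x, hxT⟩ := hne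
  obtain ⟨y, hy, hyT⟩ := Finset.exists_mem_notMem_of_card_lt_card hlt
  obtain ⟨z, hz, hzxy⟩ := Finset.exists_mem_notMem_of_card_lt_card
    (lt_of_le_of_lt Finset.card_le_two hcard : ({x, y} : Finset Ka).card < _)
  simp only [Finset.mem_insert, Finset.mem_singleton, not_or] at hzxy
  rw [Set.mem_toFinset] at hy hz
  have hxy : x ≠ y := ne_of_mem_of_not_mem hxT hyT
  obtain ⟨σ, hσx, hσz, hσ⟩ := exists_algEquiv_threeCycle hbig (hT hxT) hy hz hxy
    (Ne.symm hzxy.1) (Ne.symm hzxy.2)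
  have hσsum : ∑ w ∈ T, σ w = 0 := by rw [← map_sum, hsum, map_zero]
  rw [← Finset.add_sum_erase _ _ hxT] at hsum hσsum
  by_cases hzT : z ∈ T
  · have hz' : z ∈ T.erase x := Finset.mem_erase.2 ⟨hzxy.1, hzT⟩
    rw [← Finset.add_sum_erase _ _ hz'] at hsum hσsum
    rw [Finset.sum_congr rfl fun w hw => hσ w ?_ ?_ ?_ ?_, hσx, hσz] at hσsum
    · exact hzxy.2 (by linear_combination hsum - hσsum)
    all_goals grind
  · rw [Finset.sum_congr rfl fun w hw => hσ w ?_ ?_ ?_ ?_, hσx] at hσsum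
    · exact hxy (by linear_combination hsum - hσsum)
    all_goals grind

/-- A nonzero polynomial of degree at most `n + 1` without term of degree `n` whose roots
include `n + 1` distinct elements has these elements summing to zero. -/
theorem Polynomial.sum_eq_zero_of_coeff_eq_zero {F : Type*} [Field F] {p : F[X]} (hp : p ≠ 0)
    {n : ℕ} (hdeg : p.natDegree ≤ n + 1) (hcoeff : p.coeff n = 0) {T : Finset F}
    (hT : T.card = n + 1) (hroot : ∀ x ∈ T, p.eval x = 0) : ∑ x ∈ T, x = 0 := by
  have hroots := roots_eq_of_natDegree_le_card_of_ne_zero hroot (hT ▸ hdeg) hp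
  have hnat : p.natDegree = n + 1 :=
    le_antisymm hdeg (by simpa [hroots, hT] using p.card_roots')
  have hs : p.Splits := splits_iff_card_roots.2 (by simp [hroots, hT, hnat])
  have h := hs.nextCoeff_eq_neg_sum_roots_mul_leadingCoeff
  rw [nextCoeff_of_natDegree_pos (by omega), hnat, Nat.add_sub_cancel, hcoeff, hroots] at h
  simpa [hp, Finset.sum_val] using h

/-- The restriction of a nonzero conic to the cuspidal cubic `t ↦ (t³ : t : 1)` is a nonzero
polynomial of degree at most six without term of degree five. -/
theorem exists_eval_cuspidalCubic_of_isHomogeneous {F : Type*} [Field F]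
    {q : MvPolynomial (Fin 3) F} (hq : q.IsHomogeneous 2) (hq0 : q ≠ 0) :
    ∃ p : F[X], p ≠ 0 ∧ p.natDegree ≤ 6 ∧ p.coeff 5 = 0 ∧
      ∀ t, p.eval t = MvPolynomial.eval ![t ^ 3, t, 1] q := by
  have hdeg {d : Fin 3 →₀ ℕ} (hd : d ∈ q.support) : d 0 + d 1 + d 2 = 2 := by
    have := hq (MvPolynomial.mem_support_iff.1 hd)
    simpa [Finsupp.weight_apply, Finsupp.sum_fintype, Fin.sum_univ_three] using this
  refine ⟨∑ d ∈ q.support, C (q.coeff d) * X ^ (3 * d 0 + d 1), ?_, ?_, ?_, ?_⟩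
  · obtain ⟨e, he⟩ := MvPolynomial.ne_zero_iff.1 hq0
    intro h0
    have h := congrArg (fun p => coeff p (3 * e 0 + e 1)) h0
    have heS := MvPolynomial.mem_support_iff.2 he
    simp only [finsetSum_coeff, coeff_C_mul_X_pow, coeff_zero] at h
    rw [Finset.sum_eq_single_of_mem e heS, if_pos rfl] at h
    · exact he h
    · refine fun d hd hde => if_neg fun hk => hde ?_
      have h1 := hdeg hd
      have h2 := hdeg heS
      ext i
      fin_cases i <;> simp <;> omega
  · refine natDegree_sum_le_of_forall_le _ _ fun d hd => (natDegree_C_mul_X_pow_le _ _).trans ?_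
    have := hdeg hd
    omega
  · rw [finsetSum_coeff]
    refine Finset.sum_eq_zero fun d hd => ?_
    rw [coeff_C_mul_X_pow, if_neg]
    have := hdeg hd
    omega
  · intro t
    simp [eval_finsetSum, MvPolynomial.eval_eq', Fin.prod_univ_three, pow_add, pow_mul]

/-- Zarhin, "Del Pezzo surfaces of degree 2 and jacobians without complex multiplication",
Lemma 3 (`general`): if `f ∈ K[t]` is a separable irreducible polynomial of degree 7 whose
Galois group, viewed as a subgroup of the permutations of the set of roots of `f` in an
algebraic closure `Ka`, is the full symmetric group `S₇` or the alternating group `A₇`,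
then the 7 points `(α³ : α : 1)`, `α` a root of `f`, are in general position in `ℙ²(Ka)`:
no three of them lie on a line, and no six of them lie on a conic. -/
theorem statement0 {K Ka : Type*} [Field K] [Field Ka] [Algebra K Ka] [IsAlgClosure K Ka]
    (f : Polynomial K) (hirr : Irreducible f) (hsep : f.Separable) (hdeg : f.natDegree = 7)
    (hbig : (galRootPerm K Ka f).range = ⊤ ∨
      (galRootPerm K Ka f).range = alternatingGroup (f.rootSet Ka)) :
    (¬ ∃ α₁ α₂ α₃ : Ka, α₁ ∈ f.rootSet Ka ∧ α₂ ∈ f.rootSet Ka ∧ α₃ ∈ f.rootSet Ka ∧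
        α₁ ≠ α₂ ∧ α₁ ≠ α₃ ∧ α₂ ≠ α₃ ∧
        ∃ a b c : Ka, ¬(a = 0 ∧ b = 0 ∧ c = 0) ∧
          a * α₁ ^ 3 + b * α₁ + c = 0 ∧ a * α₂ ^ 3 + b * α₂ + c = 0 ∧
          a * α₃ ^ 3 + b * α₃ + c = 0) ∧
    (¬ ∃ α : Fin 6 → Ka, (∀ j, α j ∈ f.rootSet Ka) ∧ Function.Injective α ∧
        ∃ q : MvPolynomial (Fin 3) Ka, q ≠ 0 ∧ q.IsHomogeneous 2 ∧
          ∀ j, MvPolynomial.eval ![α j ^ 3, α j, 1] q = 0) := by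
  have hK := IsAlgClosure.isAlgClosed (R := K) (K := Ka)
  have halt : alternatingGroup (f.rootSet Ka) ≤ (galRootPerm K Ka f).range := by
    rcases hbig with h | h <;> simp [h]
  have hcard : Fintype.card (f.rootSet Ka) = 7 := by
    rw [card_rootSet_eq_natDegree hsep (IsAlgClosed.splits _), hdeg]
  constructor
  · rintro ⟨α₁, α₂, α₃, h₁, h₂, h₃, h₁₂, h₁₃, h₂₃, a, b, c, h0, e₁, e₂, e₃⟩
    have hT : ({α₁, α₂, α₃} : Finset Ka).card = 3 := Finset.card_eq_three.2
      ⟨_, _, _, h₁₂, h₁₃, h₂₃, rfl⟩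
    refine sum_ne_zero_of_subset_rootSet halt (by omega) (T := {α₁, α₂, α₃})
      (by simp [Set.insert_subset_iff, h₁, h₂, h₃]) (by simp) (by omega) ?_
    refine Polynomial.sum_eq_zero_of_coeff_eq_zero (n := 2)
      (p := C a * X ^ 3 + C b * X + C c) (fun hp => h0 ⟨?_, ?_, ?_⟩) (by compute_degree)
      (by simp) hT (by simp [e₁, e₂, e₃])
    · simpa [coeff_X, coeff_C] using congrArg (fun p => coeff p 3) hp
    · simpa [coeff_C] using congrArg (fun p => coeff p 1) hp
    · simpa using congrArg (fun p => coeff p 0) hp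
  · rintro ⟨α, hα, hinj, q, hq0, hq, he⟩
    obtain ⟨p, hp0, hpdeg, hp5, hp⟩ := exists_eval_cuspidalCubic_of_isHomogeneous hq hq0
    have hT : (Finset.univ.image α).card = 6 := by
      simp [Finset.card_image_of_injective _ hinj]
    refine sum_ne_zero_of_subset_rootSet halt (by omega) (T := Finset.univ.image α)
      (by simpa [Set.range_subset_iff] using hα) (by simp) (by omega) ?_
    exact Polynomial.sum_eq_zero_of_coeff_eq_zero hp0 hpdeg hp5 hT (by simp [hp, he])
end

section
/- Let K be a field with algebraic closure K_a, and let f ∈ K[t] be a separable irreducible polynomial of degree 7 whose set of roots ℛ_f ⊂ K_a satisfies: the image of Gal(K_a/K) in the group of permutations of ℛ_f is the full symmetric group S₇ or the alternating group A₇. Then no three points of B_f = {(α³ : α : 1) : α ∈ ℛ_f} lie on a line: there do not exist three distinct roots α₁, α₂, α₃ ∈ ℛ_f and (a,b,c) ∈ K_a³ with (a,b,c) ≠ (0,0,0) such that a·αᵢ³ + b·αᵢ + c = 0 for i = 1,2,3. -/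
open Polynomial
open scoped Classical

/-- If three points `(x³, x)` with distinct parameters lie on a line, the parameters sum to zero. -/
theorem add_add_eq_zero_of_cubic_collinear {F : Type*} [Field F] {x y z a b c : F}
    (hxy : x ≠ y) (hxz : x ≠ z) (hyz : y ≠ z) (habc : ¬(a = 0 ∧ b = 0 ∧ c = 0))
    (hx : a * x ^ 3 + b * x + c = 0) (hy : a * y ^ 3 + b * y + c = 0)
    (hz : a * z ^ 3 + b * z + c = 0) : x + y + z = 0 := by
  have h₁ : a * (x ^ 2 + x * y + y ^ 2) + b = 0 :=
    mul_left_cancel₀ (sub_ne_zero.2 hxy) (by linear_combination hx - hy)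
  have h₂ : a * (x ^ 2 + x * z + z ^ 2) + b = 0 :=
    mul_left_cancel₀ (sub_ne_zero.2 hxz) (by linear_combination hx - hz)
  have h₃ : a * (x + y + z) = 0 :=
    mul_left_cancel₀ (sub_ne_zero.2 hyz) (by linear_combination h₁ - h₂)
  refine (mul_eq_zero.1 h₃).resolve_left fun ha => habc ?_
  have hb : b = 0 := by simpa [ha] using h₁
  exact ⟨ha, hb, by simpa [ha, hb] using hx⟩

/-- On at least five points, an even permutation can move a point while fixing any two others. -/
theorem exists_mem_alternatingGroup_fix_fix_move {X : Type*} [Fintype X] [DecidableEq X]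
    (hX : 5 ≤ Fintype.card X) {x y z : X} (hxz : x ≠ z) (hyz : y ≠ z) :
    ∃ g ∈ alternatingGroup X, g x = x ∧ g y = y ∧ g z ≠ z := by
  obtain ⟨u, hu⟩ : ∃ u, u ∉ ({x, y, z} : Finset X) := by
    by_contra! h
    have := Finset.card_le_three (a := x) (b := y) (c := z)
    rw [Finset.eq_univ_iff_forall.2 h, Finset.card_univ] at this
    omega
  obtain ⟨v, hv⟩ : ∃ v, v ∉ ({x, y, z, u} : Finset X) := by
    by_contra! h
    have := Finset.card_le_four (a := x) (b := y) (c := z) (d := u)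
    rw [Finset.eq_univ_iff_forall.2 h, Finset.card_univ] at this
    omega
  simp only [Finset.mem_insert, Finset.mem_singleton, not_or] at hu hv
  obtain ⟨hux, huy, huz⟩ := hu
  obtain ⟨hvx, hvy, hvz, hvu⟩ := hv
  refine ⟨Equiv.swap z u * Equiv.swap z v, ?_, ?_, ?_, ?_⟩
  · rw [Equiv.Perm.mem_alternatingGroup, Equiv.Perm.sign_mul,
      Equiv.Perm.sign_swap (Ne.symm huz), Equiv.Perm.sign_swap (Ne.symm hvz)]
    simp
  · simp [Equiv.swap_apply_of_ne_of_ne hxz (Ne.symm hvx),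
      Equiv.swap_apply_of_ne_of_ne hxz (Ne.symm hux)]
  · simp [Equiv.swap_apply_of_ne_of_ne hyz (Ne.symm hvy),
      Equiv.swap_apply_of_ne_of_ne hyz (Ne.symm huy)]
  · simpa [Equiv.swap_apply_of_ne_of_ne hvz hvu] using hvz

/-- No three of the points `(α³ : α : 1)`, `α` a root of `f`, lie on a line, when `f` is a
separable irreducible degree-7 polynomial over `K` whose Galois group acts on the roots
as `S₇` or `A₇`. -/
theorem statement1 {K Ka : Type*} [Field K] [Field Ka] [Algebra K Ka] [IsAlgClosure K Ka]
    (f : Polynomial K) (hirr : Irreducible f) (hsep : f.Separable) (hdeg : f.natDegree = 7)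
    (hbig : (galRootPerm K Ka f).range = ⊤ ∨
      (galRootPerm K Ka f).range = alternatingGroup (f.rootSet Ka)) :
    ¬ ∃ α₁ α₂ α₃ : Ka, α₁ ∈ f.rootSet Ka ∧ α₂ ∈ f.rootSet Ka ∧ α₃ ∈ f.rootSet Ka ∧
        α₁ ≠ α₂ ∧ α₁ ≠ α₃ ∧ α₂ ≠ α₃ ∧
        ∃ a b c : Ka, ¬(a = 0 ∧ b = 0 ∧ c = 0) ∧
          a * α₁ ^ 3 + b * α₁ + c = 0 ∧ a * α₂ ^ 3 + b * α₂ + c = 0 ∧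
          a * α₃ ^ 3 + b * α₃ + c = 0 := by
  rintro ⟨x, y, z, hx, hy, hz, hxy, hxz, hyz, a, b, c, habc, ex, ey, ez⟩
  have hsum := add_add_eq_zero_of_cubic_collinear hxy hxz hyz habc ex ey ez
  have : IsAlgClosed Ka := IsAlgClosure.isAlgClosed K
  have hcard : Fintype.card (f.rootSet Ka) = 7 :=
    (card_rootSet_eq_natDegree hsep (IsAlgClosed.splits _)).trans hdeg
  obtain ⟨g, hg, gx, gy, gz⟩ := exists_mem_alternatingGroup_fix_fix_move
    (X := f.rootSet Ka) (by omega) (x := ⟨x, hx⟩) (y := ⟨y, hy⟩) (z := ⟨z, hz⟩)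
    (by simpa using hxz) (by simpa using hyz)
  have hrange : g ∈ (galRootPerm K Ka f).range := by
    rcases hbig with h | h <;> rw [h]
    · exact Subgroup.mem_top g
    · exact hg
  obtain ⟨σ, rfl⟩ := hrange
  have sx : σ x = x := congrArg Subtype.val gx
  have sy : σ y = y := congrArg Subtype.val gy
  have sz : σ z ≠ z := fun h => gz (Subtype.ext h)
  have hsum' := congrArg σ hsum
  rw [map_add, map_add, sx, sy, map_zero] at hsum'
  exact sz (by linear_combination hsum' - hsum)
end

section
/- Let K be a field with algebraic closure K_a, and let f ∈ K[t] be an irreducible polynomial of degree 7. Then no six points of B_f = {(α³ : α : 1) : α a root of f in K_a} lie on a conic: there do not exist six distinct roots α₁, …, α₆ ∈ K_a of f and a nonzero homogeneous quadratic form q ∈ K_a[x,y,z] such that q(αⱼ³, αⱼ, 1) = 0 for j = 1, …, 6. -/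
open Polynomial

/-- The polynomial obtained by restricting a ternary form to the curve `t ↦ (t³ : t : 1)`. -/
noncomputable def cuspRestriction {L : Type*} [Field L] (q : MvPolynomial (Fin 3) L) : L[X] :=
  MvPolynomial.aeval ![X ^ 3, X, 1] q

lemma cuspRestriction_eval {L : Type*} [Field L] (q : MvPolynomial (Fin 3) L) (a : L) :
    (cuspRestriction q).eval a = MvPolynomial.eval ![a ^ 3, a, 1] q := by
  rw [cuspRestriction, ← coe_evalRingHom, MvPolynomial.aeval_def, MvPolynomial.hom_eval₂,
    ← MvPolynomial.eval₂_id]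
  congr 1
  · ext; simp
  · funext i; fin_cases i <;> simp

lemma cuspRestriction_coeff {L : Type*} [Field L] (q : MvPolynomial (Fin 3) L) (n : ℕ) :
    (cuspRestriction q).coeff n =
      ∑ d ∈ q.support, if n = 3 * d 0 + d 1 then q.coeff d else 0 := by
  rw [cuspRestriction, MvPolynomial.aeval_def, MvPolynomial.eval₂_eq', finsetSum_coeff]
  refine Finset.sum_congr rfl fun d _ => ?_
  simp [Fin.prod_univ_three, ← pow_mul, ← pow_add, coeff_C_mul, coeff_X_pow]

lemma sum_eq_two_of_mem_support {L : Type*} [Field L] {q : MvPolynomial (Fin 3) L}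
    (hq : q.IsHomogeneous 2) {d : Fin 3 →₀ ℕ} (hd : d ∈ q.support) : d 0 + d 1 + d 2 = 2 := by
  have h := hq (MvPolynomial.mem_support_iff.mp hd)
  rw [← Fin.sum_univ_three, ← h, ← Finsupp.degree_eq_sum]
  exact DFunLike.congr_fun Finsupp.degree_eq_weight_one d

lemma cuspRestriction_ne_zero {L : Type*} [Field L] {q : MvPolynomial (Fin 3) L}
    (hq : q.IsHomogeneous 2) (h0 : q ≠ 0) : cuspRestriction q ≠ 0 := by
  obtain ⟨d, hd⟩ := MvPolynomial.support_nonempty.mpr h0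
  intro h
  have hc := cuspRestriction_coeff q (3 * d 0 + d 1)
  rw [h, coeff_zero, Finset.sum_eq_single_of_mem d hd, if_pos rfl] at hc
  · exact MvPolynomial.mem_support_iff.mp hd hc.symm
  · intro e he hne
    have h1 := sum_eq_two_of_mem_support hq hd
    have h2 := sum_eq_two_of_mem_support hq he
    refine if_neg fun h3 => hne ?_
    ext i
    fin_cases i <;> simp <;> omega

lemma cuspRestriction_natDegree_le {L : Type*} [Field L] {q : MvPolynomial (Fin 3) L}
    (hq : q.IsHomogeneous 2) : (cuspRestriction q).natDegree ≤ 6 := by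
  rw [natDegree_le_iff_coeff_eq_zero]
  intro n hn
  rw [cuspRestriction_coeff]
  refine Finset.sum_eq_zero fun d hd => if_neg ?_
  have := sum_eq_two_of_mem_support hq hd
  omega

lemma cuspRestriction_coeff_five {L : Type*} [Field L] {q : MvPolynomial (Fin 3) L}
    (hq : q.IsHomogeneous 2) : (cuspRestriction q).coeff 5 = 0 := by
  rw [cuspRestriction_coeff]
  refine Finset.sum_eq_zero fun d hd => if_neg ?_
  have := sum_eq_two_of_mem_support hq hd
  omega

lemma prod_X_sub_C_dvd_of_injective {L ι : Type*} [Field L] [Fintype ι] {α : ι → L}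
    (hα : Function.Injective α) {p : L[X]} (hp : ∀ j, p.eval (α j) = 0) :
    ∏ j, (X - C (α j)) ∣ p :=
  Finset.prod_dvd_of_coprime (fun _ _ _ _ hij => pairwise_coprime_X_sub_C hα hij)
    fun j _ => dvd_iff_isRoot.mpr (hp j)

/-- No six of the points `(α³ : α : 1)`, `α` a root in the algebraic closure `Ka` of an
irreducible degree-7 polynomial `f ∈ K[t]`, lie on a conic: no nonzero homogeneous
quadratic form over `Ka` vanishes at six such points with distinct `α`'s. -/
theorem statement2 {K Ka : Type*} [Field K] [Field Ka] [Algebra K Ka] [IsAlgClosure K Ka]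
    (f : Polynomial K) (hirr : Irreducible f) (hdeg : f.natDegree = 7) :
    ¬ ∃ α : Fin 6 → Ka, (∀ j, α j ∈ f.rootSet Ka) ∧ Function.Injective α ∧
        ∃ q : MvPolynomial (Fin 3) Ka, q ≠ 0 ∧ q.IsHomogeneous 2 ∧
          ∀ j, MvPolynomial.eval ![α j ^ 3, α j, 1] q = 0 := by
  rintro ⟨α, hroot, hα, q, hq0, hq, hqα⟩
  obtain ⟨g, hg⟩ := prod_X_sub_C_dvd_of_injective hα (p := cuspRestriction q)
    fun j => (cuspRestriction_eval q (α j)).trans (hqα j)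
  obtain ⟨h, hh⟩ := prod_X_sub_C_dvd_of_injective hα (p := f.map (algebraMap K Ka))
    fun j => by rw [eval_map_algebraMap]; exact aeval_eq_zero_of_mem_rootSet (hroot j)
  set P : Ka[X] := ∏ j, (X - C (α j)) with hP
  have hPm : P.Monic := monic_prod_X_sub_C α _
  have hPd : P.natDegree = 6 := by simp [hP]
  have hP6 : P.coeff 6 = 1 := by rw [← hPd]; exact hPm
  have hP7 : P.coeff 7 = 0 := coeff_eq_zero_of_natDegree_lt (by omega)
  have hP5 : P.coeff 5 = 0 := by
    have hgd := cuspRestriction_natDegree_le hq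
    have hg0 : g ≠ 0 := by
      rintro rfl
      exact cuspRestriction_ne_zero hq hq0 (by simpa using hg)
    rw [hg, hPm.natDegree_mul' hg0, hPd] at hgd
    have h5 := cuspRestriction_coeff_five hq
    rw [hg, eq_C_of_natDegree_eq_zero (p := g) (by omega), coeff_mul_C] at h5
    refine (mul_eq_zero.mp h5).resolve_right fun h => hg0 ?_
    rw [eq_C_of_natDegree_eq_zero (p := g) (by omega), h, C_0]
  have hf7 : f.coeff 7 ≠ 0 := by
    rw [← hdeg]
    exact leadingCoeff_ne_zero.mpr hirr.ne_zero
  have hh0 : h ≠ 0 := by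
    rintro rfl
    rw [mul_zero, Polynomial.map_eq_zero] at hh
    exact hirr.ne_zero hh
  have hhd : h.natDegree ≤ 1 := by
    have := congrArg natDegree hh
    rw [natDegree_map, hPm.natDegree_mul' hh0, hPd, hdeg] at this
    omega
  obtain ⟨c, d, rfl⟩ := exists_eq_X_add_C_of_natDegree_le_one hhd
  rw [mul_add, ← mul_assoc, mul_comm P, mul_assoc] at hh
  have hc := congrArg (coeff · 7) hh
  have hd := congrArg (coeff · 6) hh
  simp only [coeff_map, coeff_add, coeff_C_mul, coeff_mul_C, coeff_mul_X, hP5, hP6, hP7] at hc hd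
  have hK : f.eval (-f.coeff 6 / f.coeff 7) = 0 := by
    apply (algebraMap K Ka).injective
    have hne : algebraMap K Ka (f.coeff 7) ≠ 0 := by simpa using hf7
    rw [← eval_map_apply, hh, map_zero]
    simp only [eval_add, eval_mul, eval_C, eval_X, map_div₀, map_neg, hd]
    rw [hc] at hne ⊢
    simp only [mul_one, mul_zero, zero_mul, one_mul, zero_add, add_zero] at hne ⊢
    field_simp
    ring
  have : f.natDegree = 1 :=
    natDegree_eq_of_degree_eq_some (degree_eq_one_of_irreducible_of_root hirr hK)
  omega
end

section
/- Let K be a field with algebraic closure K_a, and let f ∈ K[t] be a separable irreducible polynomial of degree 7 whose set of roots ℛ_f ⊂ K_a satisfies: the image of Gal(K_a/K) in the group of permutations of ℛ_f is the full symmetric group S₇ or the alternating group A₇. Then no three distinct roots of f have sum zero: for all distinct α₁, α₂, α₃ ∈ ℛ_f one has α₁ + α₂ + α₃ ≠ 0. -/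
open Polynomial
open scoped Classical

/-- If the Galois group contains every even permutation of the roots, then any three distinct
roots `x`, `y`, `z` of `f` can be moved by an automorphism fixing `x` and `y` and not `z`. -/
theorem exists_algEquiv_fix_fix_ne {K Ka : Type*} [Field K] [Field Ka] [Algebra K Ka]
    (f : Polynomial K) (hcard : 5 ≤ Fintype.card (f.rootSet Ka))
    (hbig : alternatingGroup (f.rootSet Ka) ≤ (galRootPerm K Ka f).range)
    {x y z : f.rootSet Ka} (hxz : x ≠ z) (hyz : y ≠ z) :
    ∃ σ : Ka ≃ₐ[K] Ka, σ x = x ∧ σ y = y ∧ σ z ≠ z := by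
  have exists_notMem (s : Finset (f.rootSet Ka)) (hs : s.card ≤ 4) : ∃ b, b ∉ s := by
    by_contra! h
    have := Finset.card_univ (α := f.rootSet Ka)
    rw [← Finset.eq_univ_of_forall h] at this
    omega
  obtain ⟨b, hb⟩ := exists_notMem {x, y, z} (Finset.card_le_three.trans (by norm_num))
  obtain ⟨c, hc⟩ := exists_notMem {x, y, z, b} Finset.card_le_four
  simp only [Finset.mem_insert, Finset.mem_singleton, not_or] at hb hc
  obtain ⟨hbx, hby, hbz⟩ := hb
  obtain ⟨hcx, hcy, hcz, hcb⟩ := hc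
  have hmem : Equiv.swap z b * Equiv.swap b c ∈ alternatingGroup (f.rootSet Ka) := by
    rw [Equiv.Perm.mem_alternatingGroup, map_mul, Equiv.Perm.sign_swap (Ne.symm hbz),
      Equiv.Perm.sign_swap (Ne.symm hcb)]
    norm_num
  obtain ⟨σ, hσ⟩ := hbig hmem
  have apply_eq (w : f.rootSet Ka) :
      σ w = ((Equiv.swap z b * Equiv.swap b c) w : f.rootSet Ka) := by
    rw [← hσ]
    rfl
  refine ⟨σ, ?_, ?_, ?_⟩
  · rw [apply_eq, Equiv.Perm.mul_apply, Equiv.swap_apply_of_ne_of_ne (Ne.symm hbx) (Ne.symm hcx),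
      Equiv.swap_apply_of_ne_of_ne hxz (Ne.symm hbx)]
  · rw [apply_eq, Equiv.Perm.mul_apply, Equiv.swap_apply_of_ne_of_ne (Ne.symm hby) (Ne.symm hcy),
      Equiv.swap_apply_of_ne_of_ne hyz (Ne.symm hby)]
  · rw [apply_eq, Equiv.Perm.mul_apply, Equiv.swap_apply_of_ne_of_ne (Ne.symm hbz) (Ne.symm hcz),
      Equiv.swap_apply_left]
    exact fun h => hbz (Subtype.ext h)

/-- No three distinct roots of `f` have sum zero, when `f` is a separable irreducible
degree-7 polynomial over `K` whose Galois group acts on the roots as `S₇` or `A₇`. -/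
theorem statement3 {K Ka : Type*} [Field K] [Field Ka] [Algebra K Ka] [IsAlgClosure K Ka]
    (f : Polynomial K) (hirr : Irreducible f) (hsep : f.Separable) (hdeg : f.natDegree = 7)
    (hbig : (galRootPerm K Ka f).range = ⊤ ∨
      (galRootPerm K Ka f).range = alternatingGroup (f.rootSet Ka)) :
    ∀ α₁ α₂ α₃ : Ka, α₁ ∈ f.rootSet Ka → α₂ ∈ f.rootSet Ka → α₃ ∈ f.rootSet Ka →
      α₁ ≠ α₂ → α₁ ≠ α₃ → α₂ ≠ α₃ → α₁ + α₂ + α₃ ≠ 0 := by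
  intro α₁ α₂ α₃ h₁ h₂ h₃ _ h₁₃ h₂₃ hsum
  have : IsAlgClosed Ka := IsAlgClosure.isAlgClosed K
  have hcard : Fintype.card (f.rootSet Ka) = 7 := by
    rw [← hdeg]
    exact card_rootSet_eq_natDegree hsep (IsAlgClosed.splits _)
  have hle : alternatingGroup (f.rootSet Ka) ≤ (galRootPerm K Ka f).range := by
    rcases hbig with h | h
    · exact h ▸ le_top
    · exact h.ge
  obtain ⟨σ, hσ₁, hσ₂, hσ₃⟩ := exists_algEquiv_fix_fix_ne f (by omega) hle
    (x := ⟨α₁, h₁⟩) (y := ⟨α₂, h₂⟩) (z := ⟨α₃, h₃⟩)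
    (fun h => h₁₃ (congrArg Subtype.val h)) (fun h => h₂₃ (congrArg Subtype.val h))
  have hσsum := congrArg σ hsum
  rw [map_add, map_add, map_zero, hσ₁, hσ₂, ← hsum] at hσsum
  exact hσ₃ (add_left_cancel hσsum)
end

section
/- Let Q = {φ : Fin 7 → 𝔽₂ : Σ_b φ(b) = 0}, a 6-dimensional 𝔽₂-vector space, with the alternating group A₇ = alternatingGroup (Fin 7) acting by σ·φ = φ ∘ σ⁻¹. Then Q is a simple A₇-module: every 𝔽₂-subspace U ⊆ Q with σ·u ∈ U for all σ ∈ A₇ and u ∈ U satisfies U = 0 or U = Q. -/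
/-- The 6-dimensional `𝔽₂`-vector space `Q` of functions `φ : Fin 7 → 𝔽₂` with
`∑ b, φ b = 0`, as a submodule of `Fin 7 → 𝔽₂`. -/
def Q7 : Submodule (ZMod 2) (Fin 7 → ZMod 2) where
  carrier := {φ | ∑ b, φ b = 0}
  add_mem' := by
    intro a b ha hb
    simp only [Set.mem_setOf_eq, Pi.add_apply, Finset.sum_add_distrib] at *
    rw [ha, hb, add_zero]
  zero_mem' := by simp
  smul_mem' := by
    intro c φ hφ
    simp only [Set.mem_setOf_eq, Pi.smul_apply, smul_eq_mul, ← Finset.mul_sum] at *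
    rw [hφ, mul_zero]

section PermutationModule

variable {ι : Type*} [Fintype ι] [DecidableEq ι] {U : Submodule (ZMod 2) (ι → ZMod 2)}

theorem comp_swap_mul_swap_mem
    (hinv : ∀ σ : Equiv.Perm ι, σ ∈ alternatingGroup ι → ∀ u ∈ U, (fun b => u (σ⁻¹ b)) ∈ U)
    {x y z : ι} (hxy : x ≠ y) (hxz : x ≠ z) {u : ι → ZMod 2} (hu : u ∈ U) :
    (fun b => u ((Equiv.swap x y * Equiv.swap x z) b)) ∈ U := by
  have h : (Equiv.swap x y * Equiv.swap x z)⁻¹ ∈ alternatingGroup ι := by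
    simp [Equiv.Perm.mem_alternatingGroup, Equiv.Perm.sign_swap hxy, Equiv.Perm.sign_swap hxz]
  simpa only [inv_inv] using hinv _ h u hu

/-- A stable subspace containing a vector with `u a = u c ≠ u b` contains `e_a + e_b`. -/
theorem single_add_single_mem_of_ne
    (hinv : ∀ σ : Equiv.Perm ι, σ ∈ alternatingGroup ι → ∀ u ∈ U, (fun b => u (σ⁻¹ b)) ∈ U)
    {u : ι → ZMod 2} (hu : u ∈ U) {a b c : ι} (hac : a ≠ c) (huac : u a = u c)
    (huab : u a ≠ u b) : (Pi.single a 1 + Pi.single b 1 : ι → ZMod 2) ∈ U := by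
  have hab : a ≠ b := fun h => huab (h ▸ rfl)
  have hbc : b ≠ c := fun h => huab (h ▸ huac)
  have two : ∀ p q : ZMod 2, p ≠ q → q - p = 1 := by decide
  convert U.sub_mem (comp_swap_mul_swap_mem hinv hab.symm hbc hu) hu using 1
  funext t
  by_cases hta : t = a
  · subst hta
    simp [hab, Equiv.swap_apply_of_ne_of_ne hab hac, two _ _ huab]
  by_cases htb : t = b
  · subst htb
    simp [hab.symm, Equiv.swap_apply_of_ne_of_ne hbc.symm hac.symm, ← huac, two _ _ huab.symm]
  by_cases htc : t = c
  · subst htc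
    simp [hac.symm, hbc.symm, huac]
  · simp [hta, htb, htc, Equiv.swap_apply_of_ne_of_ne]

/-- A stable subspace containing `e_a + e_b` with `a ≠ b` contains `e_a + e_c` for all `c`. -/
theorem single_add_single_mem
    (hinv : ∀ σ : Equiv.Perm ι, σ ∈ alternatingGroup ι → ∀ u ∈ U, (fun b => u (σ⁻¹ b)) ∈ U)
    {a b : ι} (hab : a ≠ b) (h : (Pi.single a 1 + Pi.single b 1 : ι → ZMod 2) ∈ U) (c : ι) :
    (Pi.single a 1 + Pi.single c 1 : ι → ZMod 2) ∈ U := by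
  by_cases hca : c = a
  · subst hca
    rw [ZModModule.add_self]
    exact U.zero_mem
  by_cases hcb : c = b
  · exact hcb ▸ h
  · exact single_add_single_mem_of_ne hinv h hab (by simp [hab, hab.symm])
      (by simp [hab, hca, hcb])

/-- The vectors `e_a + e_c` span the sum-zero vectors. -/
theorem mem_of_sum_eq_zero {a : ι}
    (h : ∀ c, (Pi.single a 1 + Pi.single c 1 : ι → ZMod 2) ∈ U) {φ : ι → ZMod 2}
    (hφ : ∑ b, φ b = 0) : φ ∈ U := by
  have key : φ = ∑ c, φ c • (Pi.single a 1 + Pi.single c 1 : ι → ZMod 2) := by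
    simp only [smul_add, Finset.sum_add_distrib, ← Finset.sum_smul, hφ, zero_smul, zero_add]
    exact pi_eq_sum_univ' φ
  rw [key]
  exact U.sum_mem fun c _ => U.smul_mem _ (h c)

end PermutationModule

/-- `Q = {φ : Fin 7 → 𝔽₂ | ∑ b, φ b = 0}` is a simple module for the alternating group
`A₇` acting by permutation of coordinates: any `𝔽₂`-subspace `U ⊆ Q` stable under the
action of `A₇` is `0` or all of `Q`. -/
theorem statement7 (U : Submodule (ZMod 2) (Fin 7 → ZMod 2)) (hUQ : U ≤ Q7)
    (hinv : ∀ σ : Equiv.Perm (Fin 7), σ ∈ alternatingGroup (Fin 7) →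
      ∀ u ∈ U, (fun b => u (σ⁻¹ b)) ∈ U) :
    U = ⊥ ∨ U = Q7 := by
  refine or_iff_not_imp_left.2 fun hU => le_antisymm hUQ fun φ hφ => ?_
  obtain ⟨u, hu, hu0⟩ := U.exists_mem_ne_zero_of_ne_bot hU
  obtain ⟨i, hi⟩ := Function.ne_iff.1 hu0
  have eq_one : ∀ p : ZMod 2, p ≠ 0 → p = 1 := by decide
  obtain ⟨j, hj⟩ : ∃ j, u j = 0 := by
    by_contra! hne
    have hsum : ∑ b, u b = 0 := hUQ hu
    simp only [fun b => eq_one _ (hne b)] at hsum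
    exact absurd hsum (by decide)
  have hij : u i ≠ u j := by rwa [hj]
  obtain ⟨k, hki, hkj⟩ : ∃ k, k ≠ i ∧ k ≠ j := by
    clear hj hi hij
    revert i j
    decide
  obtain ⟨a, b, hab, h⟩ : ∃ a b : Fin 7, a ≠ b ∧
      (Pi.single a 1 + Pi.single b 1 : Fin 7 → ZMod 2) ∈ U := by
    have hne : i ≠ j := fun h => hij (h ▸ rfl)
    by_cases hk : u k = 0
    · exact ⟨j, i, hne.symm,
        single_add_single_mem_of_ne hinv hu hkj.symm (hj.trans hk.symm) hij.symm⟩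
    · exact ⟨i, j, hne, single_add_single_mem_of_ne hinv hu hki.symm
        ((eq_one _ hi).trans (eq_one _ hk).symm) hij⟩
  exact mem_of_sum_eq_zero (single_add_single_mem hinv hab h) hφ
end

section
/- Let Q = {φ : Fin 7 → 𝔽₂ : Σ_b φ(b) = 0} with the alternating group A₇ = alternatingGroup (Fin 7) acting by σ·φ = φ ∘ σ⁻¹. Then End_{A₇}(Q) = 𝔽₂: every 𝔽₂-linear map e : Q → Q satisfying e(σ·φ) = σ·e(φ) for all σ ∈ A₇ and φ ∈ Q is either the zero map or the identity map. -/
/-- The action of a permutation `σ` of `Fin 7` on `Q7`, `(σ·φ)(b) = φ(σ⁻¹ b)`. -/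
def permQ (σ : Equiv.Perm (Fin 7)) (φ : Q7) : Q7 :=
  ⟨fun b => (φ : Fin 7 → ZMod 2) (σ⁻¹ b), by
    have h : ((φ : Fin 7 → ZMod 2) ∈ Q7) := φ.2
    simp only [Q7, Submodule.mem_mk, AddSubmonoid.mem_mk, AddSubsemigroup.mem_mk,
      Set.mem_setOf_eq] at h ⊢
    rw [Equiv.sum_comp σ⁻¹ (φ : Fin 7 → ZMod 2)]
    exact h⟩

theorem mem_Q7 {φ : Fin 7 → ZMod 2} : φ ∈ Q7 ↔ ∑ b, φ b = 0 := Iff.rfl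

/-- The indicator function of `{i, j}`, for `i ≠ j`, as an element of `Q7`; it is `0` for
`i = j`. -/
def pairQ (i j : Fin 7) : Q7 :=
  ⟨Pi.single i 1 + Pi.single j 1, by
    rw [mem_Q7]
    simp only [Pi.add_apply, Finset.sum_add_distrib, Finset.sum_pi_single', Finset.mem_univ]
    exact CharTwo.add_self_eq_zero 1⟩

theorem pairQ_apply (i j b : Fin 7) :
    (pairQ i j : Fin 7 → ZMod 2) b = (if b = i then 1 else 0) + if b = j then 1 else 0 := by
  simp [pairQ, Pi.single_apply]

theorem pairQ_self (i : Fin 7) : pairQ i i = 0 := by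
  ext b
  simp [pairQ_apply, CharTwo.add_self_eq_zero]

theorem pairQ_add_pairQ (i j k : Fin 7) : pairQ i j + pairQ j k = pairQ i k := by
  ext b
  simp only [Submodule.coe_add, Pi.add_apply, pairQ_apply]
  linear_combination CharTwo.add_self_eq_zero (if b = j then (1 : ZMod 2) else 0)

theorem permQ_swap_mul_swap_pairQ {i j k l : Fin 7} (hki : k ≠ i) (hkj : k ≠ j) (hli : l ≠ i)
    (hlj : l ≠ j) : permQ (Equiv.swap i j * Equiv.swap k l) (pairQ i j) = pairQ i j := by
  ext b
  simp only [permQ, pairQ_apply, mul_inv_rev, Equiv.swap_inv, Equiv.Perm.mul_apply,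
    Equiv.swap_apply_def]
  grind

/-- An element of `Q7` is the sum of the `pairQ i j` over its support. -/
theorem sum_smul_pairQ (i : Fin 7) (φ : Q7) :
    ∑ j, (φ : Fin 7 → ZMod 2) j • pairQ i j = φ := by
  ext b
  have h := mem_Q7.1 φ.2
  simp [pairQ_apply, mul_add, Finset.sum_add_distrib, h]

/-- A vector of `Q7` invariant under all `(i j)(k l)` is a multiple of `pairQ i j`. -/
theorem eq_smul_pairQ_of_invariant {i j : Fin 7} (hij : i ≠ j) {w : Q7}
    (hw : ∀ k l, k ≠ l → k ≠ i → k ≠ j → l ≠ i → l ≠ j →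
      permQ (Equiv.swap i j * Equiv.swap k l) w = w) :
    w = (w : Fin 7 → ZMod 2) i • pairQ i j := by
  have hval : ∀ k l, k ≠ l → k ≠ i → k ≠ j → l ≠ i → l ≠ j → ∀ b,
      (w : Fin 7 → ZMod 2) (Equiv.swap k l (Equiv.swap i j b)) = (w : Fin 7 → ZMod 2) b := by
    intro k l hkl hki hkj hli hlj b
    simpa [permQ] using congrFun (congrArg Subtype.val (hw k l hkl hki hkj hli hlj)) b
  obtain ⟨k, l, hkl, hki, hkj, hli, hlj⟩ :
      ∃ k l : Fin 7, k ≠ l ∧ k ≠ i ∧ k ≠ j ∧ l ≠ i ∧ l ≠ j := by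
    clear hw hval
    revert i j
    decide
  have hj : (w : Fin 7 → ZMod 2) j = (w : Fin 7 → ZMod 2) i := by
    have := hval k l hkl hki hkj hli hlj i
    rwa [Equiv.swap_apply_left, Equiv.swap_apply_of_ne_of_ne hkj.symm hlj.symm] at this
  have hm : ∀ m, m ≠ i → m ≠ j → (w : Fin 7 → ZMod 2) m = (w : Fin 7 → ZMod 2) k := by
    intro m hmi hmj
    rcases eq_or_ne m k with rfl | hmk
    · rfl
    · have := hval m k hmk hmi hmj hki hkj k
      rwa [Equiv.swap_apply_of_ne_of_ne hki hkj, Equiv.swap_apply_right] at this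
  have hform : ∀ b, (w : Fin 7 → ZMod 2) b =
      if b = i ∨ b = j then (w : Fin 7 → ZMod 2) i else (w : Fin 7 → ZMod 2) k := by
    intro b
    grind
  have hk : (w : Fin 7 → ZMod 2) k = 0 := by
    have h := mem_Q7.1 w.2
    rw [Finset.sum_congr rfl fun b _ => hform b] at h
    generalize (w : Fin 7 → ZMod 2) i = x at h
    generalize (w : Fin 7 → ZMod 2) k = y at h ⊢
    clear hform hm hj hval hw hkl hki hkj hli hlj
    revert i j x y
    decide
  ext b
  rw [hform b, hk]
  simp only [Submodule.coe_smul, Pi.smul_apply, pairQ_apply, smul_eq_mul]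
  grind

/-- `End_{A₇}(Q) = 𝔽₂`: every `𝔽₂`-linear endomorphism of
`Q = {φ : Fin 7 → 𝔽₂ | ∑ b, φ b = 0}` commuting with the permutation action of the
alternating group `A₇` is either zero or the identity. -/
theorem statement8 (e : Q7 →ₗ[ZMod 2] Q7)
    (he : ∀ σ ∈ alternatingGroup (Fin 7), ∀ φ : Q7, e (permQ σ φ) = permQ σ (e φ)) :
    e = 0 ∨ e = LinearMap.id := by
  have hsm : ∀ i j, i ≠ j → e (pairQ i j) = (e (pairQ i j) : Fin 7 → ZMod 2) i • pairQ i j := by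
    intro i j hij
    refine eq_smul_pairQ_of_invariant hij fun k l hkl hki hkj hli hlj => ?_
    rw [← he _ _ _, permQ_swap_mul_swap_pairQ hki hkj hli hlj]
    simp [Equiv.Perm.mem_alternatingGroup, Equiv.Perm.sign_swap hij, Equiv.Perm.sign_swap hkl]
  have hconst : ∀ j, j ≠ 0 →
      (e (pairQ 0 j) : Fin 7 → ZMod 2) 0 = (e (pairQ 0 1) : Fin 7 → ZMod 2) 0 := by
    intro j hj
    rcases eq_or_ne j 1 with rfl | hj1
    · rfl
    · have h : (e (pairQ 1 j) : Fin 7 → ZMod 2) 0 = 0 := by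
        rw [hsm 1 j hj1.symm]
        simp [pairQ_apply, hj.symm]
      rw [← pairQ_add_pairQ 0 1 j, map_add, Submodule.coe_add, Pi.add_apply, h, add_zero]
  have hpair : ∀ j, e (pairQ 0 j) = (e (pairQ 0 1) : Fin 7 → ZMod 2) 0 • pairQ 0 j := by
    intro j
    rcases eq_or_ne j 0 with rfl | hj
    · simp [pairQ_self]
    · rw [← hconst j hj]
      exact hsm 0 j hj.symm
  have hscalar : ∀ φ, e φ = (e (pairQ 0 1) : Fin 7 → ZMod 2) 0 • φ := by
    intro φ
    conv_lhs => rw [← sum_smul_pairQ 0 φ]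
    conv_rhs => rw [← sum_smul_pairQ 0 φ]
    rw [map_sum, Finset.smul_sum]
    refine Finset.sum_congr rfl fun j _ => ?_
    rw [map_smul, hpair, smul_comm]
  have hc : ∀ c : ZMod 2, c = 0 ∨ c = 1 := by decide
  rcases hc ((e (pairQ 0 1) : Fin 7 → ZMod 2) 0) with h | h
  · left
    refine LinearMap.ext fun φ => ?_
    rw [hscalar, h, zero_smul, LinearMap.zero_apply]
  · right
    refine LinearMap.ext fun φ => ?_
    rw [hscalar, h, one_smul, LinearMap.id_apply]
end

section
/- The alternating group A₇ = alternatingGroup (Fin 7) admits no symplectic irreducible 6-dimensional complex representation: if V is a complex vector space of dimension 6 and ρ : A₇ → GL(V) is a group homomorphism such that the only ρ-invariant subspaces of V are 0 and V, then there is no nondegenerate alternating bilinear form B : V × V → ℂ with B(ρ(g)v, ρ(g)w) = B(v, w) for all g ∈ A₇ and v, w ∈ V. -/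
section KleinFourAction

variable {V : Type*} [AddCommGroup V] [Module ℂ V]

/-- The simultaneous eigenspace of `a` and `b` for the eigenvalues `1` and `s`. -/
def jointEigenspace (a b : V →ₗ[ℂ] V) (s : ℂ) : Submodule ℂ V :=
  LinearMap.ker (a - LinearMap.id) ⊓ LinearMap.ker (b - s • LinearMap.id)

lemma mem_jointEigenspace {a b : V →ₗ[ℂ] V} {s : ℂ} {v : V} :
    v ∈ jointEigenspace a b s ↔ a v = v ∧ b v = s • v := by
  simp [jointEigenspace, sub_eq_zero]

variable {a b c : V →ₗ[ℂ] V}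

/-- A vector of the sign eigenspace, moved by the order-three map, lies in the other two
nontrivial eigenspaces. -/
lemma map_jointEigenspace (hca : ∀ v, c (a v) = b (c v))
    (hcb : ∀ v, c (b v) = a (b (c v))) {v : V} (hv : v ∈ jointEigenspace a b (-1)) :
    (a (c v) = -c v ∧ b (c v) = c v) ∧ (a (c (c v)) = -c (c v) ∧ b (c (c v)) = -c (c v)) := by
  obtain ⟨h1, h2⟩ := mem_jointEigenspace.1 hv
  have e1 : b (c v) = c v := by rw [← hca, h1]
  have e2 : a (c v) = -c v := by
    have := hcb v
    rw [h2, e1] at this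
    simpa using this.symm
  have e3 : b (c (c v)) = -c (c v) := by rw [← hca, e2, map_neg]
  have e4 : a (c (c v)) = -c (c v) := by
    have := hcb (c v)
    rw [e1, e3, map_neg] at this
    exact (neg_eq_iff_eq_neg.2 this).symm
  exact ⟨⟨e2, e1⟩, e4, e3⟩

/-- The invariants of a Klein four-group together with three copies of its sign eigenspace, the
latter being permuted by `c`. -/
def kleinSum (a b c : V →ₗ[ℂ] V) :
    (jointEigenspace a b 1 × jointEigenspace a b (-1) × jointEigenspace a b (-1) ×
      jointEigenspace a b (-1)) →ₗ[ℂ] V :=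
  (Submodule.subtype _).coprod ((Submodule.subtype _).coprod
    ((c ∘ₗ Submodule.subtype _).coprod (c ∘ₗ c ∘ₗ Submodule.subtype _)))

lemma kleinSum_apply (x y z w) :
    kleinSum a b c (x, y, z, w) = (x : V) + (y + (c z + c (c w))) := rfl

lemma kleinSum_bijective (ha : ∀ v, a (a v) = v) (hb : ∀ v, b (b v) = v)
    (hab : ∀ v, a (b v) = b (a v)) (hc : ∀ v, c (c (c v)) = v) (hca : ∀ v, c (a v) = b (c v))
    (hcb : ∀ v, c (b v) = a (b (c v))) : Function.Bijective (kleinSum a b c) := by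
  constructor
  · rw [← LinearMap.ker_eq_bot, LinearMap.ker_eq_bot']
    rintro ⟨⟨x, hx⟩, ⟨y, hy⟩, ⟨z, hz⟩, ⟨w, hw⟩⟩ h
    rw [kleinSum_apply] at h
    simp only at h
    obtain ⟨⟨z1, z2⟩, -⟩ := map_jointEigenspace hca hcb hz
    obtain ⟨-, w1, w2⟩ := map_jointEigenspace hca hcb hw
    obtain ⟨x1, x2⟩ := mem_jointEigenspace.1 hx
    obtain ⟨y1, y2⟩ := mem_jointEigenspace.1 hy
    have h1 := congrArg a h
    have h2 := congrArg b h
    have h3 := congrArg a h2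
    simp only [map_add, map_neg, map_smul, map_zero, x1, x2, y1, y2, z1, z2, w1, w2] at h1 h2 h3
    have ex : x = 0 := by
      linear_combination (norm := module) (1/4 : ℂ) • h + (1/4 : ℂ) • h1 + (1/4 : ℂ) • h2 +
        (1/4 : ℂ) • h3
    have ey : y = 0 := by
      linear_combination (norm := module) (1/4 : ℂ) • h + (1/4 : ℂ) • h1 - (1/4 : ℂ) • h2 -
        (1/4 : ℂ) • h3
    have ez : c z = 0 := by
      linear_combination (norm := module) (1/4 : ℂ) • h - (1/4 : ℂ) • h1 + (1/4 : ℂ) • h2 -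
        (1/4 : ℂ) • h3
    have ew : c (c w) = 0 := by
      linear_combination (norm := module) (1/4 : ℂ) • h - (1/4 : ℂ) • h1 - (1/4 : ℂ) • h2 +
        (1/4 : ℂ) • h3
    have ez' : z = 0 := by rw [← hc z, ez, map_zero, map_zero]
    have ew' : w = 0 := by rw [← hc w, ew, map_zero]
    simp [ex, ey, ez', ew']
  · intro v
    have mem0 : ∀ v, (1/4 : ℂ) • (v + a v + b v + a (b v)) ∈ jointEigenspace a b 1 := by
      intro v
      rw [mem_jointEigenspace]
      simp only [map_smul, map_add, ha, ← hab, hb]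
      constructor <;> module
    have mem1 : ∀ v, (1/4 : ℂ) • (v + a v - b v - a (b v)) ∈ jointEigenspace a b (-1) := by
      intro v
      rw [mem_jointEigenspace]
      simp only [map_smul, map_add, map_sub, ha, ← hab, hb]
      constructor <;> module
    refine ⟨(⟨_, mem0 v⟩, ⟨_, mem1 v⟩, ⟨_, mem1 (c (c v))⟩, ⟨_, mem1 (c v)⟩), ?_⟩
    rw [kleinSum_apply]
    simp only [map_smul, map_add, map_sub, hca, hcb, hc, hab, hb]
    module

/-- If the Klein four-group generated by `a` and `b` preserves a symplectic form on a
six-dimensional space, and `c` normalizes it by a three-cycle of its involutions, then either `a`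
is the identity, or there are no invariants and the sign eigenspace is a plane. -/
lemma jointEigenspace_finrank (hdim : Module.finrank ℂ V = 6) (ha : ∀ v, a (a v) = v)
    (hb : ∀ v, b (b v) = v)
    (hab : ∀ v, a (b v) = b (a v)) (hc : ∀ v, c (c (c v)) = v) (hca : ∀ v, c (a v) = b (c v))
    (hcb : ∀ v, c (b v) = a (b (c v))) (B : V →ₗ[ℂ] V →ₗ[ℂ] ℂ) (hB : ∀ v, B v v = 0)
    (hnd : ∀ v, (∀ w, B v w = 0) → v = 0) (hBa : ∀ v w, B (a v) (a w) = B v w)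
    (hBb : ∀ v w, B (b v) (b w) = B v w) :
    (∀ v, a v = v) ∨ (jointEigenspace a b 1 = ⊥ ∧
      Module.finrank ℂ (jointEigenspace a b (-1)) = 2 ∧
      ∀ v ∈ jointEigenspace a b (-1), (∀ w ∈ jointEigenspace a b (-1), B v w = 0) → v = 0) := by
  have : Module.Finite ℂ V := Module.finite_of_finrank_pos (by omega)
  have hbij := kleinSum_bijective ha hb hab hc hca hcb
  have hrank := (LinearEquiv.ofBijective _ hbij).finrank_eq
  simp only [Module.finrank_prod, hdim] at hrank
  have hnd' : ∀ v ∈ jointEigenspace a b (-1),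
      (∀ w ∈ jointEigenspace a b (-1), B v w = 0) → v = 0 := by
    intro v hv h
    obtain ⟨v1, v2⟩ := mem_jointEigenspace.1 hv
    refine hnd v fun u ↦ ?_
    obtain ⟨⟨⟨x, hx⟩, ⟨y, hy⟩, ⟨z, hz⟩, ⟨w, hw⟩⟩, rfl⟩ := hbij.2 u
    obtain ⟨⟨z1, z2⟩, -⟩ := map_jointEigenspace hca hcb hz
    obtain ⟨-, w1, w2⟩ := map_jointEigenspace hca hcb hw
    obtain ⟨x1, x2⟩ := mem_jointEigenspace.1 hx
    rw [kleinSum_apply]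
    have ex := hBb v x
    have ez := hBa v (c z)
    have ew := hBa v (c (c w))
    simp only [v1, v2, x2, z1, w1, map_neg, LinearMap.neg_apply, neg_smul, one_smul,
      neg_eq_self] at ex ez ew
    simp only [map_add, ex, ez, ew, h y hy, add_zero]
  have hcases : Module.finrank ℂ (jointEigenspace a b (-1)) = 0 ∨
      Module.finrank ℂ (jointEigenspace a b (-1)) = 1 ∨
      Module.finrank ℂ (jointEigenspace a b (-1)) = 2 := by omega
  rcases hcases with h | h | h
  · left
    have hbot := Submodule.finrank_eq_zero.1 h
    intro u
    obtain ⟨⟨⟨x, hx⟩, ⟨y, hy⟩, ⟨z, hz⟩, ⟨w, hw⟩⟩, rfl⟩ := hbij.2 u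
    rw [kleinSum_apply]
    rw [hbot, Submodule.mem_bot] at hy hz hw
    simp [hy, hz, hw, (mem_jointEigenspace.1 hx).1]
  · exfalso
    obtain ⟨⟨v, hv⟩, hv0, hspan⟩ := finrank_eq_one_iff'.1 h
    refine hv0 (Subtype.ext (hnd' v hv fun w hw ↦ ?_))
    obtain ⟨r, hr⟩ := hspan ⟨w, hw⟩
    obtain rfl : r • v = w := congrArg Subtype.val hr
    rw [map_smul, hB, smul_zero]
  · right
    exact ⟨Submodule.finrank_eq_zero.1 (by omega), h, hnd'⟩

/-- A symplectic transformation of order three of a plane that fixes a nonzero vector is the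
identity. -/
lemma fixes_plane_of_fixes_vector {W : Submodule ℂ V} (hW : Module.finrank ℂ W = 2)
    {B : V →ₗ[ℂ] V →ₗ[ℂ] ℂ} (hB : ∀ v, B v v = 0)
    (hnd : ∀ v ∈ W, (∀ w ∈ W, B v w = 0) → v = 0) {d : V →ₗ[ℂ] V}
    (hd : ∀ v, d (d (d v)) = v) (hBd : ∀ v w, B (d v) (d w) = B v w)
    (hdW : ∀ v ∈ W, d v ∈ W) {v : V} (hv : v ∈ W) (hv0 : v ≠ 0) (hdv : d v = v) :
    ∀ w ∈ W, d w = w := by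
  have : Module.Finite ℂ W := Module.finite_of_finrank_pos (by omega)
  obtain ⟨u, hu, huv⟩ : ∃ u ∈ W, B v u ≠ 0 := by
    by_contra! h
    exact hv0 (hnd v hv h)
  have hli : LinearIndependent ℂ ![(⟨v, hv⟩ : W), ⟨u, hu⟩] := by
    rw [LinearIndependent.pair_iff]
    intro s t h
    have h : s • v + t • u = 0 := congrArg Subtype.val h
    have ht : t = 0 := by
      have := congrArg (B v) h
      simpa [hB, huv] using this
    subst ht
    simpa [hv0] using h
  have hspan := hli.span_eq_top_of_card_eq_finrank' (by simp [hW])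
  have hcomb : ∀ w ∈ W, ∃ s t : ℂ, s • v + t • u = w := by
    intro w hw
    have : (⟨w, hw⟩ : W) ∈ Submodule.span ℂ (Set.range ![(⟨v, hv⟩ : W), ⟨u, hu⟩]) := by
      rw [hspan]; trivial
    rw [Matrix.range_cons, Matrix.range_cons, Matrix.range_empty, Set.union_empty,
      Set.singleton_union, Submodule.mem_span_pair] at this
    obtain ⟨s, t, h⟩ := this
    exact ⟨s, t, congrArg Subtype.val h⟩
  have hdu : d u = u := by
    obtain ⟨s, t, h⟩ := hcomb (d u) (hdW u hu)
    have ht : t = 1 := by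
      have := hBd v u
      rw [hdv, ← h] at this
      simp only [map_add, map_smul, hB, smul_eq_mul, mul_zero, zero_add] at this
      exact mul_right_cancel₀ huv (by rw [this, one_mul])
    subst ht
    have h3 := hd u
    simp only [← h, map_add, map_smul, hdv, one_smul] at h3
    have hs : (3 * s) • v = 0 := by
      linear_combination (norm := module) h3
    have : s = 0 := by simpa [hv0] using hs
    rw [← h, this]
    simp
  intro w hw
  obtain ⟨s, t, rfl⟩ := hcomb w hw
  simp [hdv, hdu]

/-- Suppose `a`, `b`, `c` generate an action of `A₄` and `d` is an order-three map commuting with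
it, all preserving a symplectic form on a six-dimensional space. If `d` has a nonzero fixed vector
as soon as `c` does, then `a` or `d` is the identity. -/
lemma eq_id_or_eq_id_of_symplectic {d : V →ₗ[ℂ] V} (hdim : Module.finrank ℂ V = 6)
    (ha : ∀ v, a (a v) = v) (hb : ∀ v, b (b v) = v)
    (hab : ∀ v, a (b v) = b (a v)) (hc : ∀ v, c (c (c v)) = v) (hca : ∀ v, c (a v) = b (c v))
    (hcb : ∀ v, c (b v) = a (b (c v))) (hd : ∀ v, d (d (d v)) = v)
    (hda : ∀ v, d (a v) = a (d v)) (hdb : ∀ v, d (b v) = b (d v)) (hdc : ∀ v, d (c v) = c (d v))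
    (hfix : (∃ v, v ≠ 0 ∧ c v = v) → ∃ v, v ≠ 0 ∧ d v = v)
    (B : V →ₗ[ℂ] V →ₗ[ℂ] ℂ) (hB : ∀ v, B v v = 0)
    (hnd : ∀ v, (∀ w, B v w = 0) → v = 0) (hBa : ∀ v w, B (a v) (a w) = B v w)
    (hBb : ∀ v w, B (b v) (b w) = B v w) (hBd : ∀ v w, B (d v) (d w) = B v w) :
    (∀ v, a v = v) ∨ ∀ v, d v = v := by
  refine (jointEigenspace_finrank hdim ha hb hab hc hca hcb B hB hnd hBa hBb).imp_right ?_
  rintro ⟨h0, h2, hnd'⟩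
  have hbij := kleinSum_bijective ha hb hab hc hca hcb
  have hdW : ∀ s, ∀ v ∈ jointEigenspace a b s, d v ∈ jointEigenspace a b s := by
    intro s v hv
    rw [mem_jointEigenspace] at hv ⊢
    rw [← hda, ← hdb, hv.1, hv.2, map_smul]
    exact ⟨rfl, rfl⟩
  have hcfix : ∃ v, v ≠ 0 ∧ c v = v := by
    have : Nontrivial (jointEigenspace a b (-1)) := Module.nontrivial_of_finrank_pos (R := ℂ)
      (by omega)
    obtain ⟨⟨v, hv⟩, hv0⟩ := exists_ne (0 : jointEigenspace a b (-1))
    refine ⟨v + (c v + c (c v)), fun h ↦ hv0 ?_, ?_⟩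
    · have := @hbij.1 (0, ⟨v, hv⟩, ⟨v, hv⟩, ⟨v, hv⟩) 0 (by
        rw [kleinSum_apply, map_zero]
        simpa using h)
      exact congrArg (fun p ↦ p.2.1) this
    · simp only [map_add, hc]
      abel
  obtain ⟨v, hv0, hdv⟩ := hfix hcfix
  obtain ⟨w, hw, hw0, hdw⟩ : ∃ w ∈ jointEigenspace a b (-1), w ≠ 0 ∧ d w = w := by
    obtain ⟨⟨⟨x, hx⟩, ⟨y, hy⟩, ⟨z, hz⟩, ⟨w, hw⟩⟩, rfl⟩ := hbij.2 v
    have := @hbij.1 (⟨d x, hdW _ x hx⟩, ⟨d y, hdW _ y hy⟩, ⟨d z, hdW _ z hz⟩, ⟨d w, hdW _ w hw⟩)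
      (⟨x, hx⟩, ⟨y, hy⟩, ⟨z, hz⟩, ⟨w, hw⟩) (by
        rw [← hdv]
        simp only [kleinSum_apply, map_add, hdc])
    simp only [Prod.mk.injEq, Subtype.mk.injEq] at this
    obtain ⟨-, ey, ez, ew⟩ := this
    by_contra! h
    have hx' : x = 0 := by rwa [h0, Submodule.mem_bot] at hx
    have key : ∀ u ∈ jointEigenspace a b (-1), d u = u → u = 0 := by
      intro u hu hdu
      by_contra hu0
      exact h u hu hu0 hdu
    exact hv0 (by simp [kleinSum_apply, hx', key y hy ey, key z hz ez, key w hw ew])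
  have hall := fixes_plane_of_fixes_vector h2 hB hnd' hd hBd (hdW _) hw hw0 hdw
  intro u
  obtain ⟨⟨⟨x, hx⟩, ⟨y, hy⟩, ⟨z, hz⟩, ⟨w, hw⟩⟩, rfl⟩ := hbij.2 u
  have hx' : x = 0 := by rwa [h0, Submodule.mem_bot] at hx
  simp only [kleinSum_apply, map_add, hdc, hall y hy, hall z hz, hall w hw, hx', map_zero]

end KleinFourAction

/-- The alternating group `A₇` has no symplectic irreducible 6-dimensional complex
representation: if `ρ : A₇ → GL(V)` is irreducible with `dim_ℂ V = 6`, then there is no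
nondegenerate alternating `ρ`-invariant bilinear form on `V`. -/
theorem statement9 (V : Type*) [AddCommGroup V] [Module ℂ V]
    (hdim : Module.finrank ℂ V = 6)
    (ρ : alternatingGroup (Fin 7) →* (V ≃ₗ[ℂ] V))
    (hirr : ∀ U : Submodule ℂ V, (∀ (g : alternatingGroup (Fin 7)), ∀ v ∈ U, ρ g v ∈ U) →
      U = ⊥ ∨ U = ⊤) :
    ¬ ∃ B : V →ₗ[ℂ] V →ₗ[ℂ] ℂ,
      (∀ v, B v v = 0) ∧
      (∀ v, (∀ w, B v w = 0) → v = 0) ∧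
      (∀ (g : alternatingGroup (Fin 7)) (v w : V), B (ρ g v) (ρ g w) = B v w) := by
  rintro ⟨B, hB, hnd, hinv⟩
  have : Module.Finite ℂ V := Module.finite_of_finrank_pos (by omega)
  obtain ⟨a, b, c, d, g, ha1, hd1, ha, hb, hab, hc, hca, hcb, hd, hda, hdb, hdc, hg⟩ :
      ∃ a b c d g : alternatingGroup (Fin 7), a ≠ 1 ∧ d ≠ 1 ∧ a * a = 1 ∧ b * b = 1 ∧
        a * b = b * a ∧ c * (c * c) = 1 ∧ c * a = b * c ∧ c * b = a * (b * c) ∧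
        d * (d * d) = 1 ∧ d * a = a * d ∧ d * b = b * d ∧ d * c = c * d ∧ d * g = g * c := by
    have mem (x : Equiv.Perm (Fin 7)) (h : x.sign = 1) : x ∈ alternatingGroup (Fin 7) :=
      Equiv.Perm.mem_alternatingGroup.2 h
    refine ⟨⟨c[0, 1] * c[2, 3], mem _ (by decide)⟩, ⟨c[1, 2] * c[0, 3], mem _ (by decide)⟩, ⟨c[0, 1, 2], mem _ (by decide)⟩,
      ⟨c[4, 5, 6], mem _ (by decide)⟩, ⟨c[0, 4] * c[1, 5, 2, 6], mem _ (by decide)⟩, ?_⟩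
    simp only [ne_eq, Subtype.ext_iff, Subgroup.coe_mul, Subgroup.coe_one]
    decide
  have : IsSimpleGroup (alternatingGroup (Fin 7)) := alternatingGroup.isSimpleGroup (by simp)
  have hmul : ∀ x y v, ρ x (ρ y v) = ρ (x * y) v := by
    intro x y v
    rw [map_mul]
    rfl
  have hone : ∀ v, ρ 1 v = v := by simp
  have hker : ∀ x ≠ 1, ∃ v, ρ x v ≠ v := by
    intro x hx
    by_contra! h
    have htop : ρ.ker = ⊤ := by
      refine (Subgroup.Normal.eq_bot_or_eq_top ρ.normal_ker).resolve_left fun hbot ↦ hx ?_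
      rw [← Subgroup.mem_bot, ← hbot, MonoidHom.mem_ker]
      exact LinearEquiv.ext h
    have htriv : ∀ y v, ρ y v = v := by
      intro y v
      have : y ∈ ρ.ker := htop ▸ Subgroup.mem_top y
      rw [MonoidHom.mem_ker.1 this]
      rfl
    have : Nontrivial V := Module.nontrivial_of_finrank_pos (R := ℂ) (by omega)
    obtain ⟨v, hv⟩ := exists_ne (0 : V)
    rcases hirr (ℂ ∙ v) (fun y w hw ↦ by rwa [htriv]) with h | h
    · exact hv (Submodule.span_singleton_eq_bot.1 h)
    · have := finrank_span_singleton (K := ℂ) hv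
      rw [h, finrank_top, hdim] at this
      omega
  have key := eq_id_or_eq_id_of_symplectic (a := (ρ a).toLinearMap) (b := (ρ b).toLinearMap)
    (c := (ρ c).toLinearMap) (d := (ρ d).toLinearMap) hdim
  simp only [LinearEquiv.coe_coe, hmul, ha, hb, hab, hc, hca, hcb, hd, hda, hdb, hdc, hone,
    forall_const] at key
  obtain ⟨v, hv⟩ := hker a ha1
  obtain ⟨w, hw⟩ := hker d hd1
  refine (key ?_ B hB hnd (hinv a) (hinv b) (hinv d)).elim (fun h ↦ hv (h v)) (fun h ↦ hw (h w))
  rintro ⟨u, hu, hcu⟩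
  exact ⟨ρ g u, by simpa using hu, by rw [hmul, hg, ← hmul, hcu]⟩
end

section
/- Let G be a finite perfect group and N a cyclic subgroup of order 1 or 2 contained in the center of G such that the quotient group G⧸N is isomorphic to the alternating group A₇ = alternatingGroup (Fin 7). Then G admits no symplectic irreducible 6-dimensional complex representation: if V is a complex vector space of dimension 6 and ρ : G → GL(V) is a group homomorphism such that the only ρ-invariant subspaces of V are 0 and V, then there is no nondegenerate alternating bilinear form B : V × V → ℂ with B(ρ(g)v, ρ(g)w) = B(v, w) for all g ∈ G and v, w ∈ V. -/
open Module

/-- A vector space carrying a nondegenerate alternating form has even dimension. -/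
theorem even_finrank_of_alternating {W : Type*} [AddCommGroup W] [Module ℂ W]
    [FiniteDimensional ℂ W] (B : W →ₗ[ℂ] W →ₗ[ℂ] ℂ) (halt : ∀ v, B v v = 0)
    (hnd : ∀ v, (∀ w, B v w = 0) → v = 0) : Even (finrank ℂ W) := by
  let b := finBasis ℂ W
  have hdet : (LinearMap.toMatrix₂ b b B).det ≠ 0 := by
    rw [← LinearMap.separatingLeft_iff_det_ne_zero]
    exact hnd
  have hskew : (LinearMap.toMatrix₂ b b B).transpose = -LinearMap.toMatrix₂ b b B := by
    ext i j
    simp only [Matrix.transpose_apply, Matrix.neg_apply, LinearMap.toMatrix₂_apply]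
    exact (LinearMap.IsAlt.neg halt _ _).symm
  have h := congrArg Matrix.det hskew
  rw [Matrix.det_transpose, Matrix.det_neg, Fintype.card_fin] at h
  by_contra hodd
  rw [Nat.not_even_iff_odd] at hodd
  rw [hodd.neg_one_pow] at h
  apply hdet
  linear_combination h / 2

/-- A self-adjoint idempotent for a nondegenerate alternating form has even rank. -/
theorem even_finrank_range_of_selfAdjoint {V : Type*} [AddCommGroup V] [Module ℂ V]
    [FiniteDimensional ℂ V] (B : V →ₗ[ℂ] V →ₗ[ℂ] ℂ) (halt : ∀ v, B v v = 0)
    (hnd : ∀ v, (∀ w, B v w = 0) → v = 0) (P : End ℂ V) (hP : P * P = P)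
    (hadj : ∀ v w, B (P v) w = B v (P w)) : Even (finrank ℂ (LinearMap.range P)) := by
  apply even_finrank_of_alternating (B.domRestrict₁₂ (LinearMap.range P) (LinearMap.range P))
  · intro v
    exact halt v
  · rintro ⟨_, v, rfl⟩ h
    ext
    apply hnd
    intro w
    have h1 := h ⟨P w, w, rfl⟩
    simp only [LinearMap.domRestrict₁₂_apply] at h1
    rw [← hadj, ← Module.End.mul_apply, hP] at h1
    exact h1

/-- The trace of an idempotent is its rank. -/
theorem trace_eq_finrank_range {V : Type*} [AddCommGroup V] [Module ℂ V]
    [FiniteDimensional ℂ V] (P : End ℂ V) (hP : P * P = P) :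
    LinearMap.trace ℂ V P = finrank ℂ (LinearMap.range P) :=
  LinearMap.IsProj.trace (LinearMap.IsIdempotentElem.isProj_range P hP)

/-- Two idempotents of large rank have a common fixed vector. -/
theorem exists_common_fixed {V : Type*} [AddCommGroup V] [Module ℂ V]
    [FiniteDimensional ℂ V] (P Q : End ℂ V) (hP : P * P = P) (hQ : Q * Q = Q)
    (h : finrank ℂ V < finrank ℂ (LinearMap.range P) + finrank ℂ (LinearMap.range Q)) :
    ∃ v, v ≠ 0 ∧ P v = v ∧ Q v = v := by
  have h1 := Submodule.finrank_sup_add_finrank_inf_eq (LinearMap.range P) (LinearMap.range Q)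
  have h2 := Submodule.finrank_le (LinearMap.range P ⊔ LinearMap.range Q)
  have h3 : LinearMap.range P ⊓ LinearMap.range Q ≠ ⊥ := by
    intro h4
    rw [h4, finrank_bot] at h1
    omega
  obtain ⟨v, ⟨⟨x, rfl⟩, ⟨y, hy⟩⟩, hv⟩ := Submodule.exists_mem_ne_zero_of_ne_bot h3
  refine ⟨P x, hv, ?_, ?_⟩
  · rw [← Module.End.mul_apply, hP]
  · rw [← hy, ← Module.End.mul_apply, hQ]

/-- Two commuting symplectic involutions of a six-dimensional space which, together with their
product, have equal traces and have a common fixed vector are trivial. -/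
theorem involution_eq_one_of_common_fixed {V : Type*} [AddCommGroup V] [Module ℂ V]
    [FiniteDimensional ℂ V] (hdim : finrank ℂ V = 6)
    (B : V →ₗ[ℂ] V →ₗ[ℂ] ℂ) (halt : ∀ v, B v v = 0) (hnd : ∀ v, (∀ w, B v w = 0) → v = 0)
    (A C : End ℂ V) (hA : A * A = 1) (hC : C * C = 1) (hAC : A * C = C * A)
    (hBA : ∀ v w, B (A v) (A w) = B v w) (hBC : ∀ v w, B (C v) (C w) = B v w)
    (htC : LinearMap.trace ℂ V C = LinearMap.trace ℂ V A)
    (htAC : LinearMap.trace ℂ V (A * C) = LinearMap.trace ℂ V A)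
    (v : V) (hv : v ≠ 0) (hAv : A v = v) (hCv : C v = v) : A = 1 := by
  have adjA : ∀ v w, B (A v) w = B v (A w) := fun v w ↦ by
    rw [← hBA v (A w), ← Module.End.mul_apply A A, hA, Module.End.one_apply]
  have adjC : ∀ v w, B (C v) w = B v (C w) := fun v w ↦ by
    rw [← hBC v (C w), ← Module.End.mul_apply C C, hC, Module.End.one_apply]
  let P : End ℂ V := (1 / 2 : ℂ) • (1 + A)
  let R : End ℂ V := (1 / 2 : ℂ) • (1 + C)
  have hP : P * P = P := by
    simp only [P, smul_mul_smul_comm, mul_add, add_mul, hA, one_mul, mul_one]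
    module
  have hR : R * R = R := by
    simp only [R, smul_mul_smul_comm, mul_add, add_mul, hC, one_mul, mul_one]
    module
  have hPR : Commute P R := by
    refine Commute.smul_left (Commute.smul_right ?_ _) _
    exact (Commute.one_left _).add_left ((Commute.one_right _).add_right hAC)
  have adjP : ∀ v w, B (P v) w = B v (P w) := by
    intro v w
    simp [P, adjA]
  have adjR : ∀ v w, B (R v) w = B v (R w) := by
    intro v w
    simp [R, adjC]
  have hQ : (P * R) * (P * R) = P * R := by
    rw [hPR.symm.mul_mul_mul_comm, hP, hR]
  have adjQ : ∀ v w, B ((P * R) v) w = B v ((P * R) w) := by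
    intro v w
    rw [Module.End.mul_apply, adjP, adjR, ← Module.End.mul_apply, hPR.eq]
  have evP := even_finrank_range_of_selfAdjoint B halt hnd P hP adjP
  have evQ := even_finrank_range_of_selfAdjoint B halt hnd _ hQ adjQ
  have tP := trace_eq_finrank_range P hP
  have tQ := trace_eq_finrank_range _ hQ
  have lP := Submodule.finrank_le (LinearMap.range P)
  simp only [P, R, smul_mul_smul_comm, mul_add, add_mul, one_mul, mul_one, map_smul, map_add,
    LinearMap.trace_one, hdim, htC, htAC, smul_eq_mul] at tP tQ
  have key : 2 * finrank ℂ (LinearMap.range (P * R)) + 6 = 3 * finrank ℂ (LinearMap.range P) := by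
    have : (2 * finrank ℂ (LinearMap.range (P * R)) + 6 : ℂ)
        = 3 * finrank ℂ (LinearMap.range P) := by
      rw [← tP, ← tQ]
      push_cast
      ring
    exact_mod_cast this
  have hfix : (P * R) v = v := by
    simp only [P, R, Module.End.mul_apply, LinearMap.smul_apply, LinearMap.add_apply,
      Module.End.one_apply, hCv, ← two_smul ℂ v, map_smul, hAv]
    module
  have hQ0 : finrank ℂ (LinearMap.range (P * R)) ≠ 0 := by
    intro h0
    rw [Submodule.finrank_eq_zero] at h0
    apply hv
    rw [← Submodule.mem_bot ℂ, ← h0]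
    exact ⟨v, hfix⟩
  obtain ⟨k, hk⟩ := evP
  obtain ⟨l, hl⟩ := evQ
  have h6 : LinearMap.range P = ⊤ := by
    apply Submodule.eq_top_of_finrank_eq
    omega
  ext w
  obtain ⟨x, rfl⟩ : w ∈ LinearMap.range P := h6 ▸ Submodule.mem_top
  have hAP : A * P = P := by
    simp only [P, mul_smul_comm, mul_add, hA, mul_one]
    module
  exact LinearMap.congr_fun hAP x

/-- The averaging operator attached to an operator of order three. -/
noncomputable def cubeAverage {V : Type*} [AddCommGroup V] [Module ℂ V] (u : End ℂ V) : End ℂ V :=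
  (1 / 3 : ℂ) • (1 + u + u * u)

section cubeAverage

variable {V : Type*} [AddCommGroup V] [Module ℂ V]

theorem mul_cubeAverage {u : End ℂ V} (hu : u * (u * u) = 1) :
    u * cubeAverage u = cubeAverage u := by
  simp only [cubeAverage, mul_smul_comm, mul_add, hu, mul_one]
  module

theorem cubeAverage_mul_self {u : End ℂ V} (hu : u * (u * u) = 1) :
    cubeAverage u * cubeAverage u = cubeAverage u := by
  conv_lhs => enter [1]; rw [cubeAverage]
  simp only [smul_mul_assoc, add_mul, mul_assoc, mul_cubeAverage hu, one_mul]
  module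

theorem cubeAverage_selfAdjoint {u : End ℂ V} (hu : u * (u * u) = 1) (B : V →ₗ[ℂ] V →ₗ[ℂ] ℂ)
    (hB : ∀ v w, B (u v) (u w) = B v w) (v w : V) :
    B (cubeAverage u v) w = B v (cubeAverage u w) := by
  have h3 (w : V) : u (u (u w)) = w := LinearMap.congr_fun hu w
  have h1 (v w : V) : B (u v) w = B v (u (u w)) := by
    rw [← hB v (u (u w)), h3]
  simp only [cubeAverage, LinearMap.smul_apply, LinearMap.add_apply, Module.End.one_apply,
    Module.End.mul_apply, map_smul, map_add, h1, h3]
  module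

theorem apply_of_cubeAverage_apply {u : End ℂ V} (hu : u * (u * u) = 1) {v : V}
    (hv : cubeAverage u v = v) : u v = v := by
  rw [← hv, ← Module.End.mul_apply, mul_cubeAverage hu]

theorem trace_cubeAverage (hdim : finrank ℂ V = 6) {u : End ℂ V}
    (ht : LinearMap.trace ℂ V (u * u) = LinearMap.trace ℂ V u) :
    3 * LinearMap.trace ℂ V (cubeAverage u) = 6 + 2 * LinearMap.trace ℂ V u := by
  have : FiniteDimensional ℂ V := Module.finite_of_finrank_pos (by omega)
  simp only [cubeAverage, map_smul, map_add, LinearMap.trace_one, hdim, ht, smul_eq_mul]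
  push_cast
  ring

end cubeAverage

/-- For an elementary abelian group of order nine generated by `u, w` acting symplectically on a
six-dimensional space, with `u` and `w` of equal trace and all traces of the products equal, one of
`u` and `u * w` has a fixed space of dimension at least four. -/
theorem four_le_finrank_fixed_or {V : Type*} [AddCommGroup V] [Module ℂ V]
    [FiniteDimensional ℂ V] (hdim : finrank ℂ V = 6)
    (B : V →ₗ[ℂ] V →ₗ[ℂ] ℂ) (halt : ∀ v, B v v = 0) (hnd : ∀ v, (∀ w, B v w = 0) → v = 0)
    (u w : End ℂ V) (hu : u * (u * u) = 1) (hw : w * (w * w) = 1) (hc : u * w = w * u)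
    (hBu : ∀ v v', B (u v) (u v') = B v v') (hBw : ∀ v v', B (w v) (w v') = B v v')
    (huu : LinearMap.trace ℂ V (u * u) = LinearMap.trace ℂ V u)
    (hwu : LinearMap.trace ℂ V w = LinearMap.trace ℂ V u)
    (hww : LinearMap.trace ℂ V (w * w) = LinearMap.trace ℂ V u)
    (h12 : LinearMap.trace ℂ V (u * (w * w)) = LinearMap.trace ℂ V (u * w))
    (h21 : LinearMap.trace ℂ V (u * u * w) = LinearMap.trace ℂ V (u * w))
    (h22 : LinearMap.trace ℂ V (u * u * (w * w)) = LinearMap.trace ℂ V (u * w)) :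
    4 ≤ finrank ℂ (LinearMap.range (cubeAverage u)) ∨
      4 ≤ finrank ℂ (LinearMap.range (cubeAverage (u * w))) := by
  have hc' : Commute u w := hc
  have hsq : u * w * (u * w) = u * u * (w * w) := hc'.symm.mul_mul_mul_comm u w
  have huw : u * w * (u * w * (u * w)) = 1 := by
    rw [hsq, (hc'.symm.mul_right hc'.symm).mul_mul_mul_comm, hu, hw, one_mul]
  have hcom : Commute (cubeAverage u) (cubeAverage w) := by
    refine Commute.smul_left (Commute.smul_right ?_ _) _
    have h1 : Commute u (1 + w + w * w) :=
      ((Commute.one_right u).add_right hc').add_right (hc'.mul_right hc')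
    exact ((Commute.one_left _).add_left h1).add_left (h1.mul_left h1)
  have hQ : cubeAverage u * cubeAverage w * (cubeAverage u * cubeAverage w)
      = cubeAverage u * cubeAverage w := by
    rw [hcom.symm.mul_mul_mul_comm, cubeAverage_mul_self hu, cubeAverage_mul_self hw]
  have ev1 := even_finrank_range_of_selfAdjoint B halt hnd _ (cubeAverage_mul_self hu)
    (cubeAverage_selfAdjoint hu B hBu)
  have ev2 := even_finrank_range_of_selfAdjoint B halt hnd _ (cubeAverage_mul_self huw)
    (cubeAverage_selfAdjoint huw B fun v v' ↦ by simp only [Module.End.mul_apply, hBu, hBw])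
  have t1 := trace_cubeAverage hdim huu
  have t2 := trace_cubeAverage hdim (u := u * w) (by rw [hsq, h22])
  have tQ := trace_eq_finrank_range _ hQ
  rw [trace_eq_finrank_range _ (cubeAverage_mul_self hu)] at t1
  rw [trace_eq_finrank_range _ (cubeAverage_mul_self huw)] at t2
  have hexp : 9 * LinearMap.trace ℂ V (cubeAverage u * cubeAverage w)
      = 6 + 4 * LinearMap.trace ℂ V u + 4 * LinearMap.trace ℂ V (u * w) := by
    simp only [cubeAverage, smul_mul_smul_comm, mul_add, add_mul, one_mul, mul_one, map_smul,
      map_add, LinearMap.trace_one, hdim, huu, hwu, hww, h12, h21, h22, smul_eq_mul]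
    push_cast
    ring
  rw [tQ] at hexp
  have key : 9 * finrank ℂ (LinearMap.range (cubeAverage u * cubeAverage w)) + 18
      = 6 * finrank ℂ (LinearMap.range (cubeAverage u))
        + 6 * finrank ℂ (LinearMap.range (cubeAverage (u * w))) := by
    have : (9 * finrank ℂ (LinearMap.range (cubeAverage u * cubeAverage w)) + 18 : ℂ)
      = 6 * finrank ℂ (LinearMap.range (cubeAverage u))
        + 6 * finrank ℂ (LinearMap.range (cubeAverage (u * w))) := by
      linear_combination hexp - 2 * t1 - 2 * t2
    exact_mod_cast this
  obtain ⟨k, hk⟩ := ev1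
  obtain ⟨l, hl⟩ := ev2
  omega

section lifts

variable {G A : Type*} [Group G] [Group A]

/-- In a central extension by a group of exponent two, elements of order three with conjugate
images are conjugate. -/
theorem conj_eq_of_map_conj_eq (π : G →* A) (hcent : ∀ n, π n = 1 → ∀ g, n * g = g * n)
    (hexp : ∀ n, π n = 1 → n * n = 1) {g g' h : G} (hg : g ^ 3 = 1) (hg' : g' ^ 3 = 1)
    (hπ : π h * π g * (π h)⁻¹ = π g') : h * g * h⁻¹ = g' := by
  set k := h * g * h⁻¹ with hk
  have hk3 : k ^ 3 = 1 := by rw [hk, conj_pow, hg]; simp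
  have hn : π (k⁻¹ * g') = 1 := by
    rw [map_mul, map_inv, ← hπ, hk, map_mul, map_mul, map_inv, inv_mul_cancel]
  set n := k⁻¹ * g' with hn'
  have hkn : g' = k * n := by rw [hn']; group
  have hn1 : n = 1 := by
    have h3 : g' ^ 3 = n ^ 3 := by
      rw [hkn, (show Commute k n from (hcent n hn k).symm).mul_pow, hk3, one_mul]
    rw [hg', pow_succ, pow_two, hexp n hn, one_mul] at h3
    exact h3.symm
  rw [hkn, hn1, mul_one]

/-- In an extension by a group of exponent two, elements of order three lift to such. -/
theorem exists_lift_pow_three (π : G →* A) (hsurj : Function.Surjective π)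
    (hexp : ∀ n, π n = 1 → n * n = 1) {x : A} (hx : x ^ 3 = 1) :
    ∃ g, π g = x ∧ g ^ 3 = 1 := by
  obtain ⟨g, rfl⟩ := hsurj x
  refine ⟨g ^ 4, ?_, ?_⟩
  · rw [map_pow, pow_succ, hx, one_mul]
  · have h := hexp (g ^ 3) (by rw [map_pow, hx])
    rw [← pow_mul, show 4 * 3 = (3 + 3) * 2 from rfl, pow_mul, pow_add, h, one_pow]

end lifts

/-- Let `u` have order three and suppose that the image of `u` and a conjugate of it generate a copy
of `A₄`. Then `u` fixes at most a three-dimensional subspace of a faithful six-dimensional symplectic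
representation. -/
theorem finrank_fixed_lt_four {G A : Type*} [Group G] [Group A] (π : G →* A)
    {V : Type*} [AddCommGroup V] [Module ℂ V] [FiniteDimensional ℂ V] (hdim : finrank ℂ V = 6)
    (B : V →ₗ[ℂ] V →ₗ[ℂ] ℂ) (halt : ∀ v, B v v = 0) (hnd : ∀ v, (∀ w, B v w = 0) → v = 0)
    (R : G →* End ℂ V) (hB : ∀ g v w, B (R g v) (R g w) = B v w)
    (hfix : ∀ n, π n = 1 → ∀ v, v ≠ 0 → R n v = v → R n = 1)
    (hfaith : ∀ g, R g = 1 → π g = 1)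
    {u d : G} (hu : u ^ 3 = 1) {x y : A} (hx : π u = x) (hy : π d * x * (π d)⁻¹ = y)
    (hne : x * y ≠ 1) (h2 : x * y * (x * y) = 1) (hcomm : x * y * (y * x) = y * x * (x * y))
    (hrot : x⁻¹ * (y * x) * x = x * y * (y * x)) :
    finrank ℂ (LinearMap.range (cubeAverage (R u))) < 4 := by
  by_contra! h4
  set u' := d * u * d⁻¹ with hu'def
  have hy' : π u' = y := by rw [← hy, hu'def, map_mul, map_mul, map_inv, hx]
  have hu' : u' ^ 3 = 1 := by rw [hu'def, conj_pow, hu]; simp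
  have trconj (g h : G) : LinearMap.trace ℂ V (R (h * g * h⁻¹)) = LinearMap.trace ℂ V (R g) := by
    rw [map_mul, LinearMap.trace_mul_comm, ← map_mul]
    congr 2
    group
  have cube {g : G} (hg : g ^ 3 = 1) : R g * (R g * R g) = 1 := by
    rw [← map_mul, ← map_mul, ← pow_two, ← pow_succ', hg, map_one]
  have hP := cubeAverage_mul_self (cube hu)
  have hP' := cubeAverage_mul_self (cube hu')
  have hrank : finrank ℂ (LinearMap.range (cubeAverage (R u')))
      = finrank ℂ (LinearMap.range (cubeAverage (R u))) := by
    have h : LinearMap.trace ℂ V (cubeAverage (R u')) = LinearMap.trace ℂ V (cubeAverage (R u)) := by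
      simp only [cubeAverage, map_smul, map_add, ← map_mul R]
      rw [show u' * u' = d * (u * u) * d⁻¹ by rw [hu'def]; group, trconj, trconj]
    rw [trace_eq_finrank_range _ hP, trace_eq_finrank_range _ hP'] at h
    exact_mod_cast h
  obtain ⟨v, hv, hv1, hv2⟩ := exists_common_fixed _ _ hP hP' (by omega)
  replace hv1 : R u v = v := apply_of_cubeAverage_apply (cube hu) hv1
  replace hv2 : R u' v = v := apply_of_cubeAverage_apply (cube hu') hv2
  have fixmul {g h : G} (hg : R g v = v) (hh : R h v = v) : R (g * h) v = v := by
    rw [map_mul, Module.End.mul_apply, hh, hg]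
  have fixinv {g : G} (hg : R g v = v) : R g⁻¹ v = v := by
    conv_lhs => rw [← hg]
    rw [← Module.End.mul_apply, ← map_mul, inv_mul_cancel, map_one, Module.End.one_apply]
  have eq_of_fix {g h : G} (hg : R g v = v) (hh : R h v = v) (hπ : π g = π h) : R g = R h := by
    have h1 := hfix (g * h⁻¹) (by rw [map_mul, map_inv, hπ, mul_inv_cancel]) v hv
      (fixmul hg (fixinv hh))
    rw [← inv_mul_cancel_right g h, map_mul R (g * h⁻¹), h1, one_mul]
  have ha := fixmul hv1 hv2
  have hb := fixmul hv2 hv1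
  have hx' : x⁻¹ * (x * y) * x = y * x := by group
  have hb2 : y * x * (y * x) = 1 := by
    rw [← hx', show x⁻¹ * (x * y) * x * (x⁻¹ * (x * y) * x) = x⁻¹ * (x * y * (x * y)) * x by group,
      h2]
    group
  have key : R (u * u') = 1 := by
    refine involution_eq_one_of_common_fixed hdim B halt hnd (R (u * u')) (R (u' * u))
      ?_ ?_ ?_ (hB _) (hB _) ?_ ?_ v hv ha hb
    · rw [← map_mul, ← map_one R]
      exact eq_of_fix (fixmul ha ha) (by simp) (by simp only [map_mul, map_one, hx, hy', h2])
    · rw [← map_mul, ← map_one R]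
      exact eq_of_fix (fixmul hb hb) (by simp) (by simp only [map_mul, map_one, hx, hy', hb2])
    · rw [← map_mul, ← map_mul]
      exact eq_of_fix (fixmul ha hb) (fixmul hb ha) (by simp only [map_mul, hx, hy', hcomm])
    · rw [map_mul, LinearMap.trace_mul_comm, ← map_mul]
    · rw [← map_mul, ← eq_of_fix (fixmul (fixmul (fixinv hv1) hb) hv1) (fixmul ha hb)
        (by simp only [map_mul, map_inv, hx, hy', hrot])]
      have := trconj (u' * u) u⁻¹
      rw [inv_inv] at this
      rw [this, map_mul, LinearMap.trace_mul_comm, ← map_mul]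
  apply hne
  rw [← hfaith _ key, map_mul, hx, hy']

/-- If `G` is a finite perfect group with a central cyclic subgroup `N` of order 1 or 2
such that `G/N ≅ A₇`, then `G` has no symplectic irreducible 6-dimensional complex
representation: if `ρ : G → GL(V)` is irreducible with `dim_ℂ V = 6`, then there is no
nondegenerate alternating `ρ`-invariant bilinear form on `V`. -/
theorem statement10 (G : Type*) [Group G] [Finite G] (hperf : commutator G = ⊤)
    (N : Subgroup G) [N.Normal] (hcentral : N ≤ Subgroup.center G)
    (hcyc : IsCyclic N) (hcard : Nat.card N = 1 ∨ Nat.card N = 2)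
    (hquot : Nonempty ((G ⧸ N) ≃* alternatingGroup (Fin 7)))
    (V : Type*) [AddCommGroup V] [Module ℂ V]
    (hdim : Module.finrank ℂ V = 6)
    (ρ : G →* (V ≃ₗ[ℂ] V))
    (hirr : ∀ U : Submodule ℂ V, (∀ g : G, ∀ v ∈ U, ρ g v ∈ U) → U = ⊥ ∨ U = ⊤) :
    ¬ ∃ B : V →ₗ[ℂ] V →ₗ[ℂ] ℂ,
      (∀ v, B v v = 0) ∧
      (∀ v, (∀ w, B v w = 0) → v = 0) ∧
      (∀ (g : G) (v w : V), B (ρ g v) (ρ g w) = B v w) := by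
  rintro ⟨B, halt, hnd, hB⟩
  have : FiniteDimensional ℂ V := Module.finite_of_finrank_pos (by omega)
  have : Nontrivial V := Module.nontrivial_of_finrank_pos (R := ℂ) (by omega)
  obtain ⟨e⟩ := hquot
  let π : G →* alternatingGroup (Fin 7) := e.toMonoidHom.comp (QuotientGroup.mk' N)
  have hπ : Function.Surjective π := e.surjective.comp (QuotientGroup.mk'_surjective N)
  have hker (n : G) (hn : π n = 1) : n ∈ N := by
    rw [← QuotientGroup.eq_one_iff]
    exact e.injective (hn.trans (map_one e).symm)
  have hcent (n : G) (hn : π n = 1) (g : G) : n * g = g * n :=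
    (Subgroup.mem_center_iff.mp (hcentral (hker n hn)) g).symm
  have hexp (n : G) (hn : π n = 1) : n * n = 1 := by
    have h1 : (⟨n, hker n hn⟩ : N) ^ 2 = 1 := by
      apply orderOf_dvd_iff_pow_eq_one.mp
      refine (orderOf_dvd_natCard _).trans ?_
      rcases hcard with h | h <;> simp [h]
    rw [← pow_two]
    exact congrArg Subtype.val h1
  let R : G →* End ℂ V := (LinearEquiv.automorphismGroup.toLinearMapMonoidHom).comp ρ
  have hR (g : G) (v : V) : R g v = ρ g v := rfl
  have hBR (g : G) (v w : V) : B (R g v) (R g w) = B v w := hB g v w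
  have hfix (n : G) (hn : π n = 1) (v : V) (hv : v ≠ 0) (hnv : R n v = v) : R n = 1 := by
    rcases hirr (LinearMap.ker (R n - 1)) (fun g w hw ↦ by
      rw [LinearMap.mem_ker, LinearMap.sub_apply, Module.End.one_apply, sub_eq_zero] at hw ⊢
      rw [← hR, ← Module.End.mul_apply, ← map_mul, hcent n hn, map_mul, Module.End.mul_apply, hw])
      with h | h
    · exact absurd ((Submodule.mem_bot ℂ).mp (h ▸ (by simp [hnv] : v ∈ _))) hv
    · exact sub_eq_zero.mp (LinearMap.ker_eq_top.mp h)
  have hfaith (g : G) (hg : R g = 1) : π g = 1 := by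
    have hsimple : IsSimpleGroup (alternatingGroup (Fin 7)) :=
      alternatingGroup.isSimpleGroup (by simp)
    rcases (Subgroup.Normal.map (MonoidHom.normal_ker R) π hπ).eq_bot_or_eq_top with h | h
    · rw [← Subgroup.mem_bot, ← h]
      exact ⟨g, hg, rfl⟩
    · exfalso
      have hcen (a : G) : ∃ n, π n = 1 ∧ R a = R n := by
        obtain ⟨k, hk, hka⟩ : π a ∈ R.ker.map π := h ▸ Subgroup.mem_top _
        refine ⟨a * k⁻¹, by rw [map_mul, map_inv, hka, mul_inv_cancel], ?_⟩
        have hk1 : R k⁻¹ = 1 := R.ker.inv_mem hk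
        rw [map_mul, hk1, mul_one]
      have htriv (a : G) : R a = 1 := by
        have hle : commutator G ≤ R.ker := by
          rw [commutator_def, Subgroup.commutator_le]
          intro a _ b _
          obtain ⟨n, hn, hna⟩ := hcen a
          have hab : R (a * b) = R (b * a) := by
            rw [map_mul, map_mul, hna, ← map_mul, ← map_mul, hcent n hn]
          rw [MonoidHom.mem_ker, commutatorElement_def, mul_assoc, ← mul_inv_rev, map_mul, hab,
            ← map_mul, mul_inv_cancel, map_one]
        exact (hperf ▸ hle) (Subgroup.mem_top a)
      obtain ⟨v, hv⟩ := exists_ne (0 : V)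
      rcases hirr (ℂ ∙ v) (fun g w hw ↦ by rw [← hR, htriv]; exact hw) with h0 | h0
      · exact hv (Submodule.span_singleton_eq_bot.mp h0)
      · have h1 := finrank_span_singleton (K := ℂ) hv
        rw [h0, finrank_top] at h1
        omega
  let x : alternatingGroup (Fin 7) :=
    ⟨c[0, 1, 2], Equiv.Perm.mem_alternatingGroup.mpr (by decide)⟩
  let y : alternatingGroup (Fin 7) :=
    ⟨c[3, 4, 5], Equiv.Perm.mem_alternatingGroup.mpr (by decide)⟩
  obtain ⟨u, hux, hu⟩ := exists_lift_pow_three π hπ hexp (x := x) (by decide)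
  obtain ⟨w, hwy, hw⟩ := exists_lift_pow_three π hπ hexp (x := y) (by decide)
  have htrace {g g' : G} (hg : g ^ 3 = 1) (hg' : g' ^ 3 = 1) (a : alternatingGroup (Fin 7))
      (ha : a * π g * a⁻¹ = π g') : LinearMap.trace ℂ V (R g') = LinearMap.trace ℂ V (R g) := by
    obtain ⟨h, rfl⟩ := hπ a
    rw [← conj_eq_of_map_conj_eq π hcent hexp hg hg' ha, map_mul, LinearMap.trace_mul_comm,
      ← map_mul]
    congr 2
    group
  have hc : Commute u w := by
    have h : u * w * u⁻¹ = w := conj_eq_of_map_conj_eq π hcent hexp hw hw (by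
      rw [hux, hwy]; decide)
    exact mul_inv_eq_iff_eq_mul.mp h
  have cube {g : G} (hg : g ^ 3 = 1) : R g * (R g * R g) = 1 := by
    rw [← map_mul, ← map_mul, ← pow_two, ← pow_succ', hg, map_one]
  have sq {g : G} (hg : g ^ 3 = 1) : (g * g) ^ 3 = 1 := by
    rw [(Commute.refl g).mul_pow, hg, one_mul]
  have hu2 := sq hu
  have hw2 := sq hw
  have huw : (u * w) ^ 3 = 1 := by rw [hc.mul_pow, hu, hw, one_mul]
  have huw2 : (u * (w * w)) ^ 3 = 1 := by rw [(hc.mul_right hc).mul_pow, hu, hw2, one_mul]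
  have hu2w : (u * u * w) ^ 3 = 1 := by rw [(hc.mul_left hc).mul_pow, hu2, hw, one_mul]
  have hu2w2 : (u * u * (w * w)) ^ 3 = 1 := by
    rw [((hc.mul_left hc).mul_right (hc.mul_left hc)).mul_pow, hu2, hw2, one_mul]
  let invert : alternatingGroup (Fin 7) :=
    ⟨c[1, 2] * c[4, 5], Equiv.Perm.mem_alternatingGroup.mpr (by decide)⟩
  let exchange : alternatingGroup (Fin 7) :=
    ⟨c[0, 3] * c[1, 4] * c[2, 5] * c[3, 4], Equiv.Perm.mem_alternatingGroup.mpr (by decide)⟩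
  let halfInvert : alternatingGroup (Fin 7) :=
    ⟨c[4, 5] * (c[0, 3] * c[1, 4] * c[2, 5]), Equiv.Perm.mem_alternatingGroup.mpr (by decide)⟩
  have huu := htrace hu hu2 invert (by simp only [map_mul, hux]; decide)
  have hwu := htrace hu hw exchange (by rw [hux, hwy]; decide)
  have hww := htrace hw hw2 invert (by simp only [map_mul, hwy]; decide)
  have h12 := htrace huw huw2 halfInvert (by simp only [map_mul, hux, hwy]; decide)
  have h22 := htrace huw hu2w2 invert (by simp only [map_mul, hux, hwy]; decide)
  have h21 := htrace huw2 hu2w invert (by simp only [map_mul, hux, hwy]; decide)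
  rw [h12] at h21
  rw [hwu] at hww
  obtain ⟨d, hd⟩ := hπ ⟨c[2, 3] * c[4, 5], Equiv.Perm.mem_alternatingGroup.mpr (by decide)⟩
  obtain ⟨d', hd'⟩ := hπ ⟨c[1, 3] * c[2, 5], Equiv.Perm.mem_alternatingGroup.mpr (by decide)⟩
  have b1 := finrank_fixed_lt_four π hdim B halt hnd R hBR hfix hfaith hu hux (d := d)
    (by rw [hd]) (by decide +kernel) (by decide +kernel) (by decide +kernel) (by decide +kernel)
  have b2 := finrank_fixed_lt_four π hdim B halt hnd R hBR hfix hfaith huw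
    (by rw [map_mul, hux, hwy]) (d := d')
    (by rw [hd']) (by decide +kernel) (by decide +kernel) (by decide +kernel) (by decide +kernel)
  simp only [map_mul] at huu hwu hww h12 h21 h22
  rw [map_mul] at b2
  rcases four_le_finrank_fixed_or hdim B halt hnd (R u) (R w) (cube hu) (cube hw)
    (by rw [← map_mul, hc.eq, map_mul]) (hBR u) (hBR w) huu hwu hww h12 h21 h22 with h | h <;> omega
end

section
/- Let k be an algebraically closed field and let p₁, …, p₇ ∈ k³ be nonzero vectors, pairwise non-proportional (so they represent 7 distinct points of ℙ²(k)), which are in general position: no nonzero homogeneous linear form in k[x,y,z] vanishes at three of the pᵢ, and no nonzero homogeneous quadratic form in k[x,y,z] vanishes at six of the pᵢ. Then the k-vector space of homogeneous cubic forms in k[x,y,z] vanishing at p₁, …, p₇ has dimension 3. -/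
open MvPolynomial

/-- The space of homogeneous cubic forms in `k[x,y,z]` vanishing at each of the seven
points `p i`. -/
noncomputable def cubicsThrough {k : Type*} [Field k] (p : Fin 7 → (Fin 3 → k)) :
    Submodule k (MvPolynomial (Fin 3) k) :=
  MvPolynomial.homogeneousSubmodule (Fin 3) k 3 ⊓
    ⨅ i, LinearMap.ker (MvPolynomial.aeval (R := k) (p i)).toLinearMap

/-- The space of forms of degree `n` in finitely many variables has the expected dimension. -/
theorem finrank_homogeneousSubmodule (σ k : Type*) [Fintype σ] [Field k] (n : ℕ) :
    Module.finrank k (homogeneousSubmodule σ k n) = (Fintype.card σ).multichoose n := by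
  classical
  have hset : {d : σ →₀ ℕ | d.degree = n} =
      (Finset.finsuppAntidiag (Finset.univ : Finset σ) n : Set (σ →₀ ℕ)) := by
    ext d
    simp [Finsupp.degree_eq_sum]
  rw [homogeneousSubmodule_eq_finsupp_supported, hset]
  refine (Module.finrank_eq_nat_card_basis (basisRestrictSupport k _)).trans ?_
  rw [Nat.card_coe_set_eq, Set.ncard_coe_finset, Finset.card_finsuppAntidiag_nat_eq_multichoose,
    Finset.card_univ]

/-- Through any two vectors of `k³` passes a nonzero linear form. -/
theorem exists_linear_form_vanishing {k : Type*} [Field k] (a b : Fin 3 → k) :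
    ∃ l : MvPolynomial (Fin 3) k, l.IsHomogeneous 1 ∧ l ≠ 0 ∧ eval a l = 0 ∧ eval b l = 0 := by
  obtain ⟨v, hv, hM⟩ := Matrix.exists_mulVec_eq_zero_iff.2
    (Matrix.det_zero_of_row_eq (M := Matrix.of ![a, b, b]) (i := 1) (j := 2) (by decide) rfl)
  have heval (w : Fin 3 → k) : eval w (∑ i, C (v i) * X i) = w ⬝ᵥ v := by
    simp [dotProduct, mul_comm]
  refine ⟨∑ i, C (v i) * X i, ?_, ?_, ?_, ?_⟩
  · exact IsHomogeneous.sum _ _ _ fun i _ => isHomogeneous_C_mul_X (v i) i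
  · intro h
    refine hv (funext fun i => ?_)
    simpa [h] using (heval (Pi.single i 1)).symm
  · rw [heval]
    exact congrFun hM 0
  · rw [heval]
    exact congrFun hM 1

/-- If no three of seven points are collinear, some cubic form (a product of three lines)
vanishes at all of them but one prescribed point. -/
theorem exists_cubic_form_separating {k : Type*} [Field k] (p : Fin 7 → (Fin 3 → k))
    (hline : ∀ l : MvPolynomial (Fin 3) k, l.IsHomogeneous 1 → l ≠ 0 →
      ∀ i₁ i₂ i₃ : Fin 7, i₁ ≠ i₂ → i₁ ≠ i₃ → i₂ ≠ i₃ →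
        ¬(eval (p i₁) l = 0 ∧ eval (p i₂) l = 0 ∧ eval (p i₃) l = 0)) (i : Fin 7) :
    ∃ f : MvPolynomial (Fin 3) k, f.IsHomogeneous 3 ∧ eval (p i) f ≠ 0 ∧
      ∀ j, j ≠ i → eval (p j) f = 0 := by
  obtain ⟨l, hl, hl0, hl1, hl2⟩ := exists_linear_form_vanishing (p (i + 1)) (p (i + 2))
  obtain ⟨m, hm, hm0, hm3, hm4⟩ := exists_linear_form_vanishing (p (i + 3)) (p (i + 4))
  obtain ⟨n, hn, hn0, hn5, hn6⟩ := exists_linear_form_vanishing (p (i + 5)) (p (i + 6))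
  have hli : eval (p i) l ≠ 0 := fun h =>
    hline l hl hl0 i (i + 1) (i + 2) (by simp) (by simp) (by simp) ⟨h, hl1, hl2⟩
  have hmi : eval (p i) m ≠ 0 := fun h =>
    hline m hm hm0 i (i + 3) (i + 4) (by simp) (by simp) (by simp) ⟨h, hm3, hm4⟩
  have hni : eval (p i) n ≠ 0 := fun h =>
    hline n hn hn0 i (i + 5) (i + 6) (by simp) (by simp) (by simp) ⟨h, hn5, hn6⟩
  refine ⟨l * m * n, (hl.mul hm).mul hn, ?_, fun j hj => ?_⟩
  · simp [hli, hmi, hni]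
  · have hcover : ∀ i j : Fin 7, j ≠ i → j = i + 1 ∨ j = i + 2 ∨ j = i + 3 ∨ j = i + 4 ∨
        j = i + 5 ∨ j = i + 6 := by decide
    rcases hcover i j hj with rfl | rfl | rfl | rfl | rfl | rfl <;> simp [*]

/-- If seven pairwise non-proportional nonzero vectors of `k³` (`k` algebraically closed)
represent seven points of `ℙ²(k)` in general position (no three on a line, no six on a
conic), then the space of homogeneous cubic forms vanishing at all seven points is
3-dimensional. -/
theorem statement11 {k : Type*} [Field k] [IsAlgClosed k] (p : Fin 7 → (Fin 3 → k))
    (hnz : ∀ i, p i ≠ 0)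
    (hnp : ∀ i j, i ≠ j → ∀ c : k, p j ≠ c • p i)
    (hline : ∀ l : MvPolynomial (Fin 3) k, l.IsHomogeneous 1 → l ≠ 0 →
      ∀ i₁ i₂ i₃ : Fin 7, i₁ ≠ i₂ → i₁ ≠ i₃ → i₂ ≠ i₃ →
        ¬(eval (p i₁) l = 0 ∧ eval (p i₂) l = 0 ∧ eval (p i₃) l = 0))
    (hconic : ∀ q : MvPolynomial (Fin 3) k, q.IsHomogeneous 2 → q ≠ 0 →
      ∀ s : Finset (Fin 7), s.card = 6 → ¬(∀ i ∈ s, eval (p i) q = 0)) :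
    Module.finrank k (cubicsThrough p) = 3 := by
  set H := homogeneousSubmodule (Fin 3) k 3
  have hdim : Module.finrank k H = 10 := by
    rw [finrank_homogeneousSubmodule, Fintype.card_fin, Nat.multichoose_eq]
    rfl
  have : FiniteDimensional k H := Module.finite_of_finrank_pos (by omega)
  let ev : H →ₗ[k] Fin 7 → k :=
    LinearMap.pi fun i => (aeval (R := k) (p i)).toLinearMap ∘ₗ H.subtype
  have hker : cubicsThrough p = (LinearMap.ker ev).map H.subtype := by
    ext f
    simp [cubicsThrough, ev, H, LinearMap.ker_pi, and_comm]
  have hsurj : LinearMap.range ev = ⊤ := by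
    rw [eq_top_iff, ← (Pi.basisFun k (Fin 7)).span_eq, Submodule.span_le]
    rintro _ ⟨i, rfl⟩
    obtain ⟨f, hf, hfi, hfj⟩ := exists_cubic_form_separating p hline i
    refine ⟨(eval (p i) f)⁻¹ • ⟨f, hf⟩, funext fun j => ?_⟩
    rcases eq_or_ne j i with rfl | hj
    · simp [ev, aeval_eq_eval, hfi]
    · simp [ev, aeval_eq_eval, hfj j hj, hj]
  have hrank := ev.finrank_range_add_finrank_ker
  rw [hsurj, finrank_top, Module.finrank_fin_fun, hdim] at hrank
  rw [hker, Submodule.finrank_map_subtype_eq]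
  omega
end

section
/- Let k be an algebraically closed field and let p₁, …, p₇ ∈ k³ be nonzero vectors, pairwise non-proportional, in general position: no nonzero homogeneous linear form in k[x,y,z] vanishes at three of the pᵢ, and no nonzero homogeneous quadratic form vanishes at six of the pᵢ. Then {p₁, …, p₇} is, up to proportionality, exactly the common zero locus of the cubics through it: a nonzero vector p ∈ k³ satisfies q(p) = 0 for every homogeneous cubic form q ∈ k[x,y,z] vanishing at all of p₁, …, p₇ if and only if p is proportional to some pᵢ. -/
open MvPolynomial

lemma MvPolynomial.IsHomogeneous.eval_smul {σ R : Type*} [CommSemiring R] {n : ℕ}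
    {q : MvPolynomial σ R} (hq : q.IsHomogeneous n) (c : R) (x : σ → R) :
    eval (c • x) q = c ^ n * eval x q := by
  rw [eval_eq, eval_eq, Finset.mul_sum]
  refine Finset.sum_congr rfl fun d hd ↦ ?_
  have hdeg : ∑ i ∈ d.support, d i = n := (hq.degree_eq_sum_deg_support hd).symm
  simp only [Pi.smul_apply, smul_eq_mul, mul_pow, Finset.prod_mul_distrib,
    Finset.prod_pow_eq_pow_sum, hdeg]
  ring

/-- The linear form in three variables vanishing on the span of `u` and `v`, with
coefficients the coordinates of the cross product of `u` and `v`. -/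
noncomputable def spanForm {k : Type*} [Field k] (u v : Fin 3 → k) : MvPolynomial (Fin 3) k :=
  C (u 1 * v 2 - u 2 * v 1) * X 0 + C (u 2 * v 0 - u 0 * v 2) * X 1 +
    C (u 0 * v 1 - u 1 * v 0) * X 2

section spanForm

variable {k : Type*} [Field k]

lemma spanForm_isHomogeneous (u v : Fin 3 → k) : (spanForm u v).IsHomogeneous 1 :=
  ((isHomogeneous_C_mul_X _ _).add (isHomogeneous_C_mul_X _ _)).add (isHomogeneous_C_mul_X _ _)

lemma eval_spanForm (u v x : Fin 3 → k) :
    eval x (spanForm u v) = (u 1 * v 2 - u 2 * v 1) * x 0 + (u 2 * v 0 - u 0 * v 2) * x 1 +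
      (u 0 * v 1 - u 1 * v 0) * x 2 := by
  simp [spanForm]

lemma eval_spanForm_left (u v : Fin 3 → k) : eval u (spanForm u v) = 0 := by
  rw [eval_spanForm]; ring

lemma eval_spanForm_right (u v : Fin 3 → k) : eval v (spanForm u v) = 0 := by
  rw [eval_spanForm]; ring

lemma eval_spanForm_swap (u v x : Fin 3 → k) :
    eval x (spanForm v u) = -eval x (spanForm u v) := by
  simp only [eval_spanForm]; ring

lemma eval_spanForm_rotate (u v x : Fin 3 → k) :
    eval x (spanForm u v) = eval v (spanForm x u) := by
  simp only [eval_spanForm]; ring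

/-- If `u ≠ 0` and the form through `u` and `v` is trivial, then `v` is a multiple of `u`. -/
lemma exists_eq_smul_of_spanForm_eq_zero {u v : Fin 3 → k} (hu : u ≠ 0)
    (h : spanForm u v = 0) : ∃ c : k, v = c • u := by
  have key (x : Fin 3 → k) := (eval_spanForm u v x).symm.trans (by rw [h, map_zero])
  have h0 := key ![1, 0, 0]
  have h1 := key ![0, 1, 0]
  have h2 := key ![0, 0, 1]
  simp at h0 h1 h2
  obtain ⟨i, hi⟩ := Function.ne_iff.mp hu
  rw [Pi.zero_apply] at hi
  refine ⟨v i / u i, funext fun j ↦ ?_⟩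
  rw [Pi.smul_apply, smul_eq_mul, div_mul_eq_mul_div, eq_div_iff hi]
  fin_cases i <;> fin_cases j <;> simp <;> grind

/-- In a family of points with no three on a line, the lines joining `p a` to two further
members `p b` and `p c` meet only at `p a`. -/
lemma eval_spanForm_ne_zero_of_eval_spanForm_eq_zero {ι : Type*} {p : ι → Fin 3 → k}
    (hline : ∀ l : MvPolynomial (Fin 3) k, l.IsHomogeneous 1 → l ≠ 0 →
      ∀ i₁ i₂ i₃ : ι, i₁ ≠ i₂ → i₁ ≠ i₃ → i₂ ≠ i₃ →
        ¬(eval (p i₁) l = 0 ∧ eval (p i₂) l = 0 ∧ eval (p i₃) l = 0))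
    {x : Fin 3 → k} {a b c : ι} (hab : a ≠ b) (hac : a ≠ c) (hbc : b ≠ c) (ha : p a ≠ 0)
    (hx : ∀ t : k, x ≠ t • p a) (h : eval x (spanForm (p a) (p b)) = 0) :
    eval x (spanForm (p a) (p c)) ≠ 0 := by
  intro h'
  refine hline (spanForm x (p a)) (spanForm_isHomogeneous _ _) (fun h0 ↦ ?_) a b c hab hac hbc
    ⟨eval_spanForm_right _ _, ?_, ?_⟩
  · have : spanForm (p a) x = 0 := by
      rw [spanForm] at h0 ⊢
      rw [← neg_eq_zero, ← h0]
      simp only [map_sub, map_mul]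
      ring
    obtain ⟨t, ht⟩ := exists_eq_smul_of_spanForm_eq_zero ha this
    exact hx t ht
  · rwa [← eval_spanForm_rotate]
  · rwa [← eval_spanForm_rotate]

/-- The form through `u` and `v` times a member of the pencil of quadrics
spanned by `Q₁` and `Q₂` is a cubic form. -/
lemma isHomogeneous_spanForm_mul_pencil (u v : Fin 3 → k) {Q₁ Q₂ : MvPolynomial (Fin 3) k}
    (h₁ : Q₁.IsHomogeneous 2) (h₂ : Q₂.IsHomogeneous 2) (e : Fin 3 → k) :
    (spanForm u v * (C (eval e Q₁) * Q₂ - C (eval e Q₂) * Q₁)).IsHomogeneous 3 :=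
  (spanForm_isHomogeneous u v).mul ((h₂.C_mul _).sub (h₁.C_mul _))

end spanForm

/-- If seven pairwise non-proportional nonzero vectors of `k³` (`k` algebraically closed)
represent seven points of `ℙ²(k)` in general position (no three on a line, no six on a
conic), then the common zero locus in `ℙ²(k)` of all homogeneous cubic forms vanishing at
the seven points is exactly the seven points: a nonzero `p₀ ∈ k³` is killed by every such
cubic iff `p₀` is proportional to some `p i`. -/
theorem statement12 {k : Type*} [Field k] [IsAlgClosed k] (p : Fin 7 → (Fin 3 → k))
    (hnz : ∀ i, p i ≠ 0)
    (hnp : ∀ i j, i ≠ j → ∀ c : k, p j ≠ c • p i)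
    (hline : ∀ l : MvPolynomial (Fin 3) k, l.IsHomogeneous 1 → l ≠ 0 →
      ∀ i₁ i₂ i₃ : Fin 7, i₁ ≠ i₂ → i₁ ≠ i₃ → i₂ ≠ i₃ →
        ¬(eval (p i₁) l = 0 ∧ eval (p i₂) l = 0 ∧ eval (p i₃) l = 0))
    (hconic : ∀ q : MvPolynomial (Fin 3) k, q.IsHomogeneous 2 → q ≠ 0 →
      ∀ s : Finset (Fin 7), s.card = 6 → ¬(∀ i ∈ s, eval (p i) q = 0)) :
    ∀ p₀ : Fin 3 → k, p₀ ≠ 0 →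
      ((∀ q : MvPolynomial (Fin 3) k, q.IsHomogeneous 3 →
          (∀ i, eval (p i) q = 0) → eval p₀ q = 0) ↔
        ∃ i, ∃ c : k, p₀ = c • p i) := by
  intro p₀ hp₀
  refine ⟨fun H ↦ ?_, ?_⟩
  swap
  · rintro ⟨i, c, rfl⟩ q hq hqp
    rw [hq.eval_smul, hqp, mul_zero]
  by_contra! hne
  have meet {a b c : Fin 7} (hab : a ≠ b) (hac : a ≠ c) (hbc : b ≠ c) :
      eval p₀ (spanForm (p a) (p b)) = 0 → eval p₀ (spanForm (p a) (p c)) ≠ 0 :=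
    eval_spanForm_ne_zero_of_eval_spanForm_eq_zero hline hab hac hbc (hnz a) (hne a)
  have swap {a b : Fin 7} (h : eval p₀ (spanForm (p a) (p b)) = 0) :
      eval p₀ (spanForm (p b) (p a)) = 0 := by rw [eval_spanForm_swap, h, neg_zero]
  have noncol {a b c : Fin 7} (hab : a ≠ b) (hac : a ≠ c) (hbc : b ≠ c) :
      eval (p c) (spanForm (p a) (p b)) ≠ 0 := fun h ↦
    hline _ (spanForm_isHomogeneous _ _)
      (fun h0 ↦ (exists_eq_smul_of_spanForm_eq_zero (hnz a) h0).elim fun t ↦ hnp a b hab t)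
      a b c hab hac hbc ⟨eval_spanForm_left _ _, eval_spanForm_right _ _, h⟩
  set Q₁ := spanForm (p 0) (p 1) * spanForm (p 2) (p 3) with hQ₁
  set Q₂ := spanForm (p 0) (p 2) * spanForm (p 1) (p 3) with hQ₂
  have h₁ : Q₁.IsHomogeneous 2 := (spanForm_isHomogeneous _ _).mul (spanForm_isHomogeneous _ _)
  have h₂ : Q₂.IsHomogeneous 2 := (spanForm_isHomogeneous _ _).mul (spanForm_isHomogeneous _ _)
  have base (i : Fin 7) (hi : i < 4) : eval (p i) Q₁ = 0 ∧ eval (p i) Q₂ = 0 := by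
    have : i = 0 ∨ i = 1 ∨ i = 2 ∨ i = 3 := by omega
    rcases this with rfl | rfl | rfl | rfl <;>
      simp [hQ₁, hQ₂, eval_spanForm_left, eval_spanForm_right]
  -- each reducible cubic of this shape through the seven points vanishes at `p₀`
  have split {e f g : Fin 7} (hefg : ∀ i : Fin 7, i < 4 ∨ i = e ∨ i = f ∨ i = g) :
      eval p₀ (spanForm (p f) (p g)) = 0 ∨
        eval (p e) Q₁ * eval p₀ Q₂ = eval (p e) Q₂ * eval p₀ Q₁ := by
    have := H _ (isHomogeneous_spanForm_mul_pencil (p f) (p g) h₁ h₂ (p e)) fun i ↦ by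
      rcases hefg i with hi | rfl | rfl | rfl
      · simp [base i hi]
      · simp [mul_comm]
      · simp [eval_spanForm_left]
      · simp [eval_spanForm_right]
    simpa [sub_eq_zero] using this
  -- the member of the pencil through `p₀` passes through at most one more of the points
  have pencil {e f : Fin 7} (he : 4 ≤ e) (hf : 4 ≤ f) (hef : e ≠ f)
      (hpe : eval (p e) Q₁ * eval p₀ Q₂ = eval (p e) Q₂ * eval p₀ Q₁)
      (hpf : eval (p f) Q₁ * eval p₀ Q₂ = eval (p f) Q₂ * eval p₀ Q₁) : False := by
    have hQ : C (eval p₀ Q₁) * Q₂ - C (eval p₀ Q₂) * Q₁ = 0 := by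
      by_contra h0
      refine hconic _ ((h₂.C_mul _).sub (h₁.C_mul _)) h0 {0, 1, 2, 3, e, f} ?_ ?_
      · clear * - he hf hef
        revert e f
        decide
      · intro i hi
        simp only [Finset.mem_insert, Finset.mem_singleton] at hi
        simp only [map_sub, map_mul, eval_C]
        rcases hi with rfl | rfl | rfl | rfl | rfl | rfl
        · simp [base 0 (by decide)]
        · simp [base 1 (by decide)]
        · simp [base 2 (by decide)]
        · simp [base 3 (by decide)]
        · linear_combination -hpe
        · linear_combination -hpf
    have hev (x : Fin 3 → k) : eval p₀ Q₁ * eval x Q₂ = eval p₀ Q₂ * eval x Q₁ := by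
      simpa [sub_eq_zero] using congrArg (eval x) hQ
    have n012 := noncol (a := 0) (b := 1) (c := 2) (by decide) (by decide) (by decide)
    have n013 := noncol (a := 0) (b := 1) (c := 3) (by decide) (by decide) (by decide)
    have n023 := noncol (a := 0) (b := 2) (c := 3) (by decide) (by decide) (by decide)
    have z₁ : eval p₀ Q₁ = 0 := by
      have e₁ : eval (p 0 + p 1) Q₁ = 0 := by
        simp only [hQ₁, map_mul, eval_spanForm, Pi.add_apply]; ring
      have e₂ : eval (p 0 + p 1) Q₂ =
          -(eval (p 2) (spanForm (p 0) (p 1)) * eval (p 3) (spanForm (p 0) (p 1))) := by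
        simp only [hQ₂, map_mul, eval_spanForm, Pi.add_apply]; ring
      have := hev (p 0 + p 1)
      simpa [e₁, e₂, n012, n013] using this
    have z₂ : eval p₀ Q₂ = 0 := by
      have e₁ : eval (p 0 + p 2) Q₂ = 0 := by
        simp only [hQ₂, map_mul, eval_spanForm, Pi.add_apply]; ring
      have e₂ : eval (p 0 + p 2) Q₁ =
          eval (p 2) (spanForm (p 0) (p 1)) * eval (p 3) (spanForm (p 0) (p 2)) := by
        simp only [hQ₁, map_mul, eval_spanForm, Pi.add_apply]; ring
      have := hev (p 0 + p 2)
      simpa [e₁, e₂, n012, n023] using this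
    rw [hQ₁, map_mul, mul_eq_zero] at z₁
    rw [hQ₂, map_mul, mul_eq_zero] at z₂
    rcases z₁ with z₁ | z₁ <;> rcases z₂ with z₂ | z₂
    · exact meet (by decide) (by decide) (by decide) z₁ z₂
    · exact meet (by decide) (by decide) (by decide) (swap z₁) z₂
    · exact meet (by decide) (by decide) (by decide) z₁ (swap z₂)
    · exact meet (by decide) (by decide) (by decide) (swap z₁) (swap z₂)
  have s₄ := split (e := 4) (f := 5) (g := 6) (by decide)
  have s₅ := split (e := 5) (f := 6) (g := 4) (by decide)
  have s₆ := split (e := 6) (f := 4) (g := 5) (by decide)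
  rcases s₄ with s₄ | s₄
  · rcases s₅ with s₅ | s₅
    · exact meet (by decide) (by decide) (by decide) (swap s₄) s₅
    rcases s₆ with s₆ | s₆
    · exact meet (by decide) (by decide) (by decide) s₄ (swap s₆)
    · exact pencil (by decide) (by decide) (by decide) s₅ s₆
  · rcases s₅ with s₅ | s₅
    · rcases s₆ with s₆ | s₆
      · exact meet (by decide) (by decide) (by decide) (swap s₅) s₆
      · exact pencil (by decide) (by decide) (by decide) s₄ s₆
    · exact pencil (by decide) (by decide) (by decide) s₄ s₅
end

section
/- Let K be a field with algebraic closure K_a and let f(t) = Σ_{i=0}^{7} cᵢ tⁱ ∈ K[t] with c₇ ≠ 0. Let h(t) = Σ_{i=0}^{6} dᵢ tⁱ ∈ K[t] be the remainder of t⁹ upon division by f(t). Define the homogeneous cubic forms u = x z² − y³, v = c₇ x²y + c₆ x²z + c₅ x y² + c₄ x y z + c₃ x z² + c₂ y² z + c₁ y z² + c₀ z³, and w = x³ − d₆ x² z − d₅ x y² − d₄ x y z − d₃ x z² − d₂ y² z − d₁ y z² − d₀ z³ in K[x,y,z]. Then for every root α ∈ K_a of f one has u(α³, α, 1) = v(α³,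 α, 1) = w(α³, α, 1) = 0, and u, v, w are linearly independent over K_a. -/
/-- Let `f(t) = ∑_{i≤7} cᵢ tⁱ ∈ K[t]` with `c₇ ≠ 0`, and let `h(t) = ∑_{i≤6} dᵢ tⁱ` be the
remainder of `t⁹` upon division by `f`. Then the cubic forms
`u = xz² − y³`,
`v = c₇x²y + c₆x²z + c₅xy² + c₄xyz + c₃xz² + c₂y²z + c₁yz² + c₀z³`,
`w = x³ − d₆x²z − d₅xy² − d₄xyz − d₃xz² − d₂y²z − d₁yz² − d₀z³`
vanish at `(α³, α, 1)` for every root `α ∈ Ka` of `f`, and are linearly independent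
over the algebraic closure `Ka`. -/
theorem statement13 {K Ka : Type*} [Field K] [Field Ka] [Algebra K Ka] [IsAlgClosure K Ka]
    (c : Fin 8 → K) (hc7 : c 7 ≠ 0) (d : Fin 7 → K)
    (f : Polynomial K)
    (hf : f = ∑ i : Fin 8, Polynomial.C (c i) * Polynomial.X ^ (i : ℕ))
    (hrem : ∃ g : Polynomial K,
      (Polynomial.X : Polynomial K) ^ 9 =
        f * g + ∑ i : Fin 7, Polynomial.C (d i) * Polynomial.X ^ (i : ℕ))
    (u v w : MvPolynomial (Fin 3) Ka)
    (hu : u = MvPolynomial.X 0 * MvPolynomial.X 2 ^ 2 - MvPolynomial.X 1 ^ 3)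
    (hv : v = MvPolynomial.C (algebraMap K Ka (c 7)) * MvPolynomial.X 0 ^ 2 * MvPolynomial.X 1
      + MvPolynomial.C (algebraMap K Ka (c 6)) * MvPolynomial.X 0 ^ 2 * MvPolynomial.X 2
      + MvPolynomial.C (algebraMap K Ka (c 5)) * MvPolynomial.X 0 * MvPolynomial.X 1 ^ 2
      + MvPolynomial.C (algebraMap K Ka (c 4)) * MvPolynomial.X 0 * MvPolynomial.X 1
          * MvPolynomial.X 2
      + MvPolynomial.C (algebraMap K Ka (c 3)) * MvPolynomial.X 0 * MvPolynomial.X 2 ^ 2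
      + MvPolynomial.C (algebraMap K Ka (c 2)) * MvPolynomial.X 1 ^ 2 * MvPolynomial.X 2
      + MvPolynomial.C (algebraMap K Ka (c 1)) * MvPolynomial.X 1 * MvPolynomial.X 2 ^ 2
      + MvPolynomial.C (algebraMap K Ka (c 0)) * MvPolynomial.X 2 ^ 3)
    (hw : w = MvPolynomial.X 0 ^ 3
      - MvPolynomial.C (algebraMap K Ka (d 6)) * MvPolynomial.X 0 ^ 2 * MvPolynomial.X 2
      - MvPolynomial.C (algebraMap K Ka (d 5)) * MvPolynomial.X 0 * MvPolynomial.X 1 ^ 2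
      - MvPolynomial.C (algebraMap K Ka (d 4)) * MvPolynomial.X 0 * MvPolynomial.X 1
          * MvPolynomial.X 2
      - MvPolynomial.C (algebraMap K Ka (d 3)) * MvPolynomial.X 0 * MvPolynomial.X 2 ^ 2
      - MvPolynomial.C (algebraMap K Ka (d 2)) * MvPolynomial.X 1 ^ 2 * MvPolynomial.X 2
      - MvPolynomial.C (algebraMap K Ka (d 1)) * MvPolynomial.X 1 * MvPolynomial.X 2 ^ 2
      - MvPolynomial.C (algebraMap K Ka (d 0)) * MvPolynomial.X 2 ^ 3) :
    (∀ α : Ka, Polynomial.aeval α f = 0 →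
      MvPolynomial.eval ![α ^ 3, α, 1] u = 0 ∧
      MvPolynomial.eval ![α ^ 3, α, 1] v = 0 ∧
      MvPolynomial.eval ![α ^ 3, α, 1] w = 0) ∧
    LinearIndependent Ka ![u, v, w] := by
  refine ⟨fun α hα => ?_, ?_⟩
  · obtain ⟨g, hg⟩ := hrem
    have hh := congrArg (Polynomial.aeval α) hg
    rw [map_add, map_mul, hα, zero_mul, zero_add] at hh
    rw [hf] at hα
    simp only [Fin.sum_univ_succ, Fin.sum_univ_zero, map_add, map_mul, map_pow,
      Polynomial.aeval_C, Polynomial.aeval_X, map_zero] at hα hh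
    simp at hα hh
    refine ⟨?_, ?_, ?_⟩
    · simp [hu]
    · simp [hv]
      linear_combination hα
    · simp [hw]
      linear_combination hh
  · rw [Fintype.linearIndependent_iff]
    intro a ha
    have hc : algebraMap K Ka (c 7) ≠ 0 := by simpa using hc7
    have hP := congrArg (MvPolynomial.aeval ![(1 : Polynomial Ka), Polynomial.X, 0]) ha
    simp [Fin.sum_univ_three, hu, hv, hw] at hP
    have h0 := congrArg (Polynomial.coeff · 0) hP
    have h1 := congrArg (Polynomial.coeff · 1) hP
    have h3 := congrArg (Polynomial.coeff · 3) hP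
    simp [Polynomial.coeff_X, Polynomial.coeff_X_pow, Polynomial.coeff_C] at h0 h1 h3
    intro i
    fin_cases i <;> simp_all
end

section
/- Let K be a field with algebraic closure K_a and let f(t) = Σ_{i=0}^{7} cᵢ tⁱ ∈ K[t] be a separable irreducible polynomial of degree 7 whose set of roots ℛ_f ⊂ K_a satisfies: the image of Gal(K_a/K) in the group of permutations of ℛ_f is the full symmetric group S₇ or the alternating group A₇. Let h(t) = Σ_{i=0}^{6} dᵢ tⁱ ∈ K[t] be the remainder of t⁹ upon division by f(t), and define u = x z² − y³, v = c₇ x²y + c₆ x²z + c₅ x y² + c₄ x y z + c₃ x z² + c₂ y² z + c₁ y z² + c₀ z³, and w = x³ − d₆ x² z − d₅ x y² − d₄ x y z − d₃ x z² − d₂ y² z − d₁ y z² − d₀ z³. Then {u, v, w} is a K_a-basis of the space H of homogeneous cubic forms in K_a[x,y,z] vanishing at every point (α³, α, 1), α ∈ ℛ_f; in particular H is 3-dimensional over K_a. -/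
open scoped Classical

/-- The space `H_{B_f}` of homogeneous cubic forms in `Ka[x,y,z]` vanishing at every point
`(α³, α, 1)`, `α` a root of `f` in `Ka`. -/
noncomputable def cubicsVanishingAtRoots (K Ka : Type*) [Field K] [Field Ka] [Algebra K Ka]
    (f : Polynomial K) : Submodule Ka (MvPolynomial (Fin 3) Ka) :=
  MvPolynomial.homogeneousSubmodule (Fin 3) Ka 3 ⊓
    ⨅ α : f.rootSet Ka,
      LinearMap.ker (MvPolynomial.aeval (R := Ka) ![(α : Ka) ^ 3, (α : Ka), 1]).toLinearMap

/-- The cubic monomials in three variables span the homogeneous cubic forms: a submodule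
containing all ten of them contains every cubic form. -/
theorem MvPolynomial.IsHomogeneous.mem_of_cubic_monomials_mem {R : Type*} [CommRing R]
    (S : Submodule R (MvPolynomial (Fin 3) R))
    (hS : ∀ i j k : ℕ, i + j + k = 3 →
      (MvPolynomial.X 0 ^ i * MvPolynomial.X 1 ^ j * MvPolynomial.X 2 ^ k) ∈ S)
    {P : MvPolynomial (Fin 3) R} (hP : P.IsHomogeneous 3) : P ∈ S := by
  rw [P.as_sum]
  refine S.sum_mem fun m hm => ?_
  have hdeg : m 0 + m 1 + m 2 = 3 := by
    have h := hP (MvPolynomial.mem_support_iff.mp hm)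
    rwa [Finsupp.weight_apply, Finsupp.sum_fintype _ _ (by simp), Fin.sum_univ_three,
      Pi.one_apply, Pi.one_apply, Pi.one_apply, smul_eq_mul, smul_eq_mul, smul_eq_mul,
      mul_one, mul_one, mul_one] at h
  rw [MvPolynomial.monomial_eq, Finsupp.prod_fintype _ _ (by simp), Fin.prod_univ_three,
    ← MvPolynomial.smul_eq_C_mul]
  exact S.smul_mem _ (hS _ _ _ hdeg)

/-- A polynomial of degree smaller than that of a separable polynomial `f` and vanishing at all
roots of `f` is zero. -/
theorem Polynomial.Separable.eq_zero_of_forall_rootSet {K Ka : Type*} [Field K] [Field Ka]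
    [Algebra K Ka] [IsAlgClosed Ka] {f : Polynomial K} (hsep : f.Separable) {q : Polynomial Ka}
    (hq : q.degree < f.natDegree) (hroot : ∀ α ∈ f.rootSet Ka, q.eval α = 0) : q = 0 := by
  refine Polynomial.eq_zero_of_degree_lt_of_eval_finset_eq_zero (f.rootSet Ka).toFinset ?_
    fun α hα => hroot α (Set.mem_toFinset.mp hα)
  rwa [Set.toFinset_card,
    Polynomial.card_rootSet_eq_natDegree hsep (IsAlgClosed.splits _)]

/-- The seven cubic monomials in `x, y, z` whose values at `(t³, t, 1)` are `1, t, …, t⁶`, with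
`xz²` chosen over `y³` for `t³`. -/
noncomputable def lowCubicMonomial (R : Type*) [CommRing R] : Fin 7 → MvPolynomial (Fin 3) R :=
  ![.X 2 ^ 3, .X 1 * .X 2 ^ 2, .X 1 ^ 2 * .X 2, .X 0 * .X 2 ^ 2, .X 0 * .X 1 * .X 2,
    .X 0 * .X 1 ^ 2, .X 0 ^ 2 * .X 2]

theorem aeval_lowCubicMonomial {R : Type*} [CommRing R] (i : Fin 7) (α : R) :
    MvPolynomial.aeval (R := R) ![α ^ 3, α, 1] (lowCubicMonomial R i) = α ^ (i : ℕ) := by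
  fin_cases i <;> simp [lowCubicMonomial] <;> ring

theorem isHomogeneous_lowCubicMonomial (R : Type*) [CommRing R] (i : Fin 7) :
    (lowCubicMonomial R i).IsHomogeneous 3 := by
  have hX : ∀ j : Fin 3, (MvPolynomial.X j : MvPolynomial (Fin 3) R).IsHomogeneous 1 :=
    MvPolynomial.isHomogeneous_X R
  fin_cases i
  exacts [(hX 2).pow 3, (hX 1).mul ((hX 2).pow 2), ((hX 1).pow 2).mul (hX 2),
    (hX 0).mul ((hX 2).pow 2), ((hX 0).mul (hX 1)).mul (hX 2), (hX 0).mul ((hX 1).pow 2),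
    ((hX 0).pow 2).mul (hX 2)]

/-- A submodule containing the seven low cubic monomials together with `y³`, `x²y` and `x³`
contains every cubic form. -/
theorem MvPolynomial.IsHomogeneous.mem_of_lowCubicMonomial_mem {R : Type*} [CommRing R]
    {S : Submodule R (MvPolynomial (Fin 3) R)} (hlow : ∀ i, lowCubicMonomial R i ∈ S)
    (hy3 : MvPolynomial.X 1 ^ 3 ∈ S) (hx2y : MvPolynomial.X 0 ^ 2 * MvPolynomial.X 1 ∈ S)
    (hx3 : MvPolynomial.X 0 ^ 3 ∈ S) {P : MvPolynomial (Fin 3) R} (hP : P.IsHomogeneous 3) :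
    P ∈ S := by
  refine hP.mem_of_cubic_monomials_mem S fun i j k hijk => ?_
  obtain ⟨hi, hj, rfl⟩ : i ≤ 3 ∧ j ≤ 3 - i ∧ k = 3 - i - j := by omega
  interval_cases i <;> interval_cases j
  · simpa [lowCubicMonomial] using hlow 0
  · simpa [lowCubicMonomial] using hlow 1
  · simpa [lowCubicMonomial] using hlow 2
  · simpa using hy3
  · simpa [lowCubicMonomial] using hlow 3
  · simpa [lowCubicMonomial] using hlow 4
  · simpa [lowCubicMonomial] using hlow 5
  · simpa [lowCubicMonomial] using hlow 6
  · simpa using hx2y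
  · simpa using hx3

/-- A combination of the low cubic monomials vanishing at `(α³, α, 1)` for all roots `α` of a
separable polynomial of degree 7 is trivial. -/
theorem Polynomial.Separable.eq_zero_of_sum_lowCubicMonomial {K Ka : Type*} [Field K] [Field Ka]
    [Algebra K Ka] [IsAlgClosed Ka] {f : Polynomial K} (hsep : f.Separable)
    (hdeg : f.natDegree = 7) {p : Fin 7 → Ka}
    (h : ∀ α ∈ f.rootSet Ka, MvPolynomial.aeval (R := Ka) ![α ^ 3, α, 1]
      (∑ i, p i • lowCubicMonomial Ka i) = 0) : p = 0 := by
  have hp : Polynomial.ofFn 7 p = 0 := by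
    refine hsep.eq_zero_of_forall_rootSet (Ka := Ka) ?_ fun α hα => ?_
    · rw [hdeg]
      exact Polynomial.ofFn_degree_lt _
    · have hα := h α hα
      simp_rw [map_sum, map_smul, aeval_lowCubicMonomial, smul_eq_mul] at hα
      simpa [Polynomial.ofFn_eq_sum_monomial, Polynomial.eval_finsetSum] using hα
  exact Polynomial.injective_ofFn 7 (hp.trans (map_zero _).symm)

/-- Cubic forms with leading monomials `y³`, `x²y`, `x³` modulo the low cubic monomials are
linearly independent. -/
theorem linearIndependent_cubics {F : Type*} [Field F] {a : F} (ha : a ≠ 0) (p q r : Fin 7 → F)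
    {u v w : MvPolynomial (Fin 3) F}
    (hu : u = ∑ i, p i • lowCubicMonomial F i - MvPolynomial.X 1 ^ 3)
    (hv : v = a • (MvPolynomial.X 0 ^ 2 * MvPolynomial.X 1) +
      ∑ i, q i • lowCubicMonomial F i)
    (hw : w = MvPolynomial.X 0 ^ 3 - ∑ i, r i • lowCubicMonomial F i) :
    LinearIndependent F ![u, v, w] := by
  rw [Fintype.linearIndependent_iff]
  intro g hg
  rw [Fin.sum_univ_three] at hg
  change g 0 • u + g 1 • v + g 2 • w = 0 at hg
  have heval : ∀ x : Fin 3 → Polynomial F, MvPolynomial.aeval (R := F) x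
      (g 0 • u + g 1 • v + g 2 • w) = 0 := fun x => by
    rw [hg, map_zero]
  have h0 := heval ![0, 1, 0]
  have h1 := congrArg (Polynomial.coeff · 2) (heval ![Polynomial.X, 1, 0])
  have h2 := heval ![1, 0, 0]
  simp [hu, hv, hw, Fin.sum_univ_seven, lowCubicMonomial] at h0 h2
  simp [hu, hv, hw, h0, h2, Fin.sum_univ_seven, lowCubicMonomial, Polynomial.coeff_X, ha] at h1
  intro i
  fin_cases i
  exacts [h0, h1, h2]

/-- For `f(t) = ∑_{i≤7} cᵢ tⁱ ∈ K[t]` separable irreducible of degree 7 with Galois group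
`S₇` or `A₇` on its roots, and `h(t) = ∑_{i≤6} dᵢ tⁱ` the remainder of `t⁹` modulo `f`,
the cubic forms `u = xz² − y³`,
`v = c₇x²y + c₆x²z + c₅xy² + c₄xyz + c₃xz² + c₂y²z + c₁yz² + c₀z³`, and
`w = x³ − d₆x²z − d₅xy² − d₄xyz − d₃xz² − d₂y²z − d₁yz² − d₀z³`
form a `Ka`-basis of the space `H` of homogeneous cubic forms vanishing on
`B_f = {(α³ : α : 1) | f(α) = 0}`; in particular `H` is 3-dimensional. -/
theorem statement14 {K Ka : Type*} [Field K] [Field Ka] [Algebra K Ka] [IsAlgClosure K Ka]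
    (c : Fin 8 → K) (hc7 : c 7 ≠ 0) (d : Fin 7 → K)
    (f : Polynomial K)
    (hf : f = ∑ i : Fin 8, Polynomial.C (c i) * Polynomial.X ^ (i : ℕ))
    (hirr : Irreducible f) (hsep : f.Separable) (hdeg : f.natDegree = 7)
    (hbig : (galRootPerm K Ka f).range = ⊤ ∨
      (galRootPerm K Ka f).range = alternatingGroup (f.rootSet Ka))
    (hrem : ∃ g : Polynomial K,
      (Polynomial.X : Polynomial K) ^ 9 =
        f * g + ∑ i : Fin 7, Polynomial.C (d i) * Polynomial.X ^ (i : ℕ))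
    (u v w : MvPolynomial (Fin 3) Ka)
    (hu : u = MvPolynomial.X 0 * MvPolynomial.X 2 ^ 2 - MvPolynomial.X 1 ^ 3)
    (hv : v = MvPolynomial.C (algebraMap K Ka (c 7)) * MvPolynomial.X 0 ^ 2 * MvPolynomial.X 1
      + MvPolynomial.C (algebraMap K Ka (c 6)) * MvPolynomial.X 0 ^ 2 * MvPolynomial.X 2
      + MvPolynomial.C (algebraMap K Ka (c 5)) * MvPolynomial.X 0 * MvPolynomial.X 1 ^ 2
      + MvPolynomial.C (algebraMap K Ka (c 4)) * MvPolynomial.X 0 * MvPolynomial.X 1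
          * MvPolynomial.X 2
      + MvPolynomial.C (algebraMap K Ka (c 3)) * MvPolynomial.X 0 * MvPolynomial.X 2 ^ 2
      + MvPolynomial.C (algebraMap K Ka (c 2)) * MvPolynomial.X 1 ^ 2 * MvPolynomial.X 2
      + MvPolynomial.C (algebraMap K Ka (c 1)) * MvPolynomial.X 1 * MvPolynomial.X 2 ^ 2
      + MvPolynomial.C (algebraMap K Ka (c 0)) * MvPolynomial.X 2 ^ 3)
    (hw : w = MvPolynomial.X 0 ^ 3
      - MvPolynomial.C (algebraMap K Ka (d 6)) * MvPolynomial.X 0 ^ 2 * MvPolynomial.X 2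
      - MvPolynomial.C (algebraMap K Ka (d 5)) * MvPolynomial.X 0 * MvPolynomial.X 1 ^ 2
      - MvPolynomial.C (algebraMap K Ka (d 4)) * MvPolynomial.X 0 * MvPolynomial.X 1
          * MvPolynomial.X 2
      - MvPolynomial.C (algebraMap K Ka (d 3)) * MvPolynomial.X 0 * MvPolynomial.X 2 ^ 2
      - MvPolynomial.C (algebraMap K Ka (d 2)) * MvPolynomial.X 1 ^ 2 * MvPolynomial.X 2
      - MvPolynomial.C (algebraMap K Ka (d 1)) * MvPolynomial.X 1 * MvPolynomial.X 2 ^ 2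
      - MvPolynomial.C (algebraMap K Ka (d 0)) * MvPolynomial.X 2 ^ 3) :
    LinearIndependent Ka ![u, v, w] ∧
    Submodule.span Ka {u, v, w} = cubicsVanishingAtRoots K Ka f ∧
    Module.finrank Ka (cubicsVanishingAtRoots K Ka f) = 3 := by
  have : IsAlgClosed Ka := IsAlgClosure.isAlgClosed K
  set φ := algebraMap K Ka
  have hφ : φ (c 7) ≠ 0 := (map_ne_zero _).mpr hc7
  let m := lowCubicMonomial Ka
  have hu_eq : u = m 3 - MvPolynomial.X 1 ^ 3 := hu
  have hv_eq : v = φ (c 7) • (MvPolynomial.X 0 ^ 2 * MvPolynomial.X 1) +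
      ∑ i : Fin 7, φ (c i.castSucc) • m i := by
    simp [m, lowCubicMonomial, hv, Fin.sum_univ_seven, MvPolynomial.smul_eq_C_mul]
    ring
  have hw_eq : w = MvPolynomial.X 0 ^ 3 - ∑ i : Fin 7, φ (d i) • m i := by
    simp [m, lowCubicMonomial, hw, Fin.sum_univ_seven, MvPolynomial.smul_eq_C_mul]
    ring
  have hv_root : ∀ α ∈ f.rootSet Ka, MvPolynomial.aeval (R := Ka) ![α ^ 3, α, 1] v = 0 := by
    intro α hα
    have h := Polynomial.aeval_eq_zero_of_mem_rootSet hα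
    rw [hf] at h
    simp [Fin.sum_univ_eight] at h
    rw [hv]
    simp
    linear_combination h
  have hw_root : ∀ α ∈ f.rootSet Ka, MvPolynomial.aeval (R := Ka) ![α ^ 3, α, 1] w = 0 := by
    intro α hα
    have h := Polynomial.aeval_eq_zero_of_mem_rootSet hα
    obtain ⟨g, hg⟩ := hrem
    have h' := congrArg (Polynomial.aeval α) hg
    rw [map_add, map_mul, h] at h'
    simp [Fin.sum_univ_seven] at h'
    rw [hw]
    simp
    linear_combination h'
  have hu_root : ∀ α : Ka, MvPolynomial.aeval (R := Ka) ![α ^ 3, α, 1] u = 0 := by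
    intro α
    simp [hu]
  have hind : LinearIndependent Ka ![u, v, w] :=
    linearIndependent_cubics hφ (Pi.single 3 1) (fun i => φ (c i.castSucc)) (fun i => φ (d i))
      (by simpa [Pi.single_apply] using hu_eq) hv_eq hw_eq
  have hspan : Submodule.span Ka {u, v, w} = cubicsVanishingAtRoots K Ka f := by
    apply le_antisymm
    · rw [Submodule.span_le]
      rintro P hP
      have hX : ∀ j : Fin 3, (MvPolynomial.X j : MvPolynomial (Fin 3) Ka).IsHomogeneous 1 :=
        MvPolynomial.isHomogeneous_X Ka
      have hm_hom := isHomogeneous_lowCubicMonomial Ka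
      refine ⟨?_, (Submodule.mem_iInf _).mpr fun α => ?_⟩
      · rcases hP with rfl | rfl | rfl
        · rw [hu_eq]
          exact Submodule.sub_mem _ (hm_hom 3) ((hX 1).pow 3)
        · rw [hv_eq]
          exact Submodule.add_mem _ (Submodule.smul_mem _ _ (((hX 0).pow 2).mul (hX 1)))
            (Submodule.sum_mem _ fun i _ => Submodule.smul_mem _ _ (hm_hom i))
        · rw [hw_eq]
          exact Submodule.sub_mem _ ((hX 0).pow 3)
            (Submodule.sum_mem _ fun i _ => Submodule.smul_mem _ _ (hm_hom i))
      · rcases hP with rfl | rfl | rfl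
        exacts [hu_root α, hv_root α α.2, hw_root α α.2]
    · rintro P ⟨hP, hPα⟩
      replace hPα := (Submodule.mem_iInf _).mp hPα
      let M := Submodule.span Ka {u, v, w} ⊔ Submodule.span Ka (Set.range m)
      have hmM : ∀ i, m i ∈ M := fun i =>
        Submodule.mem_sup_right (Submodule.subset_span ⟨i, rfl⟩)
      have huM : u ∈ M := Submodule.mem_sup_left (Submodule.subset_span (by simp))
      have hvM : v ∈ M := Submodule.mem_sup_left (Submodule.subset_span (by simp))
      have hwM : w ∈ M := Submodule.mem_sup_left (Submodule.subset_span (by simp))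
      have hy3 : MvPolynomial.X 1 ^ 3 ∈ M := by
        rw [show MvPolynomial.X 1 ^ 3 = m 3 - u by rw [hu_eq, sub_sub_cancel]]
        exact M.sub_mem (hmM 3) huM
      have hx2y : MvPolynomial.X 0 ^ 2 * MvPolynomial.X 1 ∈ M := by
        rw [← Submodule.smul_mem_iff M hφ, eq_sub_of_add_eq hv_eq.symm]
        exact M.sub_mem hvM (M.sum_mem fun i _ => M.smul_mem _ (hmM i))
      have hx3 : MvPolynomial.X 0 ^ 3 ∈ M := by
        rw [sub_eq_iff_eq_add.mp hw_eq.symm]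
        exact M.add_mem hwM (M.sum_mem fun i _ => M.smul_mem _ (hmM i))
      obtain ⟨Q, hQ, R, hR, rfl⟩ := Submodule.mem_sup.mp
        (MvPolynomial.IsHomogeneous.mem_of_lowCubicMonomial_mem hmM hy3 hx2y hx3 hP)
      obtain ⟨p, rfl⟩ := (Submodule.mem_span_range_iff_exists_fun Ka).mp hR
      have hQα : ∀ α ∈ f.rootSet Ka, MvPolynomial.aeval (R := Ka) ![α ^ 3, α, 1] Q = 0 := by
        intro α hα
        obtain ⟨x, y, z, rfl⟩ := Submodule.mem_span_triple.mp hQ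
        rw [map_add, map_add, map_smul, map_smul, map_smul, hu_root α, hv_root α hα,
          hw_root α hα]
        simp
      have hp : p = 0 := hsep.eq_zero_of_sum_lowCubicMonomial hdeg fun α hα => by
        have h : MvPolynomial.aeval (R := Ka) ![α ^ 3, α, 1] (Q + ∑ i, p i • m i) = 0 :=
          hPα ⟨α, hα⟩
        rwa [map_add, hQα α hα, zero_add] at h
      simpa [hp] using hQ
  refine ⟨hind, hspan, ?_⟩
  have h := finrank_span_eq_card hind
  rwa [Matrix.range_cons, Matrix.range_cons, Matrix.range_cons, Matrix.range_empty,
    Set.union_empty, Set.singleton_union, Set.singleton_union, hspan, Fintype.card_fin] at h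
end

section
/- Let K be a field with algebraic closure K_a and let F ∈ K[x,y,z] be a homogeneous form of degree 3 that is irreducible as an element of K_a[x,y,z] (i.e., the cubic curve E : F = 0 is absolutely irreducible). Let p : Fin 7 → K_a³ assign to each index a nonzero vector with F(pᵢ) = 0, the pᵢ pairwise non-proportional (so they represent a 7-element subset B of E(K_a) ⊂ ℙ²(K_a)). Assume that for every σ ∈ Gal(K_a/K) there exist a permutation π_σ of Fin 7 and nonzero scalars λᵢ ∈ K_a with σ(pᵢ) = λᵢ · p_{π_σ(i)} coordinatewise for all i (so B is Gal(K_a/K)-stable), that B is a single Galois orbit, and that the set of permutations π_σ arising this way is the full symmetric group on Fin 7 or the alternating group A₇. Then B is in general position: no nonzero homogeneous linear form in K_a[x,y,z] vanishes at three of the pᵢ, and no nonzero homogeneous quadratic form in K_a[x,y,z] vanishes at six of the pᵢ. -/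
open MvPolynomial

namespace PlaneCurve

open Module

section Forms

variable {k : Type*} [Field k]

/-- The linear form with coefficient vector `c`. -/
noncomputable def linearForm (c : Fin 3 → k) : MvPolynomial (Fin 3) k :=
  ∑ i, C (c i) * X i

lemma linearForm_isHomogeneous (c : Fin 3 → k) : (linearForm c).IsHomogeneous 1 :=
  IsHomogeneous.sum _ _ _ fun i _ => isHomogeneous_C_mul_X (c i) i

lemma eval_linearForm (c x : Fin 3 → k) : eval x (linearForm c) = x ⬝ᵥ c := by
  simp [linearForm, dotProduct, mul_comm]

lemma exists_dotProduct_ne_zero {c : Fin 3 → k} (hc : c ≠ 0) : ∃ x, x ⬝ᵥ c ≠ 0 := by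
  by_contra! h
  exact hc (dotProduct_eq_zero c fun w => by rw [dotProduct_comm]; exact h w)

lemma linearForm_ne_zero {c : Fin 3 → k} (hc : c ≠ 0) : linearForm c ≠ 0 := by
  obtain ⟨x, hx⟩ := exists_dotProduct_ne_zero hc
  intro h
  apply hx
  rw [← eval_linearForm, h, map_zero]

lemma cross_ne_zero {u v : Fin 3 → k} (hu : u ≠ 0) (hv : ∀ a : k, v ≠ a • u) :
    crossProduct u v ≠ 0 :=
  crossProduct_ne_zero_iff_linearIndependent.2
    ((LinearIndependent.pair_iff' hu).2 fun a h => hv a h.symm)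

/-- Two points lie on a line. -/
lemma exists_line_through {u v : Fin 3 → k} (hu : u ≠ 0) (hv : ∀ a : k, v ≠ a • u) :
    ∃ l : MvPolynomial (Fin 3) k, l.IsHomogeneous 1 ∧ l ≠ 0 ∧ eval u l = 0 ∧ eval v l = 0 :=
  ⟨linearForm (crossProduct u v), linearForm_isHomogeneous _,
    linearForm_ne_zero (cross_ne_zero hu hv), by simp [eval_linearForm],
    by simp [eval_linearForm]⟩

/-- Two distinct points are separated by a line. -/
lemma exists_line_separating {u v : Fin 3 → k} (hu : u ≠ 0) (hv : ∀ a : k, v ≠ a • u) :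
    ∃ l : MvPolynomial (Fin 3) k, l.IsHomogeneous 1 ∧ eval u l ≠ 0 ∧ eval v l = 0 := by
  obtain ⟨w, hw⟩ := exists_dotProduct_ne_zero (cross_ne_zero hu hv)
  refine ⟨linearForm (crossProduct v w), linearForm_isHomogeneous _, ?_, by simp [eval_linearForm]⟩
  rwa [eval_linearForm, triple_product_permutation, triple_product_permutation]

lemma setOf_degree_eq (n : ℕ) :
    {d : Fin 3 →₀ ℕ | d.degree = n} =
      ((Finset.univ.finsuppAntidiag n : Finset (Fin 3 →₀ ℕ)) : Set (Fin 3 →₀ ℕ)) := by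
  ext d
  simp [Finsupp.degree_eq_sum]

lemma finite_monomials (n : ℕ) : Finite {d : Fin 3 →₀ ℕ | d.degree = n} := by
  rw [setOf_degree_eq]
  exact Finset.finite_toSet _

lemma card_monomials (n : ℕ) :
    Nat.card {d : Fin 3 →₀ ℕ | d.degree = n} = (n + 2).choose n := by
  rw [setOf_degree_eq, Nat.card_coe_set_eq, Set.ncard_coe_finset,
    Finset.card_finsuppAntidiag_nat_eq_choose]
  simp [add_comm]

/-- The monomial basis of the space of ternary forms of degree `n`. -/
noncomputable def formsEquiv (n : ℕ) :
    homogeneousSubmodule (Fin 3) k n ≃ₗ[k] ({d : Fin 3 →₀ ℕ | d.degree = n} →₀ k) :=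
  (LinearEquiv.ofEq _ _ (homogeneousSubmodule_eq_finsupp_supported _ _ n)).trans
    (AddMonoidAlgebra.supportedEquivFinsupp _)

instance (n : ℕ) : FiniteDimensional k (homogeneousSubmodule (Fin 3) k n) := by
  have := finite_monomials n
  exact (formsEquiv n).symm.finiteDimensional

lemma finrank_forms (n : ℕ) :
    finrank k (homogeneousSubmodule (Fin 3) k n) = (n + 2).choose n := by
  have := finite_monomials n
  have := Fintype.ofFinite {d : Fin 3 →₀ ℕ | d.degree = n}
  rw [(formsEquiv n).finrank_eq, finrank_finsupp_self, ← Nat.card_eq_fintype_card,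
    card_monomials]

/-- If a form `g` of degree `e` vanishes at points that impose independent conditions on forms of
degree `c + e`, and there are enough of these points, then every form of degree `c + e` vanishing
at them is a multiple of `g`. -/
lemma exists_eq_mul_of_forall_eval_eq_zero {ι : Type*} [Fintype ι] {P : ι → Fin 3 → k}
    {c e : ℕ} {g : MvPolynomial (Fin 3) k} (hg : g.IsHomogeneous e) (hg0 : g ≠ 0)
    (hgP : ∀ i, eval (P i) g = 0)
    (hsep : ∀ i, ∃ f : MvPolynomial (Fin 3) k, f.IsHomogeneous (c + e) ∧ eval (P i) f ≠ 0 ∧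
      ∀ j, j ≠ i → eval (P j) f = 0)
    (hcard : (c + e + 2).choose (c + e) ≤ (c + 2).choose c + Fintype.card ι)
    {f : MvPolynomial (Fin 3) k} (hf : f.IsHomogeneous (c + e)) (hfP : ∀ i, eval (P i) f = 0) :
    ∃ h : MvPolynomial (Fin 3) k, h.IsHomogeneous c ∧ f = h * g := by
  classical
  let ev : homogeneousSubmodule (Fin 3) k (c + e) →ₗ[k] (ι → k) :=
    (LinearMap.pi fun i => (aeval (P i) : MvPolynomial (Fin 3) k →ₐ[k] k).toLinearMap) ∘ₗ
      Submodule.subtype _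
  have hev (x) (i) : ev x i = eval (P i) x.1 := by simp [ev, aeval_eq_eval]
  have hsurj : LinearMap.range ev = ⊤ := by
    rw [eq_top_iff, ← (Pi.basisFun k ι).span_eq, Submodule.span_le]
    rintro _ ⟨i, rfl⟩
    obtain ⟨f, hf, hfi, hfj⟩ := hsep i
    refine ⟨(eval (P i) f)⁻¹ • ⟨f, hf⟩, ?_⟩
    ext j
    rw [map_smul, Pi.smul_apply, hev, Pi.basisFun_apply]
    by_cases h : j = i
    · subst h; simp [hfi]
    · simp [hfj j h, h]
  let m : homogeneousSubmodule (Fin 3) k c →ₗ[k] homogeneousSubmodule (Fin 3) k (c + e) :=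
    ((LinearMap.mulRight k g).comp (Submodule.subtype _)).codRestrict _
      fun x => IsHomogeneous.mul x.2 hg
  have hm (x) : (m x).1 = x.1 * g := rfl
  have hinj : Function.Injective m := fun x y hxy => by
    have := congrArg Subtype.val hxy
    rw [hm, hm] at this
    exact Subtype.ext (mul_right_cancel₀ hg0 this)
  have hle : LinearMap.range m ≤ LinearMap.ker ev := by
    rintro _ ⟨x, rfl⟩
    rw [LinearMap.mem_ker]
    ext i
    rw [hev, hm, map_mul, hgP, mul_zero, Pi.zero_apply]
  have hrn := ev.finrank_range_add_finrank_ker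
  rw [hsurj, finrank_top, finrank_fintype_fun_eq_card, finrank_forms] at hrn
  have heq : LinearMap.range m = LinearMap.ker ev := by
    apply Submodule.eq_of_le_of_finrank_le hle
    rw [LinearMap.finrank_range_of_inj hinj, finrank_forms]
    omega
  have hfm : (⟨f, hf⟩ : homogeneousSubmodule (Fin 3) k (c + e)) ∈ LinearMap.range m := by
    rw [heq, LinearMap.mem_ker]
    ext i
    rw [hev, hfP, Pi.zero_apply]
  obtain ⟨h, hh⟩ := hfm
  exact ⟨h.1, h.2, by rw [← hm, hh]⟩

lemma not_irreducible_of_eq_mul {f g h : MvPolynomial (Fin 3) k} {a b : ℕ}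
    (hg : g.IsHomogeneous a) (hh : h.IsHomogeneous b) (ha : a ≠ 0) (hb : b ≠ 0)
    (hf : f = g * h) : ¬ Irreducible f := by
  intro hirr
  have h0 : g ≠ 0 ∧ h ≠ 0 := mul_ne_zero_iff.1 (hf ▸ hirr.ne_zero)
  rcases hirr.isUnit_or_isUnit hf with hu | hu
  · rw [isUnit_iff_totalDegree_of_isReduced, hg.totalDegree h0.1] at hu
    exact ha hu.2
  · rw [isUnit_iff_totalDegree_of_isReduced, hh.totalDegree h0.2] at hu
    exact hb hu.2

lemma eval_smul_of_isHomogeneous {f : MvPolynomial (Fin 3) k} {n : ℕ} (hf : f.IsHomogeneous n)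
    (r : k) (x : Fin 3 → k) : eval (r • x) f = r ^ n * eval x f := by
  rw [eval_eq, eval_eq, Finset.mul_sum]
  refine Finset.sum_congr rfl fun d hd => ?_
  have hdeg : ∑ i ∈ d.support, d i = n := by
    rw [← hf (mem_support_iff.1 hd), Finsupp.weight_apply]
    simp [Finsupp.sum]
  simp only [Pi.smul_apply, smul_eq_mul, mul_pow, Finset.prod_mul_distrib,
    Finset.prod_pow_eq_pow_sum, hdeg]
  ring

/-- Transport of a vanishing form along a field automorphism. -/
lemma eval_map_eq_zero {f : MvPolynomial (Fin 3) k} {n : ℕ} (hf : f.IsHomogeneous n)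
    (σ : k →+* k) {u v : Fin 3 → k} {a : k} (ha : a ≠ 0) (huv : (fun m => σ (u m)) = a • v)
    (hu : eval u f = 0) : eval v (map σ f) = 0 := by
  have h1 : eval (fun m => σ (u m)) (map σ f) = 0 := by
    have := map_eval σ u f
    simpa [Function.comp_def, hu] using this.symm
  rw [huv, eval_smul_of_isHomogeneous (hf.map σ)] at h1
  exact (mul_eq_zero.1 h1).resolve_left (pow_ne_zero _ ha)

end Forms

section SevenPoints

variable {k : Type*} [Field k] {p : Fin 7 → Fin 3 → k}

lemma exists_line_separating_pair
    (hnz : ∀ i, p i ≠ 0) (hnp : ∀ i j, i ≠ j → ∀ a : k, p j ≠ a • p i)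
    (hcol : ¬ ∃ l : MvPolynomial (Fin 3) k, l.IsHomogeneous 1 ∧ l ≠ 0 ∧
      ∃ i₁ i₂ i₃ : Fin 7, i₁ ≠ i₂ ∧ i₁ ≠ i₃ ∧ i₂ ≠ i₃ ∧
        eval (p i₁) l = 0 ∧ eval (p i₂) l = 0 ∧ eval (p i₃) l = 0)
    {i j m : Fin 7} (hij : i ≠ j) (him : i ≠ m) (hjm : j ≠ m) :
    ∃ l : MvPolynomial (Fin 3) k, l.IsHomogeneous 1 ∧ eval (p i) l ≠ 0 ∧
      eval (p j) l = 0 ∧ eval (p m) l = 0 := by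
  obtain ⟨l, hl, hl0, hj, hm⟩ := exists_line_through (hnz j) (hnp j m hjm)
  exact ⟨l, hl, fun hi => hcol ⟨l, hl, hl0, i, j, m, hij, him, hjm, hi, hj, hm⟩, hj, hm⟩

/-- Seven points of an irreducible cubic do not lie on a line. -/
lemma not_irreducible_of_line
    (hnz : ∀ i, p i ≠ 0) (hnp : ∀ i j, i ≠ j → ∀ a : k, p j ≠ a • p i)
    {f l : MvPolynomial (Fin 3) k} (hf : f.IsHomogeneous 3) (hl : l.IsHomogeneous 1)
    (hl0 : l ≠ 0) (hfp : ∀ i, eval (p i) f = 0) (hlp : ∀ i, eval (p i) l = 0) :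
    ¬ Irreducible f := by
  let P : Fin 4 → Fin 3 → k := fun i => p (Fin.castLE (by decide) i)
  obtain ⟨h, hh, hfh⟩ := exists_eq_mul_of_forall_eval_eq_zero (c := 2) (P := P) hl hl0
    (fun i => hlp _) (fun i => by
      have hsep (j : Fin 4) (hij : i ≠ j) := exists_line_separating (hnz (Fin.castLE _ i))
        (hnp (Fin.castLE (by decide) i) (Fin.castLE (by decide) j)
          (fun h => hij (Fin.castLE_injective _ h)))
      obtain ⟨l₁, h₁, hi₁, hz₁⟩ := hsep (i + 1) (by simp)
      obtain ⟨l₂, h₂, hi₂, hz₂⟩ := hsep (i + 2) (by simp)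
      obtain ⟨l₃, h₃, hi₃, hz₃⟩ := hsep (i + 3) (by simp)
      refine ⟨l₁ * l₂ * l₃, (h₁.mul h₂).mul h₃, ?_, fun j hj => ?_⟩
      · rw [map_mul, map_mul]
        exact mul_ne_zero (mul_ne_zero hi₁ hi₂) hi₃
      · have : j = i + 1 ∨ j = i + 2 ∨ j = i + 3 := by
          clear * - hj
          revert i j; decide
        rcases this with rfl | rfl | rfl <;> simp only [P, map_mul, hz₁, hz₂, hz₃] <;> simp)
    (by decide) hf (fun i => hfp _)
  exact not_irreducible_of_eq_mul hh hl (by decide) (by decide) hfh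

/-- Seven points of an irreducible cubic, no three of them collinear, do not lie on a conic. -/
lemma not_irreducible_of_conic
    (hnz : ∀ i, p i ≠ 0) (hnp : ∀ i j, i ≠ j → ∀ a : k, p j ≠ a • p i)
    (hcol : ¬ ∃ l : MvPolynomial (Fin 3) k, l.IsHomogeneous 1 ∧ l ≠ 0 ∧
      ∃ i₁ i₂ i₃ : Fin 7, i₁ ≠ i₂ ∧ i₁ ≠ i₃ ∧ i₂ ≠ i₃ ∧
        eval (p i₁) l = 0 ∧ eval (p i₂) l = 0 ∧ eval (p i₃) l = 0)
    {f q : MvPolynomial (Fin 3) k} (hf : f.IsHomogeneous 3) (hq : q.IsHomogeneous 2)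
    (hq0 : q ≠ 0) (hfp : ∀ i, eval (p i) f = 0) (hqp : ∀ i, eval (p i) q = 0) :
    ¬ Irreducible f := by
  obtain ⟨h, hh, hfh⟩ := exists_eq_mul_of_forall_eval_eq_zero (c := 1) (P := p) hq hq0
    hqp (fun i => by
      have hsep (j m : Fin 7) := exists_line_separating_pair hnz hnp hcol (i := i) (j := j) (m := m)
      obtain ⟨l₁, h₁, hi₁, hz₁, hw₁⟩ := hsep (i + 1) (i + 2) (by simp) (by simp) (by simp)
      obtain ⟨l₂, h₂, hi₂, hz₂, hw₂⟩ := hsep (i + 3) (i + 4) (by simp) (by simp) (by simp)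
      obtain ⟨l₃, h₃, hi₃, hz₃, hw₃⟩ := hsep (i + 5) (i + 6) (by simp) (by simp) (by simp)
      refine ⟨l₁ * l₂ * l₃, (h₁.mul h₂).mul h₃, ?_, fun j hj => ?_⟩
      · rw [map_mul, map_mul]
        exact mul_ne_zero (mul_ne_zero hi₁ hi₂) hi₃
      · have : j = i + 1 ∨ j = i + 2 ∨ j = i + 3 ∨ j = i + 4 ∨ j = i + 5 ∨ j = i + 6 := by
          clear * - hj
          revert i j; decide
        rcases this with rfl | rfl | rfl | rfl | rfl | rfl <;> simp [*])
    (by decide) hf hfp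
  exact not_irreducible_of_eq_mul hh hq (by decide) (by decide) hfh

/-- Two conics through the same five points, no three of them collinear, coincide; hence the first
vanishes wherever the second does. -/
lemma eval_conic_eq_zero
    (hnz : ∀ i, p i ≠ 0) (hnp : ∀ i j, i ≠ j → ∀ a : k, p j ≠ a • p i)
    (hcol : ¬ ∃ l : MvPolynomial (Fin 3) k, l.IsHomogeneous 1 ∧ l ≠ 0 ∧
      ∃ i₁ i₂ i₃ : Fin 7, i₁ ≠ i₂ ∧ i₁ ≠ i₃ ∧ i₂ ≠ i₃ ∧
        eval (p i₁) l = 0 ∧ eval (p i₂) l = 0 ∧ eval (p i₃) l = 0)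
    {q r : MvPolynomial (Fin 3) k} (hq : q.IsHomogeneous 2) (hr : r.IsHomogeneous 2)
    (hr0 : r ≠ 0) {a : Fin 7} (hqp : ∀ i, i ≠ a → eval (p i) q = 0)
    (hrp : ∀ i, i ≠ a + 1 → eval (p i) r = 0) : eval (p a) q = 0 := by
  let s : Fin 5 → Fin 7 := fun i => a + 2 + Fin.castLE (by decide) i
  have hs : Function.Injective s := fun i j h => Fin.castLE_injective _ (add_left_cancel h)
  have hs0 (i) : s i ≠ a := by simp only [s]; clear * -; revert a i; decide
  have hs1 (i) : s i ≠ a + 1 := by simp only [s]; clear * -; revert a i; decide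
  obtain ⟨h, -, hqr⟩ := exists_eq_mul_of_forall_eval_eq_zero (c := 0) (e := 2)
    (P := fun i => p (s i)) hr hr0 (fun i => hrp _ (hs1 i)) (fun i => by
      have hsep (j m : Fin 5) (hij : i ≠ j) (him : i ≠ m) (hjm : j ≠ m) :=
        exists_line_separating_pair hnz hnp hcol (hs.ne hij) (hs.ne him) (hs.ne hjm)
      obtain ⟨l₁, h₁, hi₁, hz₁, hw₁⟩ := hsep (i + 1) (i + 2) (by simp) (by simp) (by simp)
      obtain ⟨l₂, h₂, hi₂, hz₂, hw₂⟩ := hsep (i + 3) (i + 4) (by simp) (by simp) (by simp)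
      refine ⟨l₁ * l₂, h₁.mul h₂, ?_, fun j hj => ?_⟩
      · rw [map_mul]
        exact mul_ne_zero hi₁ hi₂
      · have : j = i + 1 ∨ j = i + 2 ∨ j = i + 3 ∨ j = i + 4 := by
          clear * - hj
          revert i j; decide
        rcases this with rfl | rfl | rfl | rfl <;> simp [*])
    (by decide) hq (fun i => hqp _ (hs0 i))
  rw [hqr, map_mul, hrp a (by simp), mul_zero]

/-- Two lines through the same two points coincide; hence the first vanishes wherever the second
does. -/
lemma eval_line_eq_zero {u v w : Fin 3 → k} (hu : u ≠ 0) (hv : v ≠ 0)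
    (huv : ∀ a : k, v ≠ a • u) (hvu : ∀ a : k, u ≠ a • v)
    {l l' : MvPolynomial (Fin 3) k} (hl : l.IsHomogeneous 1) (hl' : l'.IsHomogeneous 1)
    (hl0 : l' ≠ 0) (hlu : eval u l = 0) (hlv : eval v l = 0)
    (hlu' : eval u l' = 0) (hlv' : eval v l' = 0) (hw : eval w l' = 0) : eval w l = 0 := by
  obtain ⟨h, -, hll⟩ := exists_eq_mul_of_forall_eval_eq_zero (c := 0) (e := 1)
    (P := ![u, v]) hl' hl0 (by simp [Fin.forall_fin_two, *]) (by
      obtain ⟨f, hf, h1, h2⟩ := exists_line_separating hu huv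
      obtain ⟨g, hg, h3, h4⟩ := exists_line_separating hv hvu
      exact Fin.forall_fin_two.2 ⟨⟨f, hf, h1, by simp [Fin.forall_fin_two, h2]⟩,
        ⟨g, hg, h3, by simp [Fin.forall_fin_two, h4]⟩⟩)
    (by decide) hl (by simp [Fin.forall_fin_two, *])
  rw [hll, map_mul, hw, mul_zero]

lemma exists_even_perm_of_ne {a b c d : Fin 7} (hac : a ≠ c) (had : a ≠ d)
    (hbc : b ≠ c) (hbd : b ≠ d) (hcd : c ≠ d) :
    ∃ π ∈ alternatingGroup (Fin 7), π a = a ∧ π b = b ∧ π c = d := by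
  obtain ⟨m, hm⟩ : ∃ m, m ∉ ({a, b, c, d} : Finset (Fin 7)) := by
    by_contra! h
    have := (Finset.card_le_card (fun m _ => h m : Finset.univ ⊆ _)).trans Finset.card_le_four
    simp at this
  simp only [Finset.mem_insert, Finset.mem_singleton, not_or] at hm
  obtain ⟨hma, hmb, hmc, hmd⟩ := hm
  refine ⟨Equiv.swap c m * Equiv.swap c d, ?_, ?_, ?_, ?_⟩
  · rw [Equiv.Perm.mem_alternatingGroup, map_mul, Equiv.Perm.sign_swap hcd,
      Equiv.Perm.sign_swap (Ne.symm hmc)]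
    rfl
  · rw [Equiv.Perm.mul_apply, Equiv.swap_apply_of_ne_of_ne hac had,
      Equiv.swap_apply_of_ne_of_ne hac (Ne.symm hma)]
  · rw [Equiv.Perm.mul_apply, Equiv.swap_apply_of_ne_of_ne hbc hbd,
      Equiv.swap_apply_of_ne_of_ne hbc (Ne.symm hmb)]
  · rw [Equiv.Perm.mul_apply, Equiv.swap_apply_left,
      Equiv.swap_apply_of_ne_of_ne (Ne.symm hcd) (Ne.symm hmd)]

end SevenPoints

end PlaneCurve

/-- Zarhin, Proposition 5 (`General`): let `E : F = 0` be an absolutely irreducible plane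
cubic over `K`, and let `B` be a 7-element subset of `E(Ka)` (given by nonzero, pairwise
non-proportional vectors `p i ∈ Ka³` with `F(p i) = 0`) which is stable under
`Gal(Ka/K)`, forms a single Galois orbit, and on which the Galois group acts through the
full symmetric group `S₇` or the alternating group `A₇`. Then `B` is in general position:
no three of the points lie on a line and no six lie on a conic. -/
theorem statement15 {K Ka : Type*} [Field K] [Field Ka] [Algebra K Ka] [IsAlgClosure K Ka]
    (F : MvPolynomial (Fin 3) K) (hF3 : F.IsHomogeneous 3)
    (hFirr : Irreducible (MvPolynomial.map (algebraMap K Ka) F))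
    (p : Fin 7 → (Fin 3 → Ka))
    (hnz : ∀ i, p i ≠ 0)
    (honE : ∀ i, MvPolynomial.aeval (p i) F = 0)
    (hnp : ∀ i j, i ≠ j → ∀ lam : Ka, p j ≠ lam • p i)
    (hstable : ∀ σ : Ka ≃ₐ[K] Ka, ∃ π : Equiv.Perm (Fin 7),
      ∀ i, ∃ lam : Ka, lam ≠ 0 ∧ (fun m => σ (p i m)) = lam • p (π i))
    (horbit : ∀ i j : Fin 7, ∃ σ : Ka ≃ₐ[K] Ka, ∃ lam : Ka, lam ≠ 0 ∧
      (fun m => σ (p i m)) = lam • p j)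
    (hbig : {π : Equiv.Perm (Fin 7) | ∃ σ : Ka ≃ₐ[K] Ka,
        ∀ i, ∃ lam : Ka, lam ≠ 0 ∧ (fun m => σ (p i m)) = lam • p (π i)} = Set.univ ∨
      {π : Equiv.Perm (Fin 7) | ∃ σ : Ka ≃ₐ[K] Ka,
        ∀ i, ∃ lam : Ka, lam ≠ 0 ∧ (fun m => σ (p i m)) = lam • p (π i)} =
        ↑(alternatingGroup (Fin 7))) :
    (¬ ∃ l : MvPolynomial (Fin 3) Ka, l.IsHomogeneous 1 ∧ l ≠ 0 ∧
      ∃ i₁ i₂ i₃ : Fin 7, i₁ ≠ i₂ ∧ i₁ ≠ i₃ ∧ i₂ ≠ i₃ ∧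
        eval (p i₁) l = 0 ∧ eval (p i₂) l = 0 ∧ eval (p i₃) l = 0) ∧
    (¬ ∃ q : MvPolynomial (Fin 3) Ka, q.IsHomogeneous 2 ∧ q ≠ 0 ∧
      ∃ s : Finset (Fin 7), s.card = 6 ∧ ∀ i ∈ s, eval (p i) q = 0) := by
  have hF : (map (algebraMap K Ka) F).IsHomogeneous 3 := hF3.map _
  have hFp (i) : eval (p i) (map (algebraMap K Ka) F) = 0 := by
    rw [eval_map, ← aeval_def]; exact honE i
  have heven : ∀ π ∈ alternatingGroup (Fin 7), ∃ σ : Ka ≃ₐ[K] Ka,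
      ∀ i, ∃ lam : Ka, lam ≠ 0 ∧ (fun m => σ (p i m)) = lam • p (π i) := by
    intro π hπ
    rcases hbig with h | h
    · exact h.ge (Set.mem_univ π)
    · exact h.ge hπ
  have hmove {n : ℕ} {f : MvPolynomial (Fin 3) Ka} (hf : f.IsHomogeneous n) (hf0 : f ≠ 0)
      {π : Equiv.Perm (Fin 7)} (hπ : π ∈ alternatingGroup (Fin 7)) :
      ∃ g : MvPolynomial (Fin 3) Ka, g.IsHomogeneous n ∧ g ≠ 0 ∧
        ∀ i, eval (p i) f = 0 → eval (p (π i)) g = 0 := by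
    obtain ⟨σ, hσ⟩ := heven π hπ
    refine ⟨map (σ : Ka →+* Ka) f, hf.map _, ?_, fun i hi => ?_⟩
    · exact (map_ne_zero_iff _ (map_injective _ σ.injective)).2 hf0
    · obtain ⟨a, ha, h⟩ := hσ i
      exact PlaneCurve.eval_map_eq_zero hf (σ : Ka →+* Ka) ha h hi
  have hcol : ¬ ∃ l : MvPolynomial (Fin 3) Ka, l.IsHomogeneous 1 ∧ l ≠ 0 ∧
      ∃ i₁ i₂ i₃ : Fin 7, i₁ ≠ i₂ ∧ i₁ ≠ i₃ ∧ i₂ ≠ i₃ ∧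
        eval (p i₁) l = 0 ∧ eval (p i₂) l = 0 ∧ eval (p i₃) l = 0 := by
    rintro ⟨l, hl, hl0, a, b, c, hab, hac, hbc, ha, hb, hc⟩
    refine PlaneCurve.not_irreducible_of_line hnz hnp hF hl hl0 hFp (fun d => ?_) hFirr
    by_cases had : a = d
    · exact had ▸ ha
    by_cases hbd : b = d
    · exact hbd ▸ hb
    by_cases hcd : c = d
    · exact hcd ▸ hc
    obtain ⟨π, hπ, hπa, hπb, hπc⟩ := PlaneCurve.exists_even_perm_of_ne hac had hbc hbd hcd
    obtain ⟨l', hl', hl0', hvan⟩ := hmove hl hl0 hπ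
    exact PlaneCurve.eval_line_eq_zero (hnz a) (hnz b) (hnp a b hab) (hnp b a hab.symm) hl hl' hl0'
      ha hb (hπa ▸ hvan a ha) (hπb ▸ hvan b hb) (hπc ▸ hvan c hc)
  refine ⟨hcol, ?_⟩
  rintro ⟨q, hq, hq0, s, hs, hqs⟩
  obtain ⟨a, ha⟩ : ∃ a, sᶜ = {a} := Finset.card_eq_one.1 (by simp [Finset.card_compl, hs])
  have hqa (i) (hi : i ≠ a) : eval (p i) q = 0 :=
    hqs i (by by_contra h; exact hi (by simpa [ha] using Finset.mem_compl.2 h))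
  obtain ⟨r, hr, hr0, hvan⟩ := hmove hq hq0 (π := Equiv.addRight 1)
    (by rw [Equiv.Perm.mem_alternatingGroup]; decide)
  refine PlaneCurve.not_irreducible_of_conic hnz hnp hcol hF hq hq0 hFp (fun i => ?_) hFirr
  by_cases hi : i = a
  · subst hi
    refine PlaneCurve.eval_conic_eq_zero hnz hnp hcol hq hr hr0 hqa fun j hj => ?_
    simpa using hvan (j - 1) (hqa _ fun h => hj (by rw [← h, sub_add_cancel]))
  · exact hqa i hi
end

section
/- Let K be a field with algebraic closure K_a and let F ∈ K[x,y,z] be a homogeneous form of degree 3 irreducible in K_a[x,y,z]. Let p : Fin 7 → K_a³ assign to each index a nonzero vector with F(pᵢ) = 0, the pᵢ pairwise non-proportional. Assume that for every σ ∈ Gal(K_a/K) there exist a permutation π_σ of Fin 7 and nonzero scalars λᵢ ∈ K_a with σ(pᵢ) = λᵢ · p_{π_σ(i)} coordinatewise for all i, and that the set of permutations π_σ arising this way is the full symmetric group on Fin 7 or the alternating group A₇. Then no three of the seven points lie on a line: no nonzero homogeneous linear form in K_a[x,y,z] vanishes at pᵢ for three distinct indices i. -/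
open MvPolynomial

section

variable {k : Type*} [Field k] {τ : Type*}

theorem MvPolynomial.IsHomogeneous.eval_smul_eq {G : MvPolynomial τ k} {n : ℕ}
    (hG : G.IsHomogeneous n) (c : k) (x : τ → k) : eval (c • x) G = c ^ n * eval x G := by
  rw [eval_eq, eval_eq, Finset.mul_sum]
  refine Finset.sum_congr rfl fun d hd => ?_
  have hdeg : ∑ i ∈ d.support, d i = n := hG.degree_eq_sum_deg_support hd |>.symm
  simp only [Pi.smul_apply, smul_eq_mul, mul_pow, Finset.prod_mul_distrib,
    Finset.prod_pow_eq_pow_sum, hdeg]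
  ring

/-- Evaluation of a linear form, as a linear functional. -/
theorem MvPolynomial.IsHomogeneous.exists_linearMap_eval_eq {l : MvPolynomial τ k}
    (hl : l.IsHomogeneous 1) : ∃ φ : (τ → k) →ₗ[k] k, ∀ x, φ x = eval x l := by
  have hmem : l ∈ Submodule.span k (Set.range (X : τ → MvPolynomial τ k)) := by
    rw [← homogeneousSubmodule_one_eq_span_X]
    exact hl
  clear hl
  induction hmem using Submodule.span_induction with
  | mem x hx =>
    obtain ⟨i, rfl⟩ := hx
    exact ⟨LinearMap.proj i, by simp⟩
  | zero => exact ⟨0, by simp⟩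
  | add a b _ _ ha hb =>
    obtain ⟨φ, hφ⟩ := ha
    obtain ⟨ψ, hψ⟩ := hb
    exact ⟨φ + ψ, by simp [hφ, hψ]⟩
  | smul c a _ ha =>
    obtain ⟨φ, hφ⟩ := ha
    exact ⟨c • φ, by simp [hφ, smul_eval]⟩

/-- A form of degree `n` with more than `n` zeros on the affine line `a ↦ a • u + v`, and
vanishing at `u`, vanishes on the plane spanned by `u` and `v`. -/
theorem MvPolynomial.IsHomogeneous.eval_eq_zero_of_mem_span_pair {G : MvPolynomial τ k} {n : ℕ}
    (hG : G.IsHomogeneous n) {u v : τ → k} (s : Finset k) (hcard : n < s.card)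
    (hs : ∀ a ∈ s, eval (a • u + v) G = 0) (hu : eval u G = 0) {x : τ → k}
    (hx : x ∈ Submodule.span k {u, v}) : eval x G = 0 := by
  let f : Polynomial k :=
    MvPolynomial.aeval (fun m => Polynomial.C (u m) * Polynomial.X + Polynomial.C (v m)) G
  have heval (a : k) : f.eval a = eval (a • u + v) G := by
    have h : (Polynomial.aeval a).comp
        (MvPolynomial.aeval fun m => Polynomial.C (u m) * Polynomial.X + Polynomial.C (v m)) =
        MvPolynomial.aeval (a • u + v) := by
      refine MvPolynomial.algHom_ext fun m => ?_
      simp only [AlgHom.comp_apply, aeval_X, map_add, map_mul, Polynomial.aeval_C,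
        Polynomial.aeval_X, Algebra.algebraMap_self_apply, Pi.add_apply, Pi.smul_apply, smul_eq_mul]
      ring
    simpa [f] using congr($h G)
  have hdeg : f.natDegree ≤ n * 1 :=
    aeval_natDegree_le G hG.totalDegree_le _ fun m => Polynomial.natDegree_linear_le
  have hf : f = 0 := Polynomial.eq_zero_of_natDegree_lt_card_of_eval_eq_zero' f s
    (fun a ha => by rw [heval, hs a ha]) (by omega)
  obtain ⟨a, b, rfl⟩ := Submodule.mem_span_pair.1 hx
  by_cases hb : b = 0
  · simp [hb, hG.eval_smul_eq, hu]
  · have h : a • u + b • v = b • ((a / b) • u + v) := by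
      rw [smul_add, smul_smul, mul_div_cancel₀ _ hb]
    rw [h, hG.eval_smul_eq, ← heval, hf, Polynomial.eval_zero, mul_zero]

/-- An irreducible polynomial divides every polynomial vanishing on its zero set. -/
theorem MvPolynomial.dvd_of_irreducible_of_forall_eval_eq_zero [IsAlgClosed k] [Finite τ]
    {l G : MvPolynomial τ k} (hl : Irreducible l)
    (h : ∀ x, eval x l = 0 → eval x G = 0) : l ∣ G := by
  have := (Ideal.span_singleton_prime hl.ne_zero).2 hl.prime
  rw [← Ideal.mem_span_singleton, ← IsPrime.vanishingIdeal_zeroLocus (K := k) (Ideal.span {l})]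
  intro x hx
  simpa using h x (by simpa using hx l (Ideal.mem_span_singleton_self l))

end

theorem LinearMap.ker_eq_span_pair {k : Type*} [Field k] {φ : (Fin 3 → k) →ₗ[k] k} (hφ : φ ≠ 0)
    {u v : Fin 3 → k} (huv : LinearIndependent k ![u, v]) (hu : φ u = 0) (hv : φ v = 0) :
    LinearMap.ker φ = Submodule.span k {u, v} := by
  symm
  apply Submodule.eq_of_le_of_finrank_le
  · rw [Submodule.span_le]
    rintro x (rfl | rfl)
    · exact hu
    · exact hv
  · have h1 := Module.Dual.finrank_ker_add_one_of_ne_zero hφ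
    have h2 := finrank_span_eq_card huv
    rw [Matrix.range_cons_cons_empty, Fintype.card_fin] at h2
    rw [Module.finrank_fin_fun] at h1
    omega

theorem Equiv.Perm.exists_mem_alternatingGroup_fix_pair {α : Type*} [Fintype α] [DecidableEq α]
    (hα : 5 ≤ Fintype.card α) {a b c d : α} (hac : a ≠ c) (hbc : b ≠ c)
    (had : a ≠ d) (hbd : b ≠ d) :
    ∃ π ∈ alternatingGroup α, π a = a ∧ π b = b ∧ π c = d := by
  by_cases hcd : c = d
  · exact ⟨1, one_mem _, rfl, rfl, hcd⟩
  obtain ⟨m, -, hm⟩ := Finset.exists_mem_notMem_of_card_lt_card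
    (s := {a, b, c, d}) (t := Finset.univ) (Finset.card_le_four.trans_lt (by rw [Finset.card_univ]; omega))
  simp only [Finset.mem_insert, Finset.mem_singleton, not_or] at hm
  obtain ⟨hma, hmb, hmc, hmd⟩ := hm
  refine ⟨swap c m * swap c d, ?_, ?_, ?_, ?_⟩
  · simp [mem_alternatingGroup, sign_swap hcd, sign_swap (Ne.symm hmc)]
  · simp [swap_apply_of_ne_of_ne, hac, had, Ne.symm hma]
  · simp [swap_apply_of_ne_of_ne, hbc, hbd, Ne.symm hmb]
  · simp [swap_apply_of_ne_of_ne, Ne.symm hcd, Ne.symm hmd]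

/-- Step 1 of Zarhin's Proposition 5: if `B` is a Galois-stable 7-element subset of an
absolutely irreducible plane cubic `E : F = 0` over `K` on which `Gal(Ka/K)` acts through
`S₇` or `A₇`, then no three of the seven points lie on a line. -/
theorem statement16 {K Ka : Type*} [Field K] [Field Ka] [Algebra K Ka] [IsAlgClosure K Ka]
    (F : MvPolynomial (Fin 3) K) (hF3 : F.IsHomogeneous 3)
    (hFirr : Irreducible (MvPolynomial.map (algebraMap K Ka) F))
    (p : Fin 7 → (Fin 3 → Ka))
    (hnz : ∀ i, p i ≠ 0)
    (honE : ∀ i, MvPolynomial.aeval (p i) F = 0)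
    (hnp : ∀ i j, i ≠ j → ∀ lam : Ka, p j ≠ lam • p i)
    (hstable : ∀ σ : Ka ≃ₐ[K] Ka, ∃ π : Equiv.Perm (Fin 7),
      ∀ i, ∃ lam : Ka, lam ≠ 0 ∧ (fun m => σ (p i m)) = lam • p (π i))
    (hbig : {π : Equiv.Perm (Fin 7) | ∃ σ : Ka ≃ₐ[K] Ka,
        ∀ i, ∃ lam : Ka, lam ≠ 0 ∧ (fun m => σ (p i m)) = lam • p (π i)} = Set.univ ∨
      {π : Equiv.Perm (Fin 7) | ∃ σ : Ka ≃ₐ[K] Ka,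
        ∀ i, ∃ lam : Ka, lam ≠ 0 ∧ (fun m => σ (p i m)) = lam • p (π i)} =
        ↑(alternatingGroup (Fin 7))) :
    ¬ ∃ l : MvPolynomial (Fin 3) Ka, l.IsHomogeneous 1 ∧ l ≠ 0 ∧
      ∃ i₁ i₂ i₃ : Fin 7, i₁ ≠ i₂ ∧ i₁ ≠ i₃ ∧ i₂ ≠ i₃ ∧
        eval (p i₁) l = 0 ∧ eval (p i₂) l = 0 ∧ eval (p i₃) l = 0 := by
  classical
  have : IsAlgClosed Ka := IsAlgClosure.isAlgClosed K
  rintro ⟨l, hl, hl0, i₁, i₂, i₃, h12, h13, h23, hl1, hl2, hl3⟩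
  obtain ⟨φ, hφ⟩ := hl.exists_linearMap_eval_eq
  have hφ0 : φ ≠ 0 := by
    rintro rfl
    exact hl0 (MvPolynomial.funext fun x => by simp [← hφ])
  have hind : LinearIndependent Ka ![p i₁, p i₂] :=
    (LinearIndependent.pair_iff' (hnz i₁)).2 fun a => (hnp i₁ i₂ h12 a).symm
  have hker := LinearMap.ker_eq_span_pair hφ0 hind (by rw [hφ, hl1]) (by rw [hφ, hl2])
  have hspan3 : p i₃ ∈ Submodule.span Ka {p i₁, p i₂} := by
    rw [← hker, LinearMap.mem_ker, hφ, hl3]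
  have hspan (j : Fin 7) : p j ∈ Submodule.span Ka {p i₁, p i₂} := by
    by_cases hj1 : i₁ = j
    · exact Submodule.subset_span (by simp [hj1])
    by_cases hj2 : i₂ = j
    · exact Submodule.subset_span (by simp [hj2])
    obtain ⟨π, hπ, hπ1, hπ2, hπ3⟩ := Equiv.Perm.exists_mem_alternatingGroup_fix_pair
      (by simp) h13 h23 hj1 hj2
    have hπσ : π ∈ {π : Equiv.Perm (Fin 7) | ∃ σ : Ka ≃ₐ[K] Ka,
        ∀ i, ∃ lam : Ka, lam ≠ 0 ∧ (fun m => σ (p i m)) = lam • p (π i)} := by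
      rcases hbig with h | h
      · rw [h]; trivial
      · rw [h]; exact hπ
    obtain ⟨σ, hσ⟩ := hπσ
    obtain ⟨c₁, -, hc₁⟩ := hσ i₁
    obtain ⟨c₂, -, hc₂⟩ := hσ i₂
    obtain ⟨c₃, hc₃0, hc₃⟩ := hσ i₃
    rw [hπ1] at hc₁
    rw [hπ2] at hc₂
    rw [hπ3] at hc₃
    obtain ⟨a, b, hab⟩ := Submodule.mem_span_pair.1 hspan3
    rw [← Submodule.smul_mem_iff _ hc₃0]
    refine Submodule.mem_span_pair.2 ⟨σ a * c₁, σ b * c₂, ?_⟩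
    rw [mul_smul, mul_smul, ← hc₁, ← hc₂, ← hc₃, ← hab]
    ext m
    simp
  choose a b hab using fun j => Submodule.mem_span_pair.1 (hspan j)
  have hb0 (j : Fin 7) (hj : j ≠ i₁) : b j ≠ 0 := fun h =>
    hnp i₁ j hj.symm (a j) (by rw [← hab j, h]; simp)
  have hpj (j : Fin 7) (hj : j ≠ i₁) : p j = b j • ((a j / b j) • p i₁ + p i₂) := by
    rw [smul_add, smul_smul, mul_div_cancel₀ _ (hb0 j hj), hab]
  set G := MvPolynomial.map (algebraMap K Ka) F with hGdef
  have hG : G.IsHomogeneous 3 := hF3.map _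
  have hGp (j : Fin 7) : eval (p j) G = 0 := by
    rw [hGdef, eval_map, ← aeval_def, honE]
  have hinj : Set.InjOn (fun j => a j / b j) (Finset.univ.erase i₁ : Finset (Fin 7)) := by
    intro i hi j hj hij
    have hi : i ≠ i₁ := by simpa using hi
    have hj : j ≠ i₁ := by simpa using hj
    by_contra hne
    refine hnp i j hne (b j / b i) ?_
    rw [hpj i hi, hpj j hj, smul_smul, div_mul_cancel₀ _ (hb0 i hi)]
    exact congr(b j • ($hij.symm • p i₁ + p i₂))
  have hvan (x : Fin 3 → Ka) (hx : eval x l = 0) : eval x G = 0 := by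
    refine hG.eval_eq_zero_of_mem_span_pair
      ((Finset.univ.erase i₁).image fun j => a j / b j) ?_ ?_ (hGp i₁)
      (by rw [← hker, LinearMap.mem_ker, hφ, hx])
    · rw [Finset.card_image_of_injOn hinj]
      simp
    · intro c hc
      obtain ⟨j, hj, rfl⟩ := Finset.mem_image.1 hc
      have hj : j ≠ i₁ := by simpa using hj
      have h := hGp j
      rw [hpj j hj, hG.eval_smul_eq] at h
      exact (mul_eq_zero.1 h).resolve_left (pow_ne_zero _ (hb0 j hj))
  have hldeg : l.totalDegree = 1 := hl.totalDegree hl0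
  have hlirr : Irreducible l := by
    refine irreducible_of_totalDegree_eq_one hldeg fun c hc => ?_
    obtain ⟨d, hd⟩ := ne_zero_iff.1 hl0
    exact isUnit_iff_ne_zero.2 fun h => hd (zero_dvd_iff.1 (h ▸ hc d))
  obtain ⟨q, hq⟩ := (hlirr.dvd_symm hFirr (dvd_of_irreducible_of_forall_eval_eq_zero hlirr hvan))
  have hle := totalDegree_le_of_dvd_of_isDomain ⟨q, hq⟩ hl0
  rw [hldeg, hG.totalDegree hFirr.ne_zero] at hle
  omega
end

section
/- Let K be a field with algebraic closure K_a and let F ∈ K[x,y,z] be a homogeneous form of degree 3 irreducible in K_a[x,y,z]. Let p : Fin 7 → K_a³ assign to each index a nonzero vector with F(pᵢ) = 0, the pᵢ pairwise non-proportional. Assume that for every σ ∈ Gal(K_a/K) there exist a permutation π_σ of Fin 7 and nonzero scalars λᵢ ∈ K_a with σ(pᵢ) = λᵢ · p_{π_σ(i)} coordinatewise for all i, and that the set of permutations π_σ arising this way is the full symmetric group on Fin 7 or the alternating group A₇. Then no six of the seven points lie on a conic: no nonzero homogeneous quadratic form in K_a[x,y,z] vanishes at pᵢ for six distinct indices i.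 -/
open MvPolynomial

open Matrix in
/-- The linear form cutting out the line through `u` and `v`. -/
noncomputable def lineForm {k : Type*} [Field k] (u v : Fin 3 → k) : MvPolynomial (Fin 3) k :=
  ∑ m, C ((u ⨯₃ v) m) * X m

section forms

open Matrix

variable {k : Type*} [Field k]

theorem lineForm_isHomogeneous (u v : Fin 3 → k) : (lineForm u v).IsHomogeneous 1 :=
  IsHomogeneous.sum _ _ _ fun m _ => isHomogeneous_C_mul_X _ m

theorem eval_lineForm (u v w : Fin 3 → k) : eval w (lineForm u v) = (u ⨯₃ v) ⬝ᵥ w := by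
  simp [lineForm, dotProduct]

@[simp]
theorem eval_lineForm_left (u v : Fin 3 → k) : eval u (lineForm u v) = 0 := by
  rw [eval_lineForm, dotProduct_comm, dot_self_cross]

@[simp]
theorem eval_lineForm_right (u v : Fin 3 → k) : eval v (lineForm u v) = 0 := by
  rw [eval_lineForm, dotProduct_comm, dot_cross_self]

theorem cross_ne_zero_of_not_proportional {u v : Fin 3 → k} (hu : u ≠ 0)
    (h : ∀ c : k, v ≠ c • u) : u ⨯₃ v ≠ 0 := by
  rw [crossProduct_ne_zero_iff_linearIndependent, LinearIndependent.pair_iff' hu]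
  exact fun a ha => h a ha.symm

/-- Two non-proportional vectors are separated by a linear form. -/
theorem exists_linear_form_separating {u v : Fin 3 → k} (h : u ⨯₃ v ≠ 0) :
    ∃ l : MvPolynomial (Fin 3) k, l.IsHomogeneous 1 ∧ eval v l = 0 ∧ eval u l ≠ 0 := by
  obtain ⟨m, hm⟩ := Function.ne_iff.1 h
  refine ⟨lineForm v (Pi.single m 1), lineForm_isHomogeneous _ _, by simp, ?_⟩
  rw [eval_lineForm, dotProduct_comm, triple_product_permutation,
    triple_product_permutation, single_one_dotProduct]
  exact hm

theorem lineForm_ne_zero {u v : Fin 3 → k} (h : u ⨯₃ v ≠ 0) : lineForm u v ≠ 0 := by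
  obtain ⟨m, hm⟩ := Function.ne_iff.1 h
  intro h0
  have := eval_lineForm u v (Pi.single m 1)
  rw [h0, map_zero, dotProduct_single_one] at this
  exact hm this.symm

theorem finrank_homogeneousSubmodule_s17 (n : ℕ) :
    Module.finrank k (homogeneousSubmodule (Fin 3) k n) = (3 + n - 1).choose n := by
  rw [homogeneousSubmodule_eq_finsupp_supported,
    (AddMonoidAlgebra.supportedEquivFinsupp _).finrank_eq]
  have e : {d : Fin 3 →₀ ℕ | d.degree = n} =
      ((Finset.univ : Finset (Fin 3)).finsuppAntidiag n : Set (Fin 3 →₀ ℕ)) := by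
    ext d
    simp [Finsupp.degree_eq_sum]
  rw [e]
  change Module.finrank k (((Finset.univ : Finset (Fin 3)).finsuppAntidiag n) →₀ k) = _
  rw [Module.finrank_finsupp_self, Fintype.card_coe, Finset.card_finsuppAntidiag_nat_eq_choose]
  simp

instance finite_homogeneousSubmodule (n : ℕ) :
    Module.Finite k (homogeneousSubmodule (Fin 3) k n) :=
  Module.Finite.iff_fg.2 (homogeneousSubmodule_fg (Fin 3) k n)

/-- If the points `r i` impose independent conditions on forms of degree `d + e`, and their number
is the codimension of the multiples of `h` in that degree, then every form of degree `d + e`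
vanishing at these points is a multiple of the form `h` vanishing at them. -/
theorem exists_eq_mul_of_independent_conditions {ι : Type*} [Fintype ι] {d e : ℕ}
    (r : ι → Fin 3 → k) {h f : MvPolynomial (Fin 3) k}
    (hind : ∀ i, ∃ g : MvPolynomial (Fin 3) k, g.IsHomogeneous (d + e) ∧ eval (r i) g ≠ 0 ∧
      ∀ j, j ≠ i → eval (r j) g = 0)
    (hdim : (3 + (d + e) - 1).choose (d + e) = Fintype.card ι + (3 + e - 1).choose e)
    (hh : h.IsHomogeneous d) (hh0 : h ≠ 0) (hhr : ∀ i, eval (r i) h = 0)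
    (hf : f.IsHomogeneous (d + e)) (hfr : ∀ i, eval (r i) f = 0) :
    ∃ g : MvPolynomial (Fin 3) k, g.IsHomogeneous e ∧ f = h * g := by
  classical
  let ev : homogeneousSubmodule (Fin 3) k (d + e) →ₗ[k] (ι → k) :=
    LinearMap.pi fun i => (aeval (r i)).toLinearMap ∘ₗ Submodule.subtype _
  have hev : ∀ x i, ev x i = eval (r i) x.1 := fun x i => by
    simp [ev]
  let mu : homogeneousSubmodule (Fin 3) k e →ₗ[k] homogeneousSubmodule (Fin 3) k (d + e) :=
    (LinearMap.mulLeft k h).restrict fun x hx => hh.mul hx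
  have hmu : ∀ x, (mu x).1 = h * x.1 := fun x => rfl
  have hinj : Function.Injective mu := fun x y hxy =>
    Subtype.ext (mul_left_cancel₀ hh0 (by rw [← hmu, ← hmu, hxy]))
  have hsurj : LinearMap.range ev = ⊤ := by
    rw [eq_top_iff, ← (Pi.basisFun k ι).span_eq, Submodule.span_le]
    rintro _ ⟨i, rfl⟩
    obtain ⟨g, hg, hgi, hgj⟩ := hind i
    refine ⟨(eval (r i) g)⁻¹ • ⟨g, hg⟩, ?_⟩
    ext j
    rw [map_smul, Pi.smul_apply, hev, Pi.basisFun_apply]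
    obtain rfl | hj := eq_or_ne j i
    · simp [hgi]
    · simp [hgj j hj, hj]
  have hle : LinearMap.range mu ≤ LinearMap.ker ev := by
    rintro _ ⟨x, rfl⟩
    ext i
    simp [hev, hmu, hhr]
  have hker := ev.finrank_range_add_finrank_ker
  rw [hsurj, finrank_top, Module.finrank_fintype_fun_eq_card,
    finrank_homogeneousSubmodule_s17, hdim] at hker
  have hrange := LinearMap.finrank_range_of_inj hinj
  rw [finrank_homogeneousSubmodule_s17] at hrange
  have heq := Submodule.eq_of_le_of_finrank_eq hle (by lia)
  have hfk : (⟨f, hf⟩ : homogeneousSubmodule (Fin 3) k (d + e)) ∈ LinearMap.ker ev := by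
    ext i
    simp [hev, hfr]
  rw [← heq] at hfk
  obtain ⟨g, hg⟩ := hfk
  exact ⟨g.1, g.2, by rw [← hmu, hg]⟩

/-- A product of two forms of positive degree is reducible. -/
theorem not_irreducible_mul_of_isHomogeneous {d e : ℕ} {g h : MvPolynomial (Fin 3) k}
    (hh : h.IsHomogeneous d) (hg : g.IsHomogeneous e) (hd : d ≠ 0) (he : e ≠ 0) :
    ¬ Irreducible (h * g) := by
  intro hirr
  have key : ∀ {n : ℕ} {f : MvPolynomial (Fin 3) k}, f.IsHomogeneous n → n ≠ 0 → ¬ IsUnit f := by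
    intro n f hf hn hu
    refine (MvPolynomial.isUnit_iff.1 hu).1.ne_zero (hf.coeff_eq_zero ?_)
    simpa using hn.symm
  exact (hirr.isUnit_or_isUnit rfl).elim (key hh hd) (key hg he)

theorem eval_smul_of_isHomogeneous {n : ℕ} {f : MvPolynomial (Fin 3) k} (hf : f.IsHomogeneous n)
    (c : k) (x : Fin 3 → k) : eval (c • x) f = c ^ n * eval x f := by
  rw [eval_eq, eval_eq, Finset.mul_sum]
  refine Finset.sum_congr rfl fun d hd => ?_
  have : ∑ i ∈ d.support, d i = n := by
    rw [← Finsupp.degree_apply]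
    by_contra hne
    exact mem_support_iff.1 hd (hf.coeff_eq_zero hne)
  simp only [Pi.smul_apply, smul_eq_mul, mul_pow, Finset.prod_mul_distrib,
    Finset.prod_pow_eq_pow_sum, this]
  ring

/-- Five points, no three collinear, impose independent conditions on conics. -/
theorem exists_conic_separating {r : Fin 5 → Fin 3 → k}
    (hr : ∀ i j l, i ≠ j → i ≠ l → j ≠ l → (r i ⨯₃ r j) ⬝ᵥ r l ≠ 0) (i : Fin 5) :
    ∃ g : MvPolynomial (Fin 3) k, g.IsHomogeneous 2 ∧ eval (r i) g ≠ 0 ∧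
      ∀ j, j ≠ i → eval (r j) g = 0 := by
  refine ⟨lineForm (r (i + 1)) (r (i + 2)) * lineForm (r (i + 3)) (r (i + 4)),
    (lineForm_isHomogeneous _ _).mul (lineForm_isHomogeneous _ _), ?_, fun j hj => ?_⟩
  · simp only [map_mul, eval_lineForm]
    refine mul_ne_zero (hr _ _ _ ?_ ?_ ?_) (hr _ _ _ ?_ ?_ ?_) <;> revert i <;> decide
  · have : j = i + 1 ∨ j = i + 2 ∨ j = i + 3 ∨ j = i + 4 := by revert i j; decide
    rcases this with rfl | rfl | rfl | rfl <;> simp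

/-- Seven points, no three collinear, impose independent conditions on cubics. -/
theorem exists_cubic_separating {r : Fin 7 → Fin 3 → k}
    (hr : ∀ i j l, i ≠ j → i ≠ l → j ≠ l → (r i ⨯₃ r j) ⬝ᵥ r l ≠ 0) (i : Fin 7) :
    ∃ g : MvPolynomial (Fin 3) k, g.IsHomogeneous 3 ∧ eval (r i) g ≠ 0 ∧
      ∀ j, j ≠ i → eval (r j) g = 0 := by
  refine ⟨lineForm (r (i + 1)) (r (i + 2)) * lineForm (r (i + 3)) (r (i + 4)) *
      lineForm (r (i + 5)) (r (i + 6)),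
    ((lineForm_isHomogeneous _ _).mul (lineForm_isHomogeneous _ _)).mul
      (lineForm_isHomogeneous _ _), ?_, fun j hj => ?_⟩
  · simp only [map_mul, eval_lineForm]
    refine mul_ne_zero (mul_ne_zero (hr _ _ _ ?_ ?_ ?_) (hr _ _ _ ?_ ?_ ?_)) (hr _ _ _ ?_ ?_ ?_)
      <;> revert i <;> decide
  · have : j = i + 1 ∨ j = i + 2 ∨ j = i + 3 ∨ j = i + 4 ∨ j = i + 5 ∨ j = i + 6 := by
      revert i j; decide
    rcases this with rfl | rfl | rfl | rfl | rfl | rfl <;> simp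

/-- Four distinct points impose independent conditions on cubics. -/
theorem exists_cubic_separating_four {r : Fin 4 → Fin 3 → k}
    (hr : ∀ i j, i ≠ j → r i ⨯₃ r j ≠ 0) (i : Fin 4) :
    ∃ g : MvPolynomial (Fin 3) k, g.IsHomogeneous 3 ∧ eval (r i) g ≠ 0 ∧
      ∀ j, j ≠ i → eval (r j) g = 0 := by
  have hsep : ∀ a : Fin 4, a ≠ 0 → ∃ l : MvPolynomial (Fin 3) k, l.IsHomogeneous 1 ∧
      eval (r (i + a)) l = 0 ∧ eval (r i) l ≠ 0 := fun a ha =>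
    exists_linear_form_separating (hr _ _ (by simpa using ha))
  obtain ⟨l₁, h₁, z₁, n₁⟩ := hsep 1 (by decide)
  obtain ⟨l₂, h₂, z₂, n₂⟩ := hsep 2 (by decide)
  obtain ⟨l₃, h₃, z₃, n₃⟩ := hsep 3 (by decide)
  refine ⟨l₁ * l₂ * l₃, (h₁.mul h₂).mul h₃, by simp [n₁, n₂, n₃], fun j hj => ?_⟩
  have : j = i + 1 ∨ j = i + 2 ∨ j = i + 3 := by
    clear hsep z₁ z₂ z₃ n₁ n₂ n₃
    revert i j
    decide
  rcases this with rfl | rfl | rfl <;> simp [z₁, z₂, z₃]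

/-- An irreducible cubic has no four distinct collinear points. -/
theorem not_irreducible_of_four_collinear {f : MvPolynomial (Fin 3) k} (hf : f.IsHomogeneous 3)
    {r : Fin 4 → Fin 3 → k} (hr : ∀ i j, i ≠ j → r i ⨯₃ r j ≠ 0)
    (hcol : ∀ l, (r 0 ⨯₃ r 1) ⬝ᵥ r l = 0) (hfr : ∀ l, eval (r l) f = 0) : ¬ Irreducible f := by
  obtain ⟨g, hg, rfl⟩ := exists_eq_mul_of_independent_conditions (d := 1) (e := 2) r
    (exists_cubic_separating_four hr) (by decide) (lineForm_isHomogeneous (r 0) (r 1))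
    (lineForm_ne_zero (hr 0 1 (by decide)))
    (fun l => by rw [eval_lineForm, hcol]) hf hfr
  exact not_irreducible_mul_of_isHomogeneous (lineForm_isHomogeneous _ _) hg one_ne_zero two_ne_zero

/-- An irreducible cubic meets a conic in no seven points of which no three are collinear. -/
theorem not_irreducible_of_seven_on_conic {f q : MvPolynomial (Fin 3) k} (hf : f.IsHomogeneous 3)
    (hq : q.IsHomogeneous 2) (hq0 : q ≠ 0) {r : Fin 7 → Fin 3 → k}
    (hr : ∀ i j l, i ≠ j → i ≠ l → j ≠ l → (r i ⨯₃ r j) ⬝ᵥ r l ≠ 0)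
    (hqr : ∀ l, eval (r l) q = 0) (hfr : ∀ l, eval (r l) f = 0) : ¬ Irreducible f := by
  obtain ⟨g, hg, rfl⟩ := exists_eq_mul_of_independent_conditions (d := 2) (e := 1) r
    (exists_cubic_separating hr) (by decide) hq hq0 hqr hf hfr
  exact not_irreducible_mul_of_isHomogeneous hq hg two_ne_zero one_ne_zero

/-- A conic through five points, no three collinear, is unique. -/
theorem eval_eq_zero_of_five_common_points {q q' : MvPolynomial (Fin 3) k}
    (hq : q.IsHomogeneous 2) (hq' : q'.IsHomogeneous 2) (hq0 : q ≠ 0) (hq0' : q' ≠ 0)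
    {r : Fin 5 → Fin 3 → k}
    (hr : ∀ i j l, i ≠ j → i ≠ l → j ≠ l → (r i ⨯₃ r j) ⬝ᵥ r l ≠ 0)
    (hqr : ∀ l, eval (r l) q = 0) (hqr' : ∀ l, eval (r l) q' = 0) {x : Fin 3 → k}
    (hx : eval x q' = 0) : eval x q = 0 := by
  obtain ⟨g, hg, rfl⟩ := exists_eq_mul_of_independent_conditions (d := 2) (e := 0) r
    (exists_conic_separating hr) (by decide) hq hq0 hqr hq' hqr'
  rw [totalDegree_eq_zero_iff_eq_C.1 ((totalDegree_zero_iff_isHomogeneous _).2 hg)] at hx hq0'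
  rw [map_mul, eval_C, mul_eq_zero] at hx
  refine hx.resolve_right fun h0 => hq0' ?_
  rw [h0, C_0, mul_zero]

theorem cross_map (s : k →+* k) (u v : Fin 3 → k) :
    (fun m => s (u m)) ⨯₃ (fun m => s (v m)) = fun m => s ((u ⨯₃ v) m) := by
  ext m
  fin_cases m <;> simp [cross_apply]

/-- Collinearity is preserved by field automorphisms and rescaling. -/
theorem triple_eq_zero_of_map (s : k →+* k) {u v w u' v' w' : Fin 3 → k} {a b c : k}
    (ha : a ≠ 0) (hb : b ≠ 0) (hc : c ≠ 0) (hu : (fun m => s (u m)) = a • u')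
    (hv : (fun m => s (v m)) = b • v') (hw : (fun m => s (w m)) = c • w')
    (h : (u ⨯₃ v) ⬝ᵥ w = 0) : (u' ⨯₃ v') ⬝ᵥ w' = 0 := by
  have h' := congrArg s h
  rw [map_zero, RingHom.map_dotProduct] at h'
  change (fun m => s ((u ⨯₃ v) m)) ⬝ᵥ (fun m => s (w m)) = 0 at h'
  rw [← cross_map, hu, hv, hw] at h'
  simpa [ha, hb, hc] using h'

/-- Vanishing of forms is preserved by field automorphisms and rescaling. -/
theorem eval_map_eq_zero (s : k →+* k) {n : ℕ} {q : MvPolynomial (Fin 3) k}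
    (hq : q.IsHomogeneous n) {u u' : Fin 3 → k} {a : k} (ha : a ≠ 0)
    (hu : (fun m => s (u m)) = a • u') (h : eval u q = 0) : eval u' (map s q) = 0 := by
  have h' : eval (a • u') (map s q) = 0 := by
    have := map_eval s u q
    rw [h, map_zero] at this
    rw [← hu]
    exact this.symm
  rw [eval_smul_of_isHomogeneous (hq.map s)] at h'
  exact (mul_eq_zero.1 h').resolve_left (pow_ne_zero _ ha)

end forms

/-- The alternating group on seven letters moves any letter to any other while fixing two. -/
theorem exists_mem_alternatingGroup_fixing (i j a b : Fin 7) (hai : a ≠ i) (haj : a ≠ j)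
    (hbi : b ≠ i) (hbj : b ≠ j) (hab : a ≠ b) :
    ∃ π ∈ alternatingGroup (Fin 7), π i = i ∧ π j = j ∧ π a = b := by
  obtain ⟨m, hm⟩ : ∃ m : Fin 7, m ∉ ({i, j, a, b} : Finset (Fin 7)) := by
    by_contra! h
    have h7 := Finset.card_le_card (fun x _ => h x : Finset.univ ⊆ ({i, j, a, b} : Finset (Fin 7)))
    have := Finset.card_le_four (a := i) (b := j) (c := a) (d := b)
    simp at h7
    lia
  simp only [Finset.mem_insert, Finset.mem_singleton, not_or] at hm
  obtain ⟨hmi, hmj, hma, hmb⟩ := hm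
  refine ⟨Equiv.swap a b * Equiv.swap b m, ?_, ?_, ?_, ?_⟩
  · rw [Equiv.Perm.mem_alternatingGroup, map_mul, Equiv.Perm.sign_swap hab,
      Equiv.Perm.sign_swap (Ne.symm hmb)]
    rfl
  · rw [Equiv.Perm.mul_apply, Equiv.swap_apply_of_ne_of_ne hbi.symm (Ne.symm hmi),
      Equiv.swap_apply_of_ne_of_ne hai.symm hbi.symm]
  · rw [Equiv.Perm.mul_apply, Equiv.swap_apply_of_ne_of_ne hbj.symm (Ne.symm hmj),
      Equiv.swap_apply_of_ne_of_ne haj.symm hbj.symm]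
  · rw [Equiv.Perm.mul_apply, Equiv.swap_apply_of_ne_of_ne hab (Ne.symm hma),
      Equiv.swap_apply_left]

/-- Step 2 of Zarhin's Proposition 5: if `B` is a Galois-stable 7-element subset of an
absolutely irreducible plane cubic `E : F = 0` over `K` on which `Gal(Ka/K)` acts through
`S₇` or `A₇`, then no six of the seven points lie on a conic. -/
theorem statement17 {K Ka : Type*} [Field K] [Field Ka] [Algebra K Ka] [IsAlgClosure K Ka]
    (F : MvPolynomial (Fin 3) K) (hF3 : F.IsHomogeneous 3)
    (hFirr : Irreducible (MvPolynomial.map (algebraMap K Ka) F))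
    (p : Fin 7 → (Fin 3 → Ka))
    (hnz : ∀ i, p i ≠ 0)
    (honE : ∀ i, MvPolynomial.aeval (p i) F = 0)
    (hnp : ∀ i j, i ≠ j → ∀ lam : Ka, p j ≠ lam • p i)
    (hstable : ∀ σ : Ka ≃ₐ[K] Ka, ∃ π : Equiv.Perm (Fin 7),
      ∀ i, ∃ lam : Ka, lam ≠ 0 ∧ (fun m => σ (p i m)) = lam • p (π i))
    (hbig : {π : Equiv.Perm (Fin 7) | ∃ σ : Ka ≃ₐ[K] Ka,
        ∀ i, ∃ lam : Ka, lam ≠ 0 ∧ (fun m => σ (p i m)) = lam • p (π i)} = Set.univ ∨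
      {π : Equiv.Perm (Fin 7) | ∃ σ : Ka ≃ₐ[K] Ka,
        ∀ i, ∃ lam : Ka, lam ≠ 0 ∧ (fun m => σ (p i m)) = lam • p (π i)} =
        ↑(alternatingGroup (Fin 7))) :
    ¬ ∃ q : MvPolynomial (Fin 3) Ka, q.IsHomogeneous 2 ∧ q ≠ 0 ∧
      ∃ s : Finset (Fin 7), s.card = 6 ∧ ∀ i ∈ s, eval (p i) q = 0 := by
  rintro ⟨q, hq, hq0, s, hs, hqs⟩
  have hgal : ∀ π ∈ alternatingGroup (Fin 7), ∃ σ : Ka ≃ₐ[K] Ka,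
      ∀ i, ∃ lam : Ka, lam ≠ 0 ∧ (fun m => σ (p i m)) = lam • p (π i) := by
    intro π hπ
    rcases hbig with h | h
    · exact (Set.ext_iff.1 h π).2 trivial
    · exact (Set.ext_iff.1 h π).2 hπ
  have hFp : ∀ i, eval (p i) (map (algebraMap K Ka) F) = 0 := fun i => by
    rw [eval_map, ← aeval_def, honE]
  have hcross : ∀ i j, i ≠ j → crossProduct (p i) (p j) ≠ 0 := fun i j hij =>
    cross_ne_zero_of_not_proportional (hnz i) (hnp i j hij)
  have hgen : ∀ i j l, i ≠ j → i ≠ l → j ≠ l → crossProduct (p i) (p j) ⬝ᵥ p l ≠ 0 := by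
    intro i j l hij hil hjl h0
    have hall : ∀ b, crossProduct (p i) (p j) ⬝ᵥ p b = 0 := by
      intro b
      by_cases hbi : b = i
      · rw [hbi, dotProduct_comm, dot_self_cross]
      by_cases hbj : b = j
      · rw [hbj, dotProduct_comm, dot_cross_self]
      by_cases hbl : b = l
      · rw [hbl, h0]
      obtain ⟨π, hπ, hπi, hπj, hπl⟩ :=
        exists_mem_alternatingGroup_fixing i j l b hil.symm hjl.symm hbi hbj (Ne.symm hbl)
      obtain ⟨σ, hσ⟩ := hgal π hπ
      obtain ⟨a, ha, hia⟩ := hσ i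
      obtain ⟨b, hb, hjb⟩ := hσ j
      obtain ⟨c, hc, hlc⟩ := hσ l
      rw [hπi] at hia
      rw [hπj] at hjb
      rw [hπl] at hlc
      exact triple_eq_zero_of_map (σ : Ka →+* Ka) ha hb hc hia hjb hlc h0
    obtain ⟨m, hmi, hmj, hml⟩ : ∃ m : Fin 7, m ≠ i ∧ m ≠ j ∧ m ≠ l := by
      clear h0 hall; revert i j l; decide
    refine not_irreducible_of_four_collinear (hF3.map _) (r := ![p i, p j, p l, p m])
      ?_ ?_ ?_ hFirr
    · intro x y hxy
      fin_cases x <;> fin_cases y <;> first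
        | exact absurd rfl hxy
        | exact hcross _ _ (by first | assumption | exact Ne.symm (by assumption))
    · intro x
      fin_cases x <;> exact hall _
    · intro x
      fin_cases x <;> exact hFp _
  obtain ⟨a, ha⟩ : ∃ a, sᶜ = {a} := Finset.card_eq_one.1 (by rw [Finset.card_compl, hs]; rfl)
  have hqa : ∀ i, i ≠ a → eval (p i) q = 0 := fun i hi => hqs i (by
    by_contra h
    rw [← Finset.mem_compl, ha, Finset.mem_singleton] at h
    exact hi h)
  obtain ⟨b, i, hba, hia, hib⟩ : ∃ b i : Fin 7, b ≠ a ∧ i ≠ a ∧ i ≠ b := by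
    clear ha hqa; revert a; decide
  obtain ⟨π, hπ, -, -, hπa⟩ :=
    exists_mem_alternatingGroup_fixing i i a b hia.symm hia.symm hib.symm hib.symm hba.symm
  obtain ⟨σ, hσ⟩ := hgal π hπ
  have hqb : ∀ j, j ≠ b → eval (p j) (map (σ : Ka →+* Ka) q) = 0 := by
    intro j hj
    obtain ⟨c, hc, hcj⟩ := hσ (π.symm j)
    rw [Equiv.apply_symm_apply] at hcj
    refine eval_map_eq_zero (σ : Ka →+* Ka) hq hc hcj (hqa _ fun h => hj ?_)
    rw [← hπa, ← h, Equiv.apply_symm_apply]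
  have hcard : (({a, b} : Finset (Fin 7))ᶜ).card = 5 := by
    rw [Finset.card_compl, Finset.card_pair hba.symm]; rfl
  let e := (({a, b} : Finset (Fin 7))ᶜ).orderEmbOfFin hcard
  have he : ∀ x, e x ≠ a ∧ e x ≠ b := fun x => by
    have := Finset.orderEmbOfFin_mem _ hcard x
    simpa only [Finset.mem_compl, Finset.mem_insert, Finset.mem_singleton, not_or] using this
  have hqa' : eval (p a) q = 0 :=
    eval_eq_zero_of_five_common_points hq (hq.map (σ : Ka →+* Ka)) hq0
      ((map_ne_zero_iff _ (map_injective _ (σ : Ka →+* Ka).injective)).2 hq0)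
      (r := fun x => p (e x))
      (fun x y z hxy hxz hyz => hgen _ _ _ (e.injective.ne hxy) (e.injective.ne hxz)
        (e.injective.ne hyz))
      (fun x => hqa _ (he x).1) (fun x => hqb _ (he x).2) (hqb a hba.symm)
  refine not_irreducible_of_seven_on_conic (hF3.map _) hq hq0 hgen (fun l => ?_) hFp hFirr
  obtain rfl | hl := eq_or_ne l a
  · exact hqa'
  · exact hqa l hl
end
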